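/- For every integer d ≥ 1 there exists ε = ε(d) > 0 with the following property: if K is a field and F is a finite subset of GL_d(K) containing the identity and generating a subgroup which is not virtually solvable (equivalently, by the Tits alternative, non-amenable), then for every finite subset A of GL_d(K) one has |F·A| ≥ (1+ε)·|A|, where F·A = { fa : f ∈ F, a ∈ A }. -/

import Mathlib

open scoped MatrixGroups Pointwise

section
open scoped MatrixGroups Pointwise

namespace UPE

open Classical in
/-- number of points of `A` moved out of `A` by a permutation. -/
noncomputable def esc {Y : Type} (A : Finset Y) (σ : Equiv.Perm Y) : ℕ :=
  (A.filter (fun y => σ y ∉ A)).card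

theorem esc_mul {Y : Type} (A : Finset Y) (σ τ : Equiv.Perm Y) :
    esc A (σ * τ) ≤ esc A σ + esc A τ := by
  classical
  unfold esc
  have h : A.filter (fun y => (σ * τ) y ∉ A) ⊆
      (A.filter (fun y => τ y ∉ A)) ∪ ((A.filter (fun y => σ y ∉ A)).image (τ⁻¹ : Equiv.Perm Y)) := by
    intro y hy
    obtain ⟨hy1, hy2⟩ := Finset.mem_filter.1 hy
    simp only [Finset.mem_filter, Finset.mem_union, Finset.mem_image]
    by_cases h : τ y ∈ A
    · right
      exact ⟨τ y, ⟨h, hy2⟩, by simp⟩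
    · left; exact ⟨hy1, h⟩
  calc _ ≤ _ := Finset.card_le_card h
    _ ≤ _ := Finset.card_union_le _ _
    _ ≤ _ := by rw [add_comm]; exact Nat.add_le_add_right Finset.card_image_le _

theorem esc_one {Y : Type} (A : Finset Y) : esc A (1 : Equiv.Perm Y) = 0 := by
  classical
  unfold esc
  rw [Finset.card_eq_zero, Finset.filter_eq_empty_iff]
  intro y hy; simpa using hy

theorem esc_inv {Y : Type} (A : Finset Y) (σ : Equiv.Perm Y) : esc A σ⁻¹ = esc A σ := by
  classical
  -- |{y∈A, σ y∈A}| is symmetric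
  have key : ∀ τ : Equiv.Perm Y, (A.filter (fun y => τ y ∈ A)).card = (A.filter (fun y => τ⁻¹ y ∈ A)).card := by
    intro τ
    refine Finset.card_bij (fun y _ => τ y) ?_ ?_ ?_
    · intro y hy
      simp only [Finset.mem_filter] at hy ⊢
      exact ⟨hy.2, by simpa using hy.1⟩
    · intro a _ b _ h; exact τ.injective h
    · intro b hb
      simp only [Finset.mem_filter] at hb
      exact ⟨τ⁻¹ b, by simpa [Finset.mem_filter] using hb.symm, by simp⟩
  have h1 := Finset.card_filter_add_card_filter_not (s := A) (fun y => σ y ∈ A)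
  have h2 := Finset.card_filter_add_card_filter_not (s := A) (fun y => σ⁻¹ y ∈ A)
  have h3 := key σ
  unfold esc
  omega

theorem esc_pow {Y : Type} (A : Finset Y) (σ : Equiv.Perm Y) (n : ℕ) :
    esc A (σ ^ n) ≤ n * esc A σ := by
  induction n with
  | zero => simp [esc_one]
  | succ n ih =>
    rw [pow_succ, Nat.succ_mul]
    exact (esc_mul A _ _).trans (Nat.add_le_add_right ih _)

open Classical in
theorem wandering {Y : Type} (A : Finset Y) (σ : Equiv.Perm Y) (D : Set Y) (M T : ℕ)
    (hD : ∀ i, M ≤ i → ∀ y ∈ D, (σ ^ i) y ∉ D) (hM : 1 ≤ M) :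
    T * (A.filter (· ∈ D)).card ≤ A.card + T * (T * (M * esc A σ)) := by
  classical
  set B := A.filter (· ∈ D) with hB
  set Bi : ℕ → Finset Y := fun i => (B.image (σ ^ (M * i) : Equiv.Perm Y)).filter (· ∈ A) with hBi
  have hcard : ∀ i, B.card ≤ (Bi i).card + i * (M * esc A σ) := by
    intro i
    have h1 : B.card = (B.image (σ ^ (M * i) : Equiv.Perm Y)).card :=
      (Finset.card_image_of_injective _ (Equiv.injective _)).symm
    have h2 := Finset.card_filter_add_card_filter_not (s := B.image (σ ^ (M * i) : Equiv.Perm Y)) (fun y => y ∈ A)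
    have h3 : ((B.image (σ ^ (M * i) : Equiv.Perm Y)).filter (fun y => ¬ y ∈ A)).card ≤ esc A (σ ^ (M * i)) := by
      unfold esc
      calc _ ≤ ((A.filter (fun y => (σ ^ (M * i)) y ∉ A)).image (σ ^ (M * i) : Equiv.Perm Y)).card := by
            apply Finset.card_le_card
            intro y hy
            simp only [Finset.mem_filter, Finset.mem_image] at hy ⊢
            obtain ⟨⟨z, hz, rfl⟩, hy⟩ := hy
            exact ⟨z, ⟨(Finset.mem_filter.1 hz).1, hy⟩, rfl⟩
        _ ≤ _ := Finset.card_image_le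
    have h4 := esc_pow A σ (M * i)
    have h6 : (Bi i).card = ((B.image (σ ^ (M * i) : Equiv.Perm Y)).filter (· ∈ A)).card := by
      simp only [hBi]
    have h5 : M * i * esc A σ = i * (M * esc A σ) := by ring
    omega
  have hdisj : ∀ i j, i < j → Disjoint (Bi i) (Bi j) := by
    intro i j hij
    rw [Finset.disjoint_left]
    intro y hy hy'
    simp only [hBi, Finset.mem_filter, Finset.mem_image] at hy hy'
    obtain ⟨⟨z, hz, rfl⟩, -⟩ := hy
    obtain ⟨⟨w, hw, h⟩, -⟩ := hy'
    have hw' := (Finset.mem_filter.1 hw).2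
    have hz' := (Finset.mem_filter.1 hz).2
    have : (σ ^ (M * (j - i))) w = z := by
      apply (σ ^ (M * i)).injective
      rw [← h, ← Equiv.Perm.mul_apply, ← pow_add, ← mul_add]
      congr 3; omega
    refine hD (M * (j - i)) ?_ w hw' (this ▸ hz')
    exact Nat.le_mul_of_pos_right _ (by omega)
  have hU : ∑ i ∈ Finset.range T, (Bi i).card ≤ A.card := by
    rw [← Finset.card_biUnion]
    · apply Finset.card_le_card
      intro y hy
      simp only [Finset.mem_biUnion] at hy
      obtain ⟨i, -, hy⟩ := hy
      exact (Finset.mem_filter.1 hy).2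
    · intro i _ j _ hij
      rcases lt_or_gt_of_ne hij with h | h
      · exact hdisj i j h
      · exact (hdisj j i h).symm
  calc T * B.card = ∑ i ∈ Finset.range T, B.card := by simp
    _ ≤ ∑ i ∈ Finset.range T, ((Bi i).card + T * (M * esc A σ)) := by
        apply Finset.sum_le_sum
        intro i hi
        refine (hcard i).trans ?_
        gcongr
        exact (Finset.mem_range.1 hi).le
    _ = ∑ i ∈ Finset.range T, (Bi i).card + T * (T * (M * esc A σ)) := by
        rw [Finset.sum_add_distrib]; simp
    _ ≤ _ := Nat.add_le_add_right hU _

/-- `x` acts almost invariantly. -/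
def AI {Y K : Type} [Field K] {m : ℕ} (A : Finset Y) (pt : Y → Matrix (Fin m) (Fin m) K) (δ : ℝ)
    (x : Matrix (Fin m) (Fin m) K) : Prop :=
  ∃ σ : Equiv.Perm Y, (∀ y, ∃ c : K, c ≠ 0 ∧ pt (σ y) = c • (x * pt y)) ∧
    (esc A σ : ℝ) ≤ δ * A.card

section
variable {Y K : Type} [Field K] {m : ℕ} {A : Finset Y} {pt : Y → Matrix (Fin m) (Fin m) K}

theorem AI.mul {δ δ' : ℝ} {x y : Matrix (Fin m) (Fin m) K} (hx : AI A pt δ x) (hy : AI A pt δ' y) :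
    AI A pt (δ + δ') (x * y) := by
  obtain ⟨σ, h1, h2⟩ := hx
  obtain ⟨τ, h3, h4⟩ := hy
  refine ⟨σ * τ, ?_, ?_⟩
  · intro z
    obtain ⟨c, hc, h⟩ := h1 (τ z)
    obtain ⟨c', hc', h'⟩ := h3 z
    refine ⟨c * c', mul_ne_zero hc hc', ?_⟩
    rw [Equiv.Perm.mul_apply, h, h', Matrix.mul_smul, smul_smul, Matrix.mul_assoc]
  · have : (esc A (σ * τ) : ℝ) ≤ esc A σ + esc A τ := by exact_mod_cast esc_mul A σ τ
    linarith

theorem AI.one : AI A pt 0 (1 : Matrix (Fin m) (Fin m) K) :=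
  ⟨1, fun y => ⟨1, one_ne_zero, by simp⟩, by simp [esc_one]⟩

theorem AI.inv {δ : ℝ} {x y : Matrix (Fin m) (Fin m) K} (hx : AI A pt δ x) (h : y * x = 1) :
    AI A pt δ y := by
  obtain ⟨σ, h1, h2⟩ := hx
  refine ⟨σ⁻¹, ?_, by rwa [esc_inv]⟩
  intro z
  obtain ⟨c, hc, h'⟩ := h1 (σ⁻¹ z)
  refine ⟨c⁻¹, inv_ne_zero hc, ?_⟩
  have h3 : σ (σ⁻¹ z) = z := by simp
  rw [h3] at h'
  rw [h', Matrix.mul_smul, smul_smul, inv_mul_cancel₀ hc, ← Matrix.mul_assoc, h, one_smul, one_mul]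

theorem AI.set_pow {δ : ℝ} {S : Set (Matrix.SpecialLinearGroup (Fin m) K)}
    (hS : ∀ s ∈ S, AI A pt δ (s : Matrix (Fin m) (Fin m) K)) (n : ℕ) :
    ∀ x ∈ S ^ n, AI A pt (n * δ) (x : Matrix (Fin m) (Fin m) K) := by
  induction n with
  | zero => intro x hx
            simp only [pow_zero, Set.mem_one] at hx
            subst hx; simpa using AI.one
  | succ n ih =>
    intro x hx
    rw [pow_succ] at hx
    obtain ⟨a, ha, b, hb, rfl⟩ := Set.mem_mul.1 hx
    have := (ih a ha).mul (hS b hb)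
    rw [Matrix.SpecialLinearGroup.coe_mul]
    convert this using 1
    push_cast; ring

/-- Data that prevents almost invariance. -/
structure PingData (S : Set (Matrix.SpecialLinearGroup (Fin m) K)) (L R M : ℕ) : Prop where
  ex : ∃ (I : Finset (Matrix.SpecialLinearGroup (Fin m) K))
      (γ : Matrix.SpecialLinearGroup (Fin m) K → Matrix.SpecialLinearGroup (Fin m) K)
      (D : Matrix.SpecialLinearGroup (Fin m) K → Set (Matrix (Fin m) (Fin m) K)),
      I.card ≤ R ∧ (∀ g ∈ I, γ g ∈ S ^ L) ∧
      (∀ g ∈ I, ∀ x ∈ D g, ∀ c : K, c ≠ 0 → c • x ∈ D g) ∧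
      (∀ x ≠ 0, ∃ g ∈ I, x ∈ D g) ∧
      (∀ g ∈ I, ∀ i, M ≤ i → ∀ x ∈ D g, ((γ g : Matrix (Fin m) (Fin m) K)) ^ i * x ∉ D g)

theorem PingData.contra {S : Set (Matrix.SpecialLinearGroup (Fin m) K)} {L R M : ℕ}
    (h : PingData S L R M) (hM : 1 ≤ M) (hR : 1 ≤ R) (hA : A.Nonempty) (hpt : ∀ y, pt y ≠ 0)
    (hS : ∀ s ∈ S, AI A pt (1 / (32 * R ^ 2 * M * (L + 1))) (s : Matrix (Fin m) (Fin m) K)) : False := by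
  classical
  obtain ⟨I, γ, D, hI, hγ, hsc, hcov, hw⟩ := h.ex
  have hA0 : (0:ℝ) < A.card := by exact_mod_cast hA.card_pos
  have hR0 : (1:ℝ) ≤ R := by exact_mod_cast hR
  have hM0 : (1:ℝ) ≤ M := by exact_mod_cast hM
  have hbound : ∀ g ∈ I, ((A.filter (fun y => pt y ∈ D g)).card : ℝ) ≤ A.card * (3 / (8 * R)) := by
    intro g hg
    obtain ⟨σ, h1, h2⟩ := AI.set_pow hS L _ (hγ g hg)
    have hpow : ∀ i y, ∃ c : K, c ≠ 0 ∧ pt ((σ ^ i) y) = c • ((γ g : Matrix (Fin m) (Fin m) K) ^ i * pt y) := by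
      intro i
      induction i with
      | zero => intro y; exact ⟨1, one_ne_zero, by simp⟩
      | succ i ih =>
        intro y
        obtain ⟨c, hc, hh⟩ := ih y
        obtain ⟨c', hc', hh'⟩ := h1 ((σ ^ i) y)
        refine ⟨c' * c, mul_ne_zero hc' hc, ?_⟩
        rw [pow_succ', Equiv.Perm.mul_apply, hh', hh, Matrix.mul_smul, smul_smul, ← Matrix.mul_assoc, ← pow_succ']
    have hwan := wandering A σ {y | pt y ∈ D g} M (4 * R) (by
      intro i hi y hy hy'
      obtain ⟨c, hc, hh⟩ := hpow i y
      simp only [Set.mem_ofPred_eq] at hy hy'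
      rw [hh] at hy'
      have := hsc g hg _ hy' c⁻¹ (inv_ne_zero hc)
      rw [smul_smul, inv_mul_cancel₀ hc, one_smul] at this
      exact hw g hg i hi _ hy this) hM
    have hwan' : (4 * R : ℝ) * ((A.filter (fun y => pt y ∈ D g)).card : ℝ) ≤
        A.card + 4 * R * (4 * R * (M * esc A σ)) := by exact_mod_cast hwan
    have h3 : (4 * R * (4 * R * (M * esc A σ)) : ℝ) ≤ A.card / 2 := by
      have : (esc A σ : ℝ) ≤ A.card / (32 * R^2 * M) := by
        refine h2.trans ?_
        have : (L:ℝ) * (1 / (32 * R ^ 2 * M * (L + 1))) ≤ 1 / (32 * R^2 * M) := by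
          rw [mul_one_div, div_le_div_iff₀ (by positivity) (by positivity)]
          have : (0:ℝ) ≤ 32 * R^2 * M := by positivity
          nlinarith
        calc _ ≤ 1 / (32 * R^2 * M) * (A.card:ℝ) := by gcongr
          _ = _ := by ring
      calc (4 * R * (4 * R * (M * esc A σ)) : ℝ) ≤ 4 * R * (4 * R * (M * (A.card / (32 * R^2 * M)))) := by gcongr
        _ = _ := by field_simp; ring
    rw [mul_div_assoc', le_div_iff₀ (by positivity)]
    linarith
  have htot : (A.card : ℝ) ≤ ∑ g ∈ I, ((A.filter (fun y => pt y ∈ D g)).card : ℝ) := by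
    have : A ⊆ I.biUnion (fun g => A.filter (fun y => pt y ∈ D g)) := by
      intro y hy
      obtain ⟨g, hg, hx⟩ := hcov (pt y) (hpt y)
      exact Finset.mem_biUnion.2 ⟨g, hg, Finset.mem_filter.2 ⟨hy, hx⟩⟩
    exact_mod_cast (Finset.card_le_card this).trans Finset.card_biUnion_le
  have h5 : (A.card : ℝ) ≤ R * (A.card * (3 / (8 * R))) := by
    refine htot.trans ((Finset.sum_le_sum hbound).trans ?_)
    rw [Finset.sum_const, nsmul_eq_mul]
    have : (I.card : ℝ) ≤ R := by exact_mod_cast hI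
    gcongr
  have h6 : (R * (A.card * (3 / (8 * R))) : ℝ) = A.card * (3/8) := by field_simp
  linarith
end

end UPE
end

section
open scoped MatrixGroups Pointwise

namespace UPE

theorem nat_stab (f : ℕ → ℕ) (hf : Monotone f) (N : ℕ) (hN : ∀ i, f i ≤ N) :
    ∃ i ≤ N, f i = f (i + 1) := by
  by_contra! h
  have : ∀ i ≤ N + 1, i ≤ f i := by
    intro i
    induction i with
    | zero => intro _; omega
    | succ i ih =>
      intro hi
      have h1 := h i (by omega)
      have h2 := hf (Nat.le_succ i)
      have h3 := ih (by omega)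
      simp only [Nat.succ_eq_add_one] at h2
      omega
  have h1 := this (N + 1) le_rfl
  have h2 := hN (N + 1)
  omega

/-- symmetric set containing `1`. -/
structure Sym {G : Type*} [Group G] (S : Set G) : Prop where
  one : (1 : G) ∈ S
  inv : ∀ s ∈ S, s⁻¹ ∈ S

section
variable {G : Type*} [Group G] {S : Set G}

theorem Sym.pow_mono (h : Sym S) {i j : ℕ} (hij : i ≤ j) : S ^ i ⊆ S ^ j :=
  Set.pow_subset_pow_right h.one hij

theorem Sym.subset_pow (h : Sym S) {j : ℕ} (hij : 1 ≤ j) : S ⊆ S ^ j := by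
  have := h.pow_mono hij; rwa [pow_one] at this

theorem mul_mem_pow {i j : ℕ} {x y : G} (hx : x ∈ S ^ i) (hy : y ∈ S ^ j) : x * y ∈ S ^ (i + j) := by
  rw [pow_add]; exact Set.mul_mem_mul hx hy

theorem Sym.mul_mem (h : Sym S) {i j k : ℕ} {x y : G} (hx : x ∈ S ^ i) (hy : y ∈ S ^ j)
    (hk : i + j ≤ k) : x * y ∈ S ^ k := h.pow_mono hk (mul_mem_pow hx hy)

theorem Sym.one_mem_pow (h : Sym S) (i : ℕ) : (1 : G) ∈ S ^ i :=
  h.pow_mono (Nat.zero_le i) (by simp)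

theorem Sym.inv_mem_pow (h : Sym S) {i : ℕ} : ∀ {x : G}, x ∈ S ^ i → x⁻¹ ∈ S ^ i := by
  induction i with
  | zero => intro x hx; simp at hx; simp [hx]
  | succ i ih =>
    intro x hx
    rw [pow_succ] at hx
    obtain ⟨a, ha, b, hb, rfl⟩ := Set.mem_mul.1 hx
    rw [mul_inv_rev, pow_succ']
    exact Set.mul_mem_mul (h.inv b hb) (ih ha)

theorem pow_mem_pow {i : ℕ} {x : G} (hx : x ∈ S ^ i) (j : ℕ) : x ^ j ∈ S ^ (i * j) := by
  rw [pow_mul]; exact Set.pow_mem_pow hx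

theorem Sym.closure (h : Sym S) {x : G} : x ∈ Subgroup.closure S ↔ ∃ n, x ∈ S ^ n := by
  constructor
  · intro hx
    induction hx using Subgroup.closure_induction with
    | mem x hx => exact ⟨1, by simpa using hx⟩
    | one => exact ⟨0, by simp⟩
    | mul x y _ _ hx hy =>
      obtain ⟨i, hi⟩ := hx
      obtain ⟨j, hj⟩ := hy
      exact ⟨i + j, mul_mem_pow hi hj⟩
    | inv x _ hx =>
      obtain ⟨i, hi⟩ := hx
      exact ⟨i, h.inv_mem_pow hi⟩
  · rintro ⟨n, hn⟩
    induction n generalizing x with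
    | zero => simp at hn; simp [hn]
    | succ n ih =>
      rw [pow_succ] at hn
      obtain ⟨a, ha, b, hb, rfl⟩ := Set.mem_mul.1 hn
      exact Subgroup.mul_mem _ (ih ha) (Subgroup.subset_closure hb)

theorem Sym.card_pow (h : Sym S) (hfin : S.Finite) (hinf : ((Subgroup.closure S : Subgroup G) : Set G).Infinite)
    (i : ℕ) : i + 1 ≤ (S ^ i).ncard := by
  have hf : ∀ i, (S ^ i).Finite := by
    intro i
    induction i with
    | zero => rw [pow_zero]; exact Set.finite_one
    | succ i ih => rw [pow_succ]; exact ih.mul hfin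
  induction i with
  | zero => rw [pow_zero, ← Set.singleton_one, Set.ncard_singleton]
  | succ i ih =>
    by_contra hcon
    have h1 : S ^ i = S ^ (i + 1) :=
      Set.eq_of_subset_of_ncard_le (h.pow_mono (Nat.le_succ i)) (by omega) (hf _)
    have h2 : ∀ j, S ^ j ⊆ S ^ i := by
      intro j
      induction j with
      | zero => exact h.pow_mono (Nat.zero_le i)
      | succ j ihj =>
        rw [pow_succ]
        calc S ^ j * S ⊆ S ^ i * S := Set.mul_subset_mul_right ihj
          _ = S ^ (i + 1) := (pow_succ _ _).symm
          _ = S ^ i := h1.symm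
    apply hinf
    refine (hf i).subset ?_
    intro x hx
    obtain ⟨n, hn⟩ := h.closure.1 hx
    exact h2 n hn

variable {K E : Type*} [Field K] [AddCommGroup E] [Module K E] [FiniteDimensional K E]

theorem Sym.stab (h : Sym S) (T : G → E →ₗ[K] E) (Φ : G → E) (hΦ : ∀ s g, Φ (s * g) = T s (Φ g))
    (n : ℕ) (hn : Module.finrank K E ≤ n) :
    (∀ s ∈ S, (Submodule.span K (Φ '' (S ^ n))).map (T s) ≤ Submodule.span K (Φ '' (S ^ n))) ∧
    ∀ g ∈ Subgroup.closure S, Φ g ∈ Submodule.span K (Φ '' (S ^ n)) := by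
  set W : ℕ → Submodule K E := fun i => Submodule.span K (Φ '' (S ^ i)) with hW
  have hmono : Monotone W := fun i j hij => Submodule.span_mono (Set.image_mono (h.pow_mono hij))
  obtain ⟨i, hi, hi'⟩ := nat_stab (fun i => Module.finrank K (W i))
    (fun i j hij => Submodule.finrank_mono (hmono hij)) n
    (fun i => (Submodule.finrank_le _).trans hn)
  have hWi : W i = W (i + 1) := Submodule.eq_of_le_of_finrank_eq (hmono (Nat.le_succ i)) hi'
  have hT : ∀ j, ∀ s ∈ S, (W j).map (T s) ≤ W (j + 1) := by
    intro j s hs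
    rw [hW, Submodule.map_span, Submodule.span_le]
    rintro _ ⟨_, ⟨g, hg, rfl⟩, rfl⟩
    rw [← hΦ]
    refine Submodule.subset_span ⟨s * g, ?_, rfl⟩
    rw [pow_succ']
    exact Set.mul_mem_mul hs hg
  have hall : ∀ j, W j ≤ W i := by
    intro j
    induction j with
    | zero => exact hmono (Nat.zero_le i)
    | succ j ih =>
      refine Submodule.span_le.2 ?_
      rintro _ ⟨g, hg, rfl⟩
      rw [pow_succ'] at hg
      obtain ⟨a, ha, b, hb, rfl⟩ := Set.mem_mul.1 hg
      have h1 : Φ b ∈ W i := ih (Submodule.subset_span ⟨b, hb, rfl⟩)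
      rw [hΦ, hWi]
      exact hT i a ha (Submodule.mem_map_of_mem h1)
  constructor
  · intro s hs
    exact (hT n s hs).trans ((hall _).trans (hmono hi))
  · intro g hg
    obtain ⟨j, hj⟩ := h.closure.1 hg
    exact hmono hi (hall j (Submodule.subset_span ⟨g, hj, rfl⟩))
end

/-- Strong irreducibility up to `N`. -/
def SI {K : Type} [Field K] {m : ℕ} (N : ℕ) (S : Set (Matrix.SpecialLinearGroup (Fin m) K)) : Prop :=
  ∀ W : Finset (Submodule K (Fin m → K)), W.Nonempty → W.card ≤ N → (∀ w ∈ W, w ≠ ⊥ ∧ w ≠ ⊤) →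
    ∃ s ∈ S, ∃ w ∈ W, w.map (Matrix.toLin' (s : Matrix (Fin m) (Fin m) K)) ∉ W

section
variable {K : Type} [Field K] {m : ℕ} {S : Set (Matrix.SpecialLinearGroup (Fin m) K)}

theorem SI.mono {N N' : ℕ} (h : SI N S) (hN : N' ≤ N) : SI N' S :=
  fun W h1 h2 h3 => h W h1 (h2.trans hN) h3

theorem toLin'_SL_inj (s : Matrix.SpecialLinearGroup (Fin m) K) :
    Function.Injective (Matrix.toLin' (s : Matrix (Fin m) (Fin m) K)) := by
  have : Function.LeftInverse (Matrix.toLin' (s⁻¹ : Matrix.SpecialLinearGroup (Fin m) K).1) (Matrix.toLin' (s : Matrix (Fin m) (Fin m) K)) := by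
    intro x
    rw [← LinearMap.comp_apply, ← Matrix.toLin'_mul, ← Matrix.SpecialLinearGroup.coe_mul]
    simp
  exact this.injective

theorem finrank_map_SL (s : Matrix.SpecialLinearGroup (Fin m) K) (W : Submodule K (Fin m → K)) :
    Module.finrank K (W.map (Matrix.toLin' (s : Matrix (Fin m) (Fin m) K))) = Module.finrank K W :=
  (LinearEquiv.finrank_eq (Submodule.equivMapOfInjective _ (toLin'_SL_inj s) W)).symm

/-- Q-lemma -/
theorem Qlemma (k : ℕ) : ∀ t n : ℕ, ∃ N : ℕ, ∀ {K : Type} [Field K] {m : ℕ}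
    {S : Set (Matrix.SpecialLinearGroup (Fin m) K)}, SI N S →
    ∀ Z : Finset (Submodule K (Fin m → K)), Z.card ≤ n → (∀ w ∈ Z, w ≠ ⊤ ∧ Module.finrank K w ≤ k) →
    ∀ R : Finset (Submodule K (Fin m → K)), R.card ≤ t → (∀ w ∈ Z, Module.finrank K w = k → w ∈ R) →
    ∀ x : Fin m → K, (∀ g ∈ Subgroup.closure S, ∃ w ∈ Z, (g : Matrix (Fin m) (Fin m) K).mulVec x ∈ w) →
      x = 0 := by
  induction k with
  | zero =>
    intro t n
    refine ⟨0, ?_⟩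
    intro K _ m S _ Z hZ hZ2 R _ _ x hx
    obtain ⟨w, hw, hxw⟩ := hx 1 (one_mem _)
    have := (hZ2 w hw).2
    have hw0 : w = ⊥ := Submodule.finrank_eq_zero.1 (by omega)
    rw [hw0] at hxw
    simpa using hxw
  | succ k ihk =>
    intro t
    induction t with
    | zero =>
      intro n
      obtain ⟨N, hN⟩ := ihk n n
      refine ⟨N, ?_⟩
      intro K _ m S hS Z hZ hZ2 R hR hR2 x hx
      have hR0 : R = ∅ := Finset.card_eq_zero.1 (by omega)
      refine hN hS Z hZ ?_ Z hZ (fun w hw _ => hw) x hx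
      intro w hw
      refine ⟨(hZ2 w hw).1, ?_⟩
      have h1 := (hZ2 w hw).2
      by_contra hcon
      have := hR2 w hw (by omega)
      simp [hR0] at this
    | succ t iht =>
      intro n
      obtain ⟨N, hN⟩ := iht (n * n)
      obtain ⟨N1, hN1⟩ := ihk n n
      refine ⟨max n (max N N1), ?_⟩
      intro K _ m S hS Z hZ hZ2 R hR hR2 x hx
      classical
      set Tp := Z.filter (fun w : Submodule K (Fin m → K) => Module.finrank K w = k + 1) with hTp
      by_cases hne : Tp.Nonempty
      · obtain ⟨s, hs, w0, hw0, hsw⟩ := hS Tp hne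
          ((Finset.card_filter_le _ _).trans (hZ.trans (le_max_left _ _))) (by
            intro w hw
            have h1 := Finset.mem_filter.1 hw
            refine ⟨?_, (hZ2 w h1.1).1⟩
            rintro rfl
            simp at h1)
        have hw0R : w0 ∈ R := hR2 w0 (Finset.mem_filter.1 hw0).1 (Finset.mem_filter.1 hw0).2
        set f := Matrix.toLin' (s : Matrix (Fin m) (Fin m) K) with hf
        have hfi : Function.Injective f := toLin'_SL_inj s
        have hfs : Function.Surjective f := LinearMap.surjective_of_injective hfi
        have hmapcomap : ∀ u : Submodule K (Fin m → K), (u.comap f).map f = u :=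
          fun u => Submodule.map_comap_eq_of_surjective hfs u
        have hcomap : ∀ u : Submodule K (Fin m → K), Module.finrank K (u.comap f) = Module.finrank K u := by
          intro u
          rw [← finrank_map_SL s (u.comap f), hmapcomap]
        set Z' := (Z ×ˢ Z).image (fun p => p.1 ⊓ p.2.comap f) with hZ'
        refine hN (hS.mono ((le_max_left _ _).trans (le_max_right _ _))) Z' ?_ ?_ (R.erase w0) ?_ ?_ x ?_
        · refine Finset.card_image_le.trans ?_
          rw [Finset.card_product]
          exact Nat.mul_le_mul hZ hZ
        · intro w hw
          obtain ⟨⟨u, u'⟩, hu, rfl⟩ := Finset.mem_image.1 hw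
          obtain ⟨hu, hu'⟩ := Finset.mem_product.1 hu
          constructor
          · intro h
            exact (hZ2 u hu).1 (top_le_iff.1 (h ▸ inf_le_left))
          · exact (Submodule.finrank_mono inf_le_left).trans (hZ2 u hu).2
        · rw [Finset.card_erase_of_mem hw0R]; omega
        · intro w hw hwk
          obtain ⟨⟨u, u'⟩, hu, rfl⟩ := Finset.mem_image.1 hw
          obtain ⟨hu, hu'⟩ := Finset.mem_product.1 hu
          simp only at hu hu' hwk ⊢
          have e1 : u ⊓ u'.comap f = u := Submodule.eq_of_le_of_finrank_le inf_le_left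
            (by rw [hwk]; exact (hZ2 u hu).2)
          have e2 : u ⊓ u'.comap f = u'.comap f := Submodule.eq_of_le_of_finrank_le inf_le_right
            (by rw [hwk, hcomap]; exact (hZ2 u' hu').2)
          rw [e1] at hwk ⊢
          refine Finset.mem_erase.2 ⟨?_, hR2 u hu hwk⟩
          rintro rfl
          apply hsw
          have e3 : u.map f = u' := by
            rw [e1] at e2
            conv_lhs => rw [e2]
            exact hmapcomap u'
          rw [e3]
          refine Finset.mem_filter.2 ⟨hu', ?_⟩
          rw [← e3, finrank_map_SL, hwk]
        · intro g hg
          obtain ⟨u, hu, h1⟩ := hx g hg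
          obtain ⟨u', hu', h2⟩ := hx (s * g) (mul_mem (Subgroup.subset_closure hs) hg)
          refine ⟨u ⊓ u'.comap f, Finset.mem_image.2 ⟨(u, u'), Finset.mem_product.2 ⟨hu, hu'⟩, rfl⟩, h1, ?_⟩
          rw [SetLike.mem_coe, Submodule.mem_comap, hf, Matrix.toLin'_apply, Matrix.mulVec_mulVec]
          exact h2
      · refine hN1 (hS.mono ((le_max_right _ _).trans (le_max_right _ _))) Z hZ ?_ Z hZ (fun w hw _ => hw) x hx
        intro w hw
        refine ⟨(hZ2 w hw).1, ?_⟩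
        have h1 := (hZ2 w hw).2
        by_contra hcon
        exact hne ⟨w, Finset.mem_filter.2 ⟨hw, by omega⟩⟩

end

end UPE
end

section
open scoped MatrixGroups Pointwise

namespace UPE

theorem burnside_end {K V : Type} [Field K] [IsAlgClosed K] [AddCommGroup V] [Module K V] [FiniteDimensional K V]
    [Nontrivial V] (A : Subalgebra K (Module.End K V))
    (h : ∀ W : Submodule K V, (∀ a ∈ A, ∀ w ∈ W, a w ∈ W) → W = ⊥ ∨ W = ⊤) : A = ⊤ := by
  have hsimple : IsSimpleModule A V := by
    have : Nontrivial (Submodule A V) := inferInstance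
    refine @IsSimpleModule.mk _ _ _ _ _ ⟨?_⟩
    intro W
    have := h (W.restrictScalars K) (by
      intro a ha w hw
      exact W.smul_mem (⟨a, ha⟩ : A) hw)
    simpa using this
  rw [eq_top_iff]
  intro f _
  have hbij := IsSimpleModule.algebraMap_end_bijective_of_isAlgClosed (k := K) (A := A) (V := V)
  let f' : Module.End (Module.End A V) V :=
    { toFun := f
      map_add' := map_add f
      map_smul' := by
        intro r x
        obtain ⟨c, rfl⟩ := hbij.2 r
        simp }
  obtain ⟨s, hs⟩ := (Module.Finite.fg_top (R := K) (M := V))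
  obtain ⟨r, hr⟩ := jacobson_density (R := A) f' s
  have : f = r.1 := by
    apply LinearMap.ext_on hs
    intro x hx
    exact hr x hx
  rw [this]; exact r.2

theorem burnside {K : Type} [Field K] [IsAlgClosed K] {m : ℕ}
    {S : Set (Matrix.SpecialLinearGroup (Fin m) K)} (hS : Sym S) (hSI : SI 1 S) (n : ℕ) (hn : m * m ≤ n) :
    Submodule.span K ((fun g : Matrix.SpecialLinearGroup (Fin m) K => (g : Matrix (Fin m) (Fin m) K)) '' (S ^ n)) = ⊤ := by
  rcases Nat.eq_zero_or_pos m with rfl | hm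
  · exact Subsingleton.elim _ _
  have : Nonempty (Fin m) := ⟨⟨0, hm⟩⟩
  have hst := (hS.stab (K := K) (fun s => LinearMap.mulLeft K (s : Matrix (Fin m) (Fin m) K))
    (fun g : Matrix.SpecialLinearGroup (Fin m) K => (g : Matrix (Fin m) (Fin m) K))
    (by intro s g; simp) n (by simpa [Module.finrank_matrix] using hn)).2
  set Γ : Set (Matrix (Fin m) (Fin m) K) :=
    (fun g : Matrix.SpecialLinearGroup (Fin m) K => (g : Matrix (Fin m) (Fin m) K)) '' (Subgroup.closure S) with hΓ
  have hadj : Subalgebra.toSubmodule (Algebra.adjoin K Γ) = Submodule.span K Γ := by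
    rw [Algebra.adjoin_eq_span]
    congr 1
    let M : Submonoid (Matrix (Fin m) (Fin m) K) :=
      { carrier := Γ
        one_mem' := ⟨1, one_mem _, by simp⟩
        mul_mem' := by
          rintro _ _ ⟨a, ha, rfl⟩ ⟨b, hb, rfl⟩
          exact ⟨a * b, mul_mem ha hb, by simp⟩ }
    exact congrArg SetLike.coe (Submonoid.closure_eq M)
  have htop : Algebra.adjoin K Γ = ⊤ := by
    have := burnside_end ((Algebra.adjoin K Γ).map (Matrix.toLinAlgEquiv' : Matrix (Fin m) (Fin m) K ≃ₐ[K] _).toAlgHom) (by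
      intro W hW
      by_contra! hcon
      obtain ⟨s, hs, w, hw, hsw⟩ := hSI {W} (by simp) (by simp) (by simpa using hcon)
      rw [Finset.mem_singleton] at hw
      subst hw
      apply hsw
      rw [Finset.mem_singleton]
      apply Submodule.eq_of_le_of_finrank_eq
      · rintro _ ⟨x, hx, rfl⟩
        exact hW _ ⟨s, Algebra.subset_adjoin ⟨s, Subgroup.subset_closure hs, rfl⟩, rfl⟩ x hx
      · exact finrank_map_SL s w)
    rw [eq_top_iff]
    intro x _
    have hx : Matrix.toLinAlgEquiv' x ∈ (⊤ : Subalgebra K (Module.End K (Fin m → K))) := trivial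
    rw [← this] at hx
    obtain ⟨y, hy, hyx⟩ := hx
    have : y = x := Matrix.toLinAlgEquiv'.injective hyx
    exact this ▸ hy
  rw [eq_top_iff]
  intro x _
  have hx : x ∈ Subalgebra.toSubmodule (Algebra.adjoin K Γ) := by rw [htop]; trivial
  rw [hadj] at hx
  refine (Submodule.span_le.2 ?_) hx
  rintro _ ⟨g, hg, rfl⟩
  exact hst g hg

/-- choose a spanning family of bounded size -/
theorem exists_span_family {K E ι : Type} [Field K] [AddCommGroup E] [Module K E] [FiniteDimensional K E]
    [Fintype ι] (hι : Fintype.card ι = Module.finrank K E) (s : Set E) (hs : Submodule.span K s = ⊤) :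
    ∃ w : ι → E, (∀ i, w i ∈ s) ∧ Submodule.span K (Set.range w) = ⊤ ∧ LinearIndependent K w := by
  obtain ⟨f, hf1, hf2, hf3⟩ := Submodule.exists_fun_fin_finrank_span_eq K s
  have hc : Module.finrank K (Submodule.span K s) = Fintype.card ι := by rw [hs, finrank_top, hι]
  let e : ι ≃ Fin (Module.finrank K (Submodule.span K s)) := (Fintype.equivFin ι).trans (finCongr hc.symm)
  refine ⟨f ∘ e, fun i => hf1 _, ?_, ?_⟩
  · rw [e.surjective.range_comp, hf2, hs]
  · exact hf3.comp _ e.injective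
end UPE
end

section
open scoped MatrixGroups Pointwise

namespace UPE

set_option linter.unusedSectionVars false

section
variable {K : Type} [Field K] {m : ℕ} {ι : Type} [Fintype ι] [DecidableEq ι]

theorem tr_ext {z : ι → Matrix (Fin m) (Fin m) K} (hz : Submodule.span K (Set.range z) = ⊤)
    {x : Matrix (Fin m) (Fin m) K} (h : ∀ p, (z p * x).trace = 0) : x = 0 := by
  have h1 : ∀ y : Matrix (Fin m) (Fin m) K, (y * x).trace = 0 := by
    intro y
    have hy : y ∈ Submodule.span K (Set.range z) := by rw [hz]; trivial
    induction hy using Submodule.span_induction with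
    | mem y hy => obtain ⟨p, rfl⟩ := hy; exact h p
    | zero => simp
    | add a b _ _ ha hb => rw [add_mul, Matrix.trace_add, ha, hb, add_zero]
    | smul c a _ ha => rw [Matrix.smul_mul, Matrix.trace_smul, ha, smul_zero]
  rw [Matrix.ext_iff_trace_mul_left]
  intro y; rw [h1]; simp

theorem trdet_ne {z w : ι → Matrix (Fin m) (Fin m) K} (hz : Submodule.span K (Set.range z) = ⊤)
    (hw : LinearIndependent K w) : (Matrix.of fun p l => (z p * w l).trace).det ≠ 0 := by
  intro hdet
  obtain ⟨c, hc, hc'⟩ := Matrix.exists_mulVec_eq_zero_iff.2 hdet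
  have hx : ∑ l, c l • w l = 0 := by
    apply tr_ext hz
    intro p
    have := congrFun hc' p
    simp only [Matrix.mulVec, dotProduct, Matrix.of_apply, Pi.zero_apply] at this
    rw [Finset.mul_sum, Matrix.trace_sum, ← this]
    refine Finset.sum_congr rfl fun l _ => ?_
    rw [Matrix.mul_smul, Matrix.trace_smul, smul_eq_mul, mul_comm]
  exact hc (funext fun l => (Fintype.linearIndependent_iff.1 hw c hx l))

theorem kron_mulVec (A B : Matrix (Fin m) (Fin m) K) (u v : Fin m → K) :
    (Matrix.kronecker A B).mulVec (fun p : Fin m × Fin m => u p.1 * v p.2) =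
      fun p => (A.mulVec u) p.1 * (B.mulVec v) p.2 := by
  funext p
  simp only [Matrix.mulVec, dotProduct, Fintype.sum_prod_type, Finset.sum_mul_sum]
  refine Finset.sum_congr rfl fun i _ => Finset.sum_congr rfl fun j _ => ?_
  have e : A.kronecker B p (i, j) = A p.1 i * B p.2 j := rfl
  rw [e]
  ring

theorem quad_family {S : Set (Matrix.SpecialLinearGroup (Fin m) K)} (hS : Sym S) :
    ∃ I : Finset (Matrix.SpecialLinearGroup (Fin m) K), I.card ≤ m ^ 4 ∧ (∀ g ∈ I, g ∈ S ^ (m ^ 4)) ∧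
      ∀ (A B : Matrix (Fin m) (Fin m) K) (u : Fin m → K),
        (∀ g ∈ I, (A * g.1).mulVec u = 0 ∨ (B * g.1).mulVec u = 0) →
        ∀ g ∈ Subgroup.closure S, (A * g.1).mulVec u = 0 ∨ (B * g.1).mulVec u = 0 := by
  classical
  set Φ : Matrix.SpecialLinearGroup (Fin m) K → Matrix (Fin m × Fin m) (Fin m × Fin m) K :=
    fun g => Matrix.kronecker g.1 g.1 with hΦ
  have hfr : Module.finrank K (Matrix (Fin m × Fin m) (Fin m × Fin m) K) = m ^ 4 := by
    simp [Module.finrank_matrix]; ring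
  have hst := (hS.stab (K := K) (fun s => LinearMap.mulLeft K (Φ s)) Φ
    (by intro s g; simp only [hΦ, LinearMap.mulLeft_apply, Matrix.SpecialLinearGroup.coe_mul]
        exact Matrix.mul_kronecker_mul _ _ _ _) (m ^ 4) hfr.le).2
  obtain ⟨f, hf1, hf2, -⟩ := Submodule.exists_fun_fin_finrank_span_eq K (Φ '' (S ^ (m ^ 4)))
  choose g hg1 hg2 using hf1
  refine ⟨Finset.univ.image g, ?_, ?_, ?_⟩
  · refine Finset.card_image_le.trans ?_
    rw [Finset.card_univ, Fintype.card_fin, ← hfr]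
    exact Submodule.finrank_le _
  · intro x hx
    obtain ⟨i, -, rfl⟩ := Finset.mem_image.1 hx
    exact hg1 i
  · intro A B u hI x hx
    have key : ∀ X ∈ Submodule.span K (Φ '' (S ^ (m ^ 4))),
        (Matrix.kronecker A B * X).mulVec (fun p : Fin m × Fin m => u p.1 * u p.2) = 0 := by
      intro X hX
      rw [← hf2] at hX
      induction hX using Submodule.span_induction with
      | mem y hy =>
        obtain ⟨i, rfl⟩ := hy
        rw [← hg2 i, hΦ]
        have e : Matrix.kronecker A B * Matrix.kronecker (g i).1 (g i).1 = Matrix.kronecker (A * (g i).1) (B * (g i).1) :=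
          (Matrix.mul_kronecker_mul _ _ _ _).symm
        rw [e, kron_mulVec]
        funext p
        rcases hI (g i) (Finset.mem_image_of_mem _ (Finset.mem_univ i)) with h | h <;> simp [h]
      | zero => simp
      | add a b _ _ ha hb => rw [Matrix.mul_add, Matrix.add_mulVec, ha, hb, add_zero]
      | smul c a _ ha => rw [Matrix.mul_smul, Matrix.smul_mulVec, ha, smul_zero]
    have h1 := key _ (hst x hx)
    rw [hΦ] at h1
    have e : Matrix.kronecker A B * Matrix.kronecker x.1 x.1 = Matrix.kronecker (A * x.1) (B * x.1) :=
      (Matrix.mul_kronecker_mul _ _ _ _).symm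
    simp only at h1
    rw [e, kron_mulVec] at h1
    by_contra! hcon
    obtain ⟨hc1, hc2⟩ := hcon
    obtain ⟨i, hi⟩ := Function.ne_iff.1 hc1
    obtain ⟨j, hj⟩ := Function.ne_iff.1 hc2
    have := congrFun h1 (i, j)
    simp only [Pi.zero_apply] at this hi hj
    exact (mul_ne_zero hi hj) this

/-- left ideal without common kernel vector is everything -/
theorem left_ideal_top {κ : Type} [Fintype κ] (Z : κ → Matrix (Fin m) (Fin m) K)
    (h : ∀ u : Fin m → K, (∀ k, (Z k).mulVec u = 0) → u = 0)
    (w : ι → Matrix (Fin m) (Fin m) K) (hw : Submodule.span K (Set.range w) = ⊤) :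
    Submodule.span K {y | ∃ j k, y = w j * Z k} = ⊤ := by
  classical
  set T := Submodule.span K {y | ∃ j k, y = w j * Z k} with hT
  have h1 : ∀ (y : Matrix (Fin m) (Fin m) K) k, y * Z k ∈ T := by
    intro y k
    have hy : y ∈ Submodule.span K (Set.range w) := by rw [hw]; trivial
    induction hy using Submodule.span_induction with
    | mem y hy => obtain ⟨p, rfl⟩ := hy; exact Submodule.subset_span ⟨p, k, rfl⟩
    | zero => simp
    | add a b _ _ ha hb => rw [add_mul]; exact T.add_mem ha hb
    | smul c a _ ha => rw [Matrix.smul_mul]; exact T.smul_mem c ha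
  let f : (Fin m → K) →ₗ[K] (κ → Fin m → K) := LinearMap.pi (fun k => Matrix.toLin' (Z k))
  have hf : LinearMap.ker f = ⊥ := by
    rw [LinearMap.ker_eq_bot']
    intro u hu
    apply h
    intro k
    have := congrFun hu k
    simpa [f] using this
  obtain ⟨g, hg⟩ := LinearMap.exists_leftInverse_of_injective f hf
  -- g (v) = ∑ k, g_k v_k
  have h2 : (1 : Matrix (Fin m) (Fin m) K) = ∑ k, LinearMap.toMatrix' (g ∘ₗ LinearMap.single K (fun _ => Fin m → K) k) * Z k := by
    apply (Matrix.toLin' (R := K)).injective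
    rw [map_sum, Matrix.toLin'_one, ← hg]
    apply LinearMap.ext
    intro u
    rw [LinearMap.sum_apply]
    simp only [Matrix.toLin'_mul, Matrix.toLin'_toMatrix', LinearMap.comp_apply]
    rw [← map_sum]
    congr 1
    funext k
    simp [f, Finset.sum_apply, LinearMap.single_apply, Pi.single_apply]
  rw [eq_top_iff]
  intro y _
  rw [← mul_one y, h2, Finset.mul_sum]
  apply Submodule.sum_mem
  intro k _
  rw [← Matrix.mul_assoc]
  exact h1 _ _

end

/-- the two-set family lemma -/
theorem two_family (m : ℕ) : ∃ N : ℕ, ∀ {K : Type} [Field K]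
    {S : Set (Matrix.SpecialLinearGroup (Fin m) K)}, Sym S → SI N S →
    ∃ I : Finset (Matrix.SpecialLinearGroup (Fin m) K), I.card ≤ m ^ 4 ∧ (∀ g ∈ I, g ∈ S ^ (m ^ 4)) ∧
      ∀ (Q : Bool → Matrix (Fin m) (Fin m) K), (∀ b, Q b ≠ 0) →
      ∀ e : Matrix.SpecialLinearGroup (Fin m) K → Bool,
      ∀ u : Fin m → K, (∀ g ∈ I, (Q (e g) * g.1).mulVec u = 0) → u = 0 := by
  classical
  obtain ⟨N, hN⟩ := Qlemma m 2 2
  refine ⟨N, ?_⟩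
  intro K _ S hS hSI
  obtain ⟨I, h1, h2, h3⟩ := quad_family hS
  refine ⟨I, h1, h2, ?_⟩
  intro Q hQ e u hu
  have h4 := h3 (Q true) (Q false) u (by
    intro g hg
    have := hu g hg
    cases h : e g
    · right; rwa [h] at this
    · left; rwa [h] at this)
  set Z : Finset (Submodule K (Fin m → K)) := {LinearMap.ker (Matrix.toLin' (Q true)), LinearMap.ker (Matrix.toLin' (Q false))} with hZ
  have hne : ∀ b, LinearMap.ker (Matrix.toLin' (Q b)) ≠ ⊤ := by
    intro b hb
    apply hQ b
    rw [LinearMap.ker_eq_top] at hb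
    simpa using hb
  have hZc : Z.card ≤ 2 := Finset.card_le_two
  refine hN hSI Z hZc ?_ Z hZc (fun w hw _ => hw) u ?_
  · intro w hw
    refine ⟨?_, (Submodule.finrank_le _).trans (by simp)⟩
    simp only [hZ, Finset.mem_insert, Finset.mem_singleton] at hw
    rcases hw with rfl | rfl <;> exact hne _
  · intro g hg
    rcases h4 g hg with h | h
    · exact ⟨_, Finset.mem_insert_self _ _, by simpa [LinearMap.mem_ker, Matrix.mulVec_mulVec] using h⟩
    · exact ⟨_, Finset.mem_insert_of_mem (Finset.mem_singleton_self _), by simpa [LinearMap.mem_ker, Matrix.mulVec_mulVec] using h⟩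

end UPE
end

section
open scoped MatrixGroups Pointwise

namespace UPE

/-- scalar matrices -/
def IsScal {K : Type} [Field K] {m : ℕ} (x : Matrix (Fin m) (Fin m) K) : Prop := ∃ c : K, x = c • 1

theorem charpoly_root_eigenvector {K : Type} [Field K] {m : ℕ} {x : Matrix (Fin m) (Fin m) K} {c : K}
    (hc : c ∈ x.charpoly.roots) : ∃ v : Fin m → K, v ≠ 0 ∧ x.mulVec v = c • v := by
  have h1 : x.charpoly.eval c = 0 := (Polynomial.mem_roots'.1 hc).2
  rw [Matrix.eval_charpoly] at h1
  obtain ⟨v, hv, hv'⟩ := Matrix.exists_mulVec_eq_zero_iff.2 h1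
  refine ⟨v, hv, ?_⟩
  rw [Matrix.sub_mulVec, sub_eq_zero] at hv'
  rw [← hv']
  funext i
  simp [Matrix.scalar_apply, Matrix.mulVec_diagonal]

theorem mulVec_pow_eig {K : Type} [Field K] {m : ℕ} {x : Matrix (Fin m) (Fin m) K} {c : K} {v : Fin m → K}
    (h : x.mulVec v = c • v) (n : ℕ) : (x ^ n).mulVec v = c ^ n • v := by
  induction n with
  | zero => simp
  | succ n ih => rw [pow_succ, ← Matrix.mulVec_mulVec, h, Matrix.mulVec_smul, ih, smul_smul, pow_succ, mul_comm]

theorem multiset_sum_fin {K : Type} [AddCommMonoid K] (s : Multiset K) (m : ℕ) (hs : s.card = m) :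
    ∃ f : Fin m → K, (∀ i, f i ∈ s) ∧ ∑ i, f i = s.sum := by
  subst hs
  refine ⟨fun i => s.toList.get (Fin.cast (by simp) i), ?_, ?_⟩
  · intro i
    rw [← Multiset.mem_toList]
    exact List.get_mem _ _
  · conv_rhs => rw [← Multiset.coe_toList s, Multiset.sum_coe, ← List.ofFn_get s.toList, List.sum_ofFn]
    refine Fintype.sum_equiv (finCongr (by simp)) _ _ ?_
    intro i
    rfl

theorem exists_nontorsion (m J : ℕ) : ∃ L : ℕ, ∀ {K : Type} [Field K] [IsAlgClosed K]
    {S : Set (Matrix.SpecialLinearGroup (Fin m) K)}, Sym S → S.Finite → SI 1 S →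
    ((Subgroup.closure S : Subgroup _) : Set (Matrix.SpecialLinearGroup (Fin m) K)).Infinite →
    ∃ a ∈ S ^ L, ∀ j, 1 ≤ j → j ≤ J → ¬ IsScal ((a : Matrix (Fin m) (Fin m) K) ^ j) := by
  classical
  set N0 := m * J.factorial with hN0
  refine ⟨((N0 ^ m) ^ (m * m)) + m * m, ?_⟩
  intro K _ _ S hS hfin hSI hinf
  by_contra! hcon
  rcases Nat.eq_zero_or_pos m with rfl | hm
  · exact hinf (Set.toFinite _)
  have hN0pos : 0 < N0 := Nat.mul_pos hm (Nat.factorial_pos J)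
  have htor : ∀ x ∈ S ^ (((N0 ^ m) ^ (m * m)) + m * m), (x : Matrix (Fin m) (Fin m) K) ^ N0 = 1 := by
    intro x hx
    obtain ⟨j, hj1, hj2, c, hc⟩ := hcon x hx
    have hcm : c ^ m = 1 := by
      have h1 : ((x : Matrix (Fin m) (Fin m) K) ^ j).det = 1 := by
        rw [Matrix.det_pow, x.2, one_pow]
      rw [hc, Matrix.det_smul] at h1
      simpa using h1
    obtain ⟨q, hq⟩ := Nat.dvd_factorial hj1 hj2
    rw [hN0, hq, show m * (j * q) = j * (m * q) by ring, pow_mul, hc, smul_pow, pow_mul, hcm]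
    simp
  set Rt : Finset K := (Polynomial.X ^ N0 - 1 : Polynomial K).roots.toFinset with hRt
  have hRtc : Rt.card ≤ N0 := by
    refine (Multiset.toFinset_card_le _).trans ((Polynomial.card_roots' _).trans ?_)
    rw [← Polynomial.C_1, Polynomial.natDegree_X_pow_sub_C]
  set Θ : Finset K := (Fintype.piFinset (fun _ : Fin m => Rt)).image (fun f => ∑ i, f i) with hΘ
  have hΘc : Θ.card ≤ N0 ^ m := by
    refine Finset.card_image_le.trans ?_
    rw [Fintype.card_piFinset_const]
    simpa using Nat.pow_le_pow_left hRtc m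
  have htr : ∀ x ∈ S ^ (((N0 ^ m) ^ (m * m)) + m * m), (x : Matrix (Fin m) (Fin m) K).trace ∈ Θ := by
    intro x hx
    rw [Matrix.trace_eq_sum_roots_charpoly]
    have hcard : (x : Matrix (Fin m) (Fin m) K).charpoly.roots.card = m := by
      rw [← (IsAlgClosed.splits _).natDegree_eq_card_roots, Matrix.charpoly_natDegree_eq_dim]
      simp
    obtain ⟨f, hf1, hf2⟩ := multiset_sum_fin _ m hcard
    refine Finset.mem_image.2 ⟨f, ?_, hf2⟩
    rw [Fintype.mem_piFinset]
    intro i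
    obtain ⟨v, hv, hv'⟩ := charpoly_root_eigenvector (hf1 i)
    have h1 := mulVec_pow_eig hv' N0
    rw [htor x hx, Matrix.one_mulVec] at h1
    have h2 : f i ^ N0 = 1 := by
      obtain ⟨k, hk⟩ := Function.ne_iff.1 hv
      have := congrFun h1 k
      simp only [Pi.smul_apply, smul_eq_mul] at this
      exact (mul_right_cancel₀ hk (by rw [one_mul]; exact this)).symm
    have h3 : (Polynomial.X ^ N0 - 1 : Polynomial K) ≠ 0 := by
      rw [← Polynomial.C_1]; exact Polynomial.X_pow_sub_C_ne_zero hN0pos 1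
    rw [hRt, Multiset.mem_toFinset, Polynomial.mem_roots h3]
    simp [h2]
  obtain ⟨w, hw1, hw2, -⟩ := exists_span_family (ι := Fin m × Fin m) (by simp [Module.finrank_matrix]) _
    (burnside hS hSI (m * m) le_rfl)
  have hS' : (S ^ ((N0 ^ m) ^ (m * m))).ncard ≤ ((N0 ^ m) ^ (m * m)) := by
    let F : Finset (Fin m × Fin m → K) := Fintype.piFinset (fun _ => Θ)
    have hF : (F : Set (Fin m × Fin m → K)).ncard ≤ (N0 ^ m) ^ (m * m) := by
      rw [Set.ncard_coe_finset]
      simp only [F]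
      rw [Fintype.card_piFinset]
      simpa using Nat.pow_le_pow_left hΘc (m * m)
    refine le_trans (Set.ncard_le_ncard_of_injOn (fun x l => (w l * (x : Matrix (Fin m) (Fin m) K)).trace) ?_ ?_ F.finite_toSet) hF
    · intro x hx
      simp only [F, Finset.mem_coe, Fintype.mem_piFinset]
      intro l
      obtain ⟨y, hy, hy'⟩ := hw1 l
      rw [← hy', Matrix.trace_mul_comm]
      exact htr (x * y) (mul_mem_pow hx hy)
    · intro x _ y _ hxy
      have : (x : Matrix (Fin m) (Fin m) K) - y = 0 := by
        apply tr_ext hw2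
        intro l
        have := congrFun hxy l
        simp only at this
        rw [Matrix.mul_sub, Matrix.trace_sub, this, sub_self]
      exact Subtype.ext (sub_eq_zero.1 this)
  have := hS.card_pow hfin hinf ((N0 ^ m) ^ (m * m))
  omega
end UPE
end

section
open scoped MatrixGroups Pointwise

namespace UPE

theorem joint_eigen {K V ι : Type} [Field K] [IsAlgClosed K] [AddCommGroup V] [Module K V]
    [FiniteDimensional K V] [Nontrivial V] (f : ι → Module.End K V) (hc : ∀ i j, Commute (f i) (f j)) :
    ∃ χ : ι → K, (⨅ i, Module.End.eigenspace (f i) (χ i)) ≠ ⊥ := by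
  classical
  let P : ℕ → Prop := fun n => ∃ U : Submodule K V, U ≠ ⊥ ∧ (∀ i, ∀ u ∈ U, f i u ∈ U) ∧ Module.finrank K U = n
  have hP : ∃ n, P n := ⟨_, ⊤, top_ne_bot, fun _ _ _ => trivial, rfl⟩
  obtain ⟨U, hU, hinv, hfr⟩ := Nat.find_spec hP
  have hmin : ∀ U' : Submodule K V, U' ≤ U → U' ≠ ⊥ → (∀ i, ∀ u ∈ U', f i u ∈ U') → U' = U := by
    intro U' hle hne hi
    apply Submodule.eq_of_le_of_finrank_le hle
    rw [hfr]
    exact Nat.find_min' hP ⟨U', hne, hi, rfl⟩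
  have hex : ∀ i, ∃ μ, U ≤ Module.End.eigenspace (f i) μ := by
    intro i
    have hnt : Nontrivial U := Submodule.nontrivial_iff_ne_bot.2 hU
    obtain ⟨μ, hμ⟩ := Module.End.exists_eigenvalue ((f i).restrict (hinv i))
    obtain ⟨v, hv, hv0⟩ := hμ.exists_hasEigenvector
    refine ⟨μ, ?_⟩
    have := hmin (U ⊓ Module.End.eigenspace (f i) μ) inf_le_left ?_ ?_
    · rw [← this]; exact inf_le_right
    · rw [Submodule.ne_bot_iff]
      refine ⟨v, ⟨v.2, ?_⟩, by simpa using hv0⟩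
      rw [SetLike.mem_coe, Module.End.mem_eigenspace_iff]
      have h1 := Module.End.mem_eigenspace_iff.1 hv
      exact congrArg Subtype.val h1
    · intro j u hu
      refine ⟨hinv j u hu.1, ?_⟩
      have h1 := Module.End.mem_eigenspace_iff.1 hu.2
      rw [SetLike.mem_coe, Module.End.mem_eigenspace_iff]
      have h2 : (f i * f j) u = (f j * f i) u := by rw [(hc i j).eq]
      rw [Module.End.mul_apply, Module.End.mul_apply, h1, map_smul] at h2
      exact h2
  choose χ hχ using hex
  refine ⟨χ, fun h => hU ?_⟩
  rw [eq_bot_iff, ← h]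
  exact le_iInf hχ

theorem exists_noncomm {K : Type} [Field K] [IsAlgClosed K] {m : ℕ}
    {S : Set (Matrix.SpecialLinearGroup (Fin m) K)} (hS : Sym S) (hSI : SI m S)
    (c : Matrix.SpecialLinearGroup (Fin m) K) (hc : ¬ IsScal (c : Matrix (Fin m) (Fin m) K)) :
    ∃ g ∈ S ^ (2 * (m * m)), c * (g * c * g⁻¹) ≠ (g * c * g⁻¹) * c := by
  classical
  by_contra! hcon
  rcases Nat.eq_zero_or_pos m with rfl | hm
  · exact hc ⟨1, Subsingleton.elim _ _⟩
  have : Nonempty (Fin m) := ⟨⟨0, hm⟩⟩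
  set Φ : Matrix.SpecialLinearGroup (Fin m) K → Matrix (Fin m) (Fin m) K :=
    fun g => ((g * c * g⁻¹ : Matrix.SpecialLinearGroup (Fin m) K) : Matrix (Fin m) (Fin m) K) with hΦ
  have hst := (hS.stab (K := K)
    (fun s => (LinearMap.mulLeft K (s : Matrix (Fin m) (Fin m) K)) ∘ₗ
      (LinearMap.mulRight K ((s⁻¹ : Matrix.SpecialLinearGroup (Fin m) K) : Matrix (Fin m) (Fin m) K)))
    Φ (by
      intro s g
      simp only [hΦ, LinearMap.comp_apply, LinearMap.mulLeft_apply, LinearMap.mulRight_apply,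
        ← Matrix.SpecialLinearGroup.coe_mul]
      congr 1; simp only [mul_inv_rev, mul_assoc]; rfl) (m * m) (by simp [Module.finrank_matrix])).1
  set W := Submodule.span K (Φ '' (S ^ (m * m))) with hW
  have hcomm0 : ∀ g ∈ S ^ (m * m), ∀ h ∈ S ^ (m * m), Commute (Φ g) (Φ h) := by
    intro g hg h hh
    have h1 := hcon (g⁻¹ * h) (hS.mul_mem (hS.inv_mem_pow hg) hh (by omega))
    have h2 : (g * c * g⁻¹) * (h * c * h⁻¹) = (h * c * h⁻¹) * (g * c * g⁻¹) := by
      have h3 : (g * c * g⁻¹) * (h * c * h⁻¹) = g * (c * (g⁻¹ * h * c * (g⁻¹ * h)⁻¹)) * g⁻¹ := by group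
      rw [h3, h1]; group
    have := congrArg (fun x : Matrix.SpecialLinearGroup (Fin m) K => (x : Matrix (Fin m) (Fin m) K)) h2
    simpa only [Matrix.SpecialLinearGroup.coe_mul] using! this
  have hcomm : ∀ x ∈ W, ∀ y ∈ W, Commute x y := by
    intro x hx y hy
    induction hx using Submodule.span_induction with
    | mem x hx =>
      obtain ⟨g, hg, rfl⟩ := hx
      induction hy using Submodule.span_induction with
      | mem y hy => obtain ⟨h, hh, rfl⟩ := hy; exact hcomm0 g hg h hh
      | zero => exact Commute.zero_right _
      | add a b _ _ ha hb => exact ha.add_right hb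
      | smul k a _ ha => exact ha.smul_right k
    | zero => exact Commute.zero_left _
    | add a b _ _ ha hb => exact ha.add_left hb
    | smul k a _ ha => exact ha.smul_left k
  let f : W → Module.End K (Fin m → K) := fun y => Matrix.toLin' y.1
  have hfc : ∀ i j, Commute (f i) (f j) := by
    intro i j
    have := (hcomm i.1 i.2 j.1 j.2).eq
    show Matrix.toLin' i.1 ∘ₗ Matrix.toLin' j.1 = Matrix.toLin' j.1 ∘ₗ Matrix.toLin' i.1
    rw [← Matrix.toLin'_mul, ← Matrix.toLin'_mul, this]
  let E : (W → K) → Submodule K (Fin m → K) := fun χ => ⨅ i, Module.End.eigenspace (f i) (χ i)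
  have hEmem : ∀ χ u, u ∈ E χ ↔ ∀ i : W, (i.1).mulVec u = χ i • u := by
    intro χ u
    simp only [E, Submodule.mem_iInf, Module.End.mem_eigenspace_iff]
    rfl
  have hind : iSupIndep E := by
    refine iSupIndep.mono (Module.End.independent_iInf_maxGenEigenspace_of_forall_mapsTo f ?_) ?_
    · intro i j φ
      exact Module.End.mapsTo_maxGenEigenspace_of_comm (hfc j i) φ
    · intro χ
      exact iInf_mono fun i => (Module.End.genEigenspace (f i) (χ i)).mono le_top
  let _ := hind.fintypeNeBotOfFiniteDimensional
  have hcard := hind.subtype_ne_bot_le_finrank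
  set Ws : Finset (Submodule K (Fin m → K)) := (Finset.univ : Finset {χ // E χ ≠ ⊥}).image (fun χ => E χ.1) with hWs
  obtain ⟨χ0, hχ0⟩ := joint_eigen f hfc
  have hmem : ∀ χ, E χ ≠ ⊥ → E χ ∈ Ws := fun χ h => Finset.mem_image.2 ⟨⟨χ, h⟩, Finset.mem_univ _, rfl⟩
  have hcW : (c : Matrix (Fin m) (Fin m) K) ∈ W :=
    Submodule.subset_span ⟨1, hS.one_mem_pow _, by simp [hΦ]⟩
  obtain ⟨s, hs, w, hw, hsw⟩ := hSI Ws ⟨_, hmem χ0 hχ0⟩ (by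
      refine Finset.card_image_le.trans ?_
      rw [Finset.card_univ]
      simpa using hcard) (by
      intro w hw
      obtain ⟨⟨χ, hχ⟩, -, rfl⟩ := Finset.mem_image.1 hw
      refine ⟨hχ, ?_⟩
      intro htop
      apply hc
      refine ⟨χ ⟨c, hcW⟩, ?_⟩
      simp only at htop
      have h1 : ∀ u, (c : Matrix (Fin m) (Fin m) K).mulVec u = χ ⟨c, hcW⟩ • u := by
        intro u
        have hu : u ∈ E χ := by rw [htop]; trivial
        exact (hEmem χ u).1 hu ⟨c, hcW⟩
      apply (Matrix.toLin' (R := K)).injective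
      apply LinearMap.ext
      intro u
      simpa using h1 u)
  obtain ⟨⟨χ, hχ⟩, -, rfl⟩ := Finset.mem_image.1 hw
  simp only at hsw
  apply hsw
  -- conjugation by s⁻¹ maps W to W
  have hconj : ∀ y ∈ W, ((s⁻¹ : Matrix.SpecialLinearGroup (Fin m) K) : Matrix (Fin m) (Fin m) K) * y * s ∈ W := by
    intro y hy
    have := hst s⁻¹ (hS.inv s hs) (Submodule.mem_map_of_mem hy)
    simp only [LinearMap.comp_apply, LinearMap.mulLeft_apply, LinearMap.mulRight_apply, inv_inv] at this
    rw [Matrix.mul_assoc]; exact this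
  have hconj' : ∀ y ∈ W, (s : Matrix (Fin m) (Fin m) K) * y * ((s⁻¹ : Matrix.SpecialLinearGroup (Fin m) K) : Matrix (Fin m) (Fin m) K) ∈ W := by
    intro y hy
    have := hst s hs (Submodule.mem_map_of_mem hy)
    simp only [LinearMap.comp_apply, LinearMap.mulLeft_apply, LinearMap.mulRight_apply] at this
    rw [Matrix.mul_assoc]; exact this
  have hss : (s : Matrix (Fin m) (Fin m) K) * ((s⁻¹ : Matrix.SpecialLinearGroup (Fin m) K) : Matrix (Fin m) (Fin m) K) = 1 := by
    rw [← Matrix.SpecialLinearGroup.coe_mul]; simp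
  have hss' : ((s⁻¹ : Matrix.SpecialLinearGroup (Fin m) K) : Matrix (Fin m) (Fin m) K) * (s : Matrix (Fin m) (Fin m) K) = 1 := by
    rw [← Matrix.SpecialLinearGroup.coe_mul]; simp
  have heq : (E χ).map (Matrix.toLin' (s : Matrix (Fin m) (Fin m) K)) = E (fun y => χ ⟨_, hconj y.1 y.2⟩) := by
    ext u
    rw [hEmem]
    constructor
    · rintro ⟨v, hv, rfl⟩ i
      have h1 := (hEmem χ v).1 hv ⟨_, hconj i.1 i.2⟩
      simp only at h1
      rw [Matrix.toLin'_apply, Matrix.mulVec_mulVec]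
      have h2 := congrArg ((s : Matrix (Fin m) (Fin m) K).mulVec) h1
      rw [Matrix.mulVec_mulVec, Matrix.mulVec_smul, ← Matrix.mul_assoc, ← Matrix.mul_assoc, hss, one_mul] at h2
      exact h2
    · intro hu
      refine ⟨((s⁻¹ : Matrix.SpecialLinearGroup (Fin m) K) : Matrix (Fin m) (Fin m) K).mulVec u, ?_, ?_⟩
      · rw [SetLike.mem_coe, hEmem]
        intro i
        have h1 := hu ⟨_, hconj' i.1 i.2⟩
        have h3 : ((s⁻¹ : Matrix.SpecialLinearGroup (Fin m) K) : Matrix (Fin m) (Fin m) K) *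
          ((s : Matrix (Fin m) (Fin m) K) * i.1 * ((s⁻¹ : Matrix.SpecialLinearGroup (Fin m) K) : Matrix (Fin m) (Fin m) K)) * s = i.1 := by
          rw [Matrix.mul_assoc, Matrix.mul_assoc, Matrix.mul_assoc, hss', mul_one, ← Matrix.mul_assoc, hss', one_mul]
        have h4 : (⟨_, hconj _ (hconj' i.1 i.2)⟩ : W) = i := Subtype.ext h3
        simp only at h1
        rw [h4] at h1
        have h2 := congrArg (((s⁻¹ : Matrix.SpecialLinearGroup (Fin m) K) : Matrix (Fin m) (Fin m) K).mulVec) h1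
        rw [Matrix.mulVec_mulVec, Matrix.mulVec_smul, ← Matrix.mul_assoc, ← Matrix.mul_assoc, hss', one_mul] at h2
        rw [Matrix.mulVec_mulVec]
        exact h2
      · rw [Matrix.toLin'_apply, Matrix.mulVec_mulVec, hss, Matrix.one_mulVec]
  rw [heq]
  apply hmem
  rw [← heq]
  intro h0
  have h1 := finrank_map_SL s (E χ)
  rw [h0, finrank_bot] at h1
  exact hχ (Submodule.finrank_eq_zero.1 h1.symm)

end UPE
end

section
open scoped MatrixGroups Pointwise

namespace UPE

set_option linter.unusedSectionVars false

/-- quasi-valuation -/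
structure QV (K Λ : Type) [Field K] [LinearOrderedCommGroupWithZero Λ] where
  v : K →*₀ Λ
  c : Λ
  hc : 1 ≤ c
  add : ∀ x y, v (x + y) ≤ c * max (v x) (v y)

section
variable {K Λ : Type} [Field K] [LinearOrderedCommGroupWithZero Λ] (q : QV K Λ) {H : Λ}

theorem QV.one_le (hH : q.c ≤ H) : 1 ≤ H := q.hc.trans hH

theorem QV.neg_one : q.v (-1) = 1 := by
  have h : q.v (-1) ^ 2 = 1 := by rw [← map_pow]; simp
  exact (pow_eq_one_iff_of_nonneg zero_le (by norm_num)).1 h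

theorem QV.neg (x : K) : q.v (-x) = q.v x := by
  rw [← neg_one_mul, map_mul, q.neg_one, one_mul]

theorem QV.add_le (hH : q.c ≤ H) {x y : K} {D : Λ} (hx : q.v x ≤ D) (hy : q.v y ≤ D) :
    q.v (x + y) ≤ H * D :=
  (q.add x y).trans (mul_le_mul' hH (max_le hx hy))

theorem QV.sum_le (hH : q.c ≤ H) {α : Type} (s : Finset α) (f : α → K) {D : Λ} {n : ℕ}
    (hn : s.card ≤ n) (hf : ∀ i ∈ s, q.v (f i) ≤ D) : q.v (∑ i ∈ s, f i) ≤ H ^ n * D := by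
  classical
  have h1 := q.one_le hH
  suffices h : q.v (∑ i ∈ s, f i) ≤ H ^ s.card * D from
    h.trans (mul_le_mul' (pow_le_pow_right' h1 hn) le_rfl)
  clear hn
  induction s using Finset.induction_on with
  | empty => simp
  | insert a s ha ih =>
    rw [Finset.sum_insert ha, Finset.card_insert_of_notMem ha, pow_succ', mul_assoc]
    apply q.add_le hH
    · refine (hf a (Finset.mem_insert_self _ _)).trans ?_
      calc D = 1 * D := (one_mul D).symm
        _ ≤ _ := mul_le_mul' (one_le_pow_of_one_le' h1 _) le_rfl
    · exact ih fun i hi => hf i (Finset.mem_insert_of_mem hi)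

theorem QV.det_le (hH : q.c ≤ H) {ι : Type} [Fintype ι] [DecidableEq ι] (A : Matrix ι ι K) (a n : ℕ)
    (hn : Fintype.card ι = n) (hA : ∀ i j, q.v (A i j) ≤ H ^ a) : q.v A.det ≤ H ^ (n.factorial + n * a) := by
  rw [Matrix.det_apply, pow_add]
  refine q.sum_le hH _ _ ?_ ?_
  · rw [Finset.card_univ, Fintype.card_perm, hn]
  · intro σ _
    have : q.v (Equiv.Perm.sign σ • ∏ i, A (σ i) i) = ∏ i, q.v (A (σ i) i) := by
      rcases Int.units_eq_one_or (Equiv.Perm.sign σ) with h | h <;> rw [h] <;> simp [map_prod, q.neg]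
    rw [this]
    calc ∏ i, q.v (A (σ i) i) ≤ ∏ i : ι, H ^ a := Finset.prod_le_prod' fun i _ => hA _ _
      _ = H ^ (n * a) := by simp [hn, ← pow_mul, mul_comm]

theorem QV.adj_le (hH : q.c ≤ H) {ι : Type} [Fintype ι] [DecidableEq ι] (A : Matrix ι ι K) (a n : ℕ)
    (hn : Fintype.card ι = n) (hA : ∀ i j, q.v (A i j) ≤ H ^ a) (i j : ι) :
    q.v (A.adjugate i j) ≤ H ^ (n.factorial + n * a) := by
  have h1 := q.one_le hH
  rw [Matrix.adjugate_apply]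
  apply q.det_le hH _ _ _ hn
  intro k l
  rw [Matrix.updateRow_apply]
  split_ifs with h
  · by_cases hl : l = i
    · subst hl; simp; exact one_le_pow_of_one_le' h1 _
    · simp [hl]
  · exact hA _ _

theorem QV.cramer (hH : q.c ≤ H) {ι : Type} [Fintype ι] [DecidableEq ι] (A : Matrix ι ι K) (a b n : ℕ)
    (hn : Fintype.card ι = n) (hA : ∀ i j, q.v (A i j) ≤ H ^ a) (hdet : A.det ≠ 0)
    (hd : (q.v A.det)⁻¹ ≤ H ^ b) (x : ι → K) {D : Λ} (hx : ∀ l, q.v (Matrix.vecMul x A l) ≤ D) (p : ι) :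
    q.v (x p) ≤ H ^ (b + (n + (n.factorial + n * a))) * D := by
  have h1 : Matrix.vecMul (Matrix.vecMul x A) A.adjugate = A.det • x := by
    rw [Matrix.vecMul_vecMul, Matrix.mul_adjugate, Matrix.vecMul_smul, Matrix.vecMul_one]
  have h2 : q.v (A.det * x p) ≤ H ^ n * (D * H ^ (n.factorial + n * a)) := by
    have := congrFun h1 p
    rw [Pi.smul_apply, smul_eq_mul] at this
    rw [← this]
    simp only [Matrix.vecMul, dotProduct]
    refine q.sum_le hH _ _ (by rw [Finset.card_univ, hn]) ?_
    intro l _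
    rw [map_mul]
    exact mul_le_mul' (hx l) (q.adj_le hH A a n hn hA _ _)
  have h3 : x p = A.det⁻¹ * (A.det * x p) := by field_simp
  rw [h3, map_mul, map_inv₀]
  calc _ ≤ H ^ b * (H ^ n * (D * H ^ (n.factorial + n * a))) := mul_le_mul' hd h2
    _ = _ := by simp only [pow_add]; simp only [mul_assoc, mul_comm, mul_left_comm]

/-- trace norm relative to a family -/
noncomputable def nrm {m : ℕ} {ι : Type} [Fintype ι] (w : ι → Matrix (Fin m) (Fin m) K)
    (x : Matrix (Fin m) (Fin m) K) : Λ := Finset.univ.sup fun l => q.v (x * w l).trace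

variable {m : ℕ} {ι : Type} [Fintype ι] (w : ι → Matrix (Fin m) (Fin m) K)

theorem nrm_le {x : Matrix (Fin m) (Fin m) K} {D : Λ} : nrm q w x ≤ D ↔ ∀ l, q.v (x * w l).trace ≤ D := by
  simp [nrm, Finset.sup_le_iff]

theorem le_nrm (x : Matrix (Fin m) (Fin m) K) (l : ι) : q.v (x * w l).trace ≤ nrm q w x :=
  (nrm_le q w).1 le_rfl l

theorem nrm_smul (c : K) (x : Matrix (Fin m) (Fin m) K) : nrm q w (c • x) = q.v c * nrm q w x := by
  apply le_antisymm
  · rw [nrm_le]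
    intro l
    rw [Matrix.smul_mul, Matrix.trace_smul, smul_eq_mul, map_mul]
    exact mul_le_mul' le_rfl (le_nrm q w x l)
  · by_cases hc : c = 0
    · simp [hc]
    have h0 : 0 < q.v c := zero_lt_iff.2 (by simpa using hc)
    rw [mul_comm, ← le_div_iff₀ h0, nrm_le]
    intro l
    rw [le_div_iff₀ h0, mul_comm, ← map_mul]
    have := le_nrm q w (c • x) l
    rwa [Matrix.smul_mul, Matrix.trace_smul, smul_eq_mul] at this

theorem nrm_add (hH : q.c ≤ H) {x y : Matrix (Fin m) (Fin m) K} {D : Λ} (hx : nrm q w x ≤ D) (hy : nrm q w y ≤ D) :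
    nrm q w (x + y) ≤ H * D := by
  rw [nrm_le] at *
  intro l
  rw [add_mul, Matrix.trace_add]
  exact q.add_le hH (hx l) (hy l)

theorem nrm_neg (x : Matrix (Fin m) (Fin m) K) : nrm q w (-x) = nrm q w x := by
  rw [← neg_one_smul K x, nrm_smul, q.neg_one, one_mul]

theorem nrm_ne_zero (hw : Submodule.span K (Set.range w) = ⊤) [DecidableEq ι] {x : Matrix (Fin m) (Fin m) K} (hx : x ≠ 0) :
    nrm q w x ≠ 0 := by
  intro h
  apply hx
  apply tr_ext hw
  intro l
  have := le_nrm q w x l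
  rw [h, le_zero_iff, map_eq_zero] at this
  rw [Matrix.trace_mul_comm, this]

/-- operator bound -/
def Op (y : Matrix (Fin m) (Fin m) K) (r : Λ) : Prop := ∀ x, nrm q w (y * x) ≤ r * nrm q w x

theorem Op.mul {x y : Matrix (Fin m) (Fin m) K} {r s : Λ} (hx : Op q w x r) (hy : Op q w y s) :
    Op q w (x * y) (r * s) := by
  intro z
  rw [mul_assoc, mul_assoc]
  exact (hx _).trans (mul_le_mul' le_rfl (hy z))

theorem Op.mono {x : Matrix (Fin m) (Fin m) K} {r s : Λ} (hx : Op q w x r) (h : r ≤ s) :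
    Op q w x s := fun z => (hx z).trans (mul_le_mul' h le_rfl)

theorem Op.add (hH : q.c ≤ H) {x y : Matrix (Fin m) (Fin m) K} {r : Λ} (hx : Op q w x r) (hy : Op q w y r) :
    Op q w (x + y) (H * r) := by
  intro z
  rw [add_mul, mul_assoc]
  exact nrm_add q w hH (hx z) (hy z)

theorem Op.neg {x : Matrix (Fin m) (Fin m) K} {r : Λ} (hx : Op q w x r) : Op q w (-x) r := by
  intro z; rw [neg_mul, nrm_neg]; exact hx z

theorem Op.sub (hH : q.c ≤ H) {x y : Matrix (Fin m) (Fin m) K} {r : Λ} (hx : Op q w x r) (hy : Op q w y r) :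
    Op q w (x - y) (H * r) := by
  rw [sub_eq_add_neg]; exact Op.add q w hH hx (Op.neg q w hy)

theorem Op.scalar (c : K) : Op q w (c • 1) (q.v c) := by
  intro z; rw [Matrix.smul_mul, one_mul, nrm_smul]

/-- basis change: `x` is a combination of `z` with coefficients bounded by any bound on traces -/
theorem coef_bound (hH : q.c ≤ H) [DecidableEq ι] (a b n : ℕ) (hn : Fintype.card ι = n)
    (z : ι → Matrix (Fin m) (Fin m) K) (hz : Submodule.span K (Set.range z) = ⊤)
    (hA : ∀ p l, q.v (z p * w l).trace ≤ H ^ a)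
    (hdet : (Matrix.of fun p l => (z p * w l).trace).det ≠ 0)
    (hd : (q.v (Matrix.of fun p l => (z p * w l).trace).det)⁻¹ ≤ H ^ b)
    (x : Matrix (Fin m) (Fin m) K) {D : Λ} (hx : nrm q w x ≤ D) :
    ∃ c : ι → K, x = ∑ p, c p • z p ∧ ∀ p, q.v (c p) ≤ H ^ (b + (n + (n.factorial + n * a))) * D := by
  have hx0 : x ∈ Submodule.span K (Set.range z) := by rw [hz]; trivial
  obtain ⟨c, hc⟩ := (Submodule.mem_span_range_iff_exists_fun K).1 hx0
  refine ⟨c, hc.symm, ?_⟩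
  refine q.cramer hH _ a b n hn (by simpa using hA) hdet hd c ?_
  intro l
  rw [nrm_le] at hx
  convert hx l using 2
  rw [← hc, Finset.sum_mul, Matrix.trace_sum]
  simp [Matrix.vecMul, dotProduct, Matrix.trace_smul]

/-- `nrm`-bound on products from coefficient bound -/
theorem nrm_sum_le (hH : q.c ≤ H) {n : ℕ} (hn : Fintype.card ι = n) (c : ι → K) (z : ι → Matrix (Fin m) (Fin m) K) {D D' : Λ}
    (hc : ∀ p, q.v (c p) ≤ D) (hz : ∀ p, nrm q w (z p) ≤ D') : nrm q w (∑ p, c p • z p) ≤ H ^ n * (D * D') := by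
  rw [nrm_le]
  intro l
  rw [Finset.sum_mul, Matrix.trace_sum]
  refine q.sum_le hH _ _ (by rw [Finset.card_univ, hn]) ?_
  intro p _
  rw [Matrix.smul_mul, Matrix.trace_smul, smul_eq_mul, map_mul]
  exact mul_le_mul' (hc p) ((nrm_le q w).1 (hz p) l)

end

end UPE
end

section
open scoped MatrixGroups Pointwise

namespace UPE

set_option linter.unusedSectionVars false
set_option linter.unusedSimpArgs false

theorem exists_Q {K : Type} [Field K] [IsAlgClosed K] {m : ℕ} (x : Matrix (Fin m) (Fin m) K) (c : K)
    (hc : c ∈ x.charpoly.roots) : ∃ l : List K, l.length ≤ m ∧ (∀ μ ∈ l, μ ∈ x.charpoly.roots) ∧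
      (l.map fun μ => x - μ • (1 : Matrix (Fin m) (Fin m) K)).prod ≠ 0 ∧
      (l.map fun μ => x - μ • (1 : Matrix (Fin m) (Fin m) K)).prod * x =
        c • (l.map fun μ => x - μ • (1 : Matrix (Fin m) (Fin m) K)).prod := by
  classical
  have hinteg : IsIntegral K x := Matrix.isIntegral x
  set P := minpoly K x with hP
  have hP0 : P ≠ 0 := minpoly.ne_zero hinteg
  have hPm : P.Monic := minpoly.monic hinteg
  have hroot : c ∈ P.roots := by
    rw [Polynomial.mem_roots hP0, hP, ← Matrix.minpoly_toLin', ← Module.End.hasEigenvalue_iff_isRoot]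
    obtain ⟨v, hv, hv'⟩ := charpoly_root_eigenvector hc
    exact Module.End.hasEigenvalue_of_hasEigenvector
      (Module.End.hasEigenvector_iff.2 ⟨Module.End.mem_eigenspace_iff.2 (by simpa using hv'), hv⟩)
  have hle : P.roots ≤ x.charpoly.roots :=
    Polynomial.roots.le_of_dvd (Matrix.charpoly_monic x).ne_zero (Matrix.minpoly_dvd_charpoly x)
  obtain ⟨t, ht⟩ := Multiset.exists_cons_of_mem hroot
  have hprod : P = (P.roots.map fun a => Polynomial.X - Polynomial.C a).prod :=
    (IsAlgClosed.splits P).eq_prod_roots_of_monic hPm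
  set l := t.toList with hl
  have hlt : (l : Multiset K) = t := Multiset.coe_toList t
  set R : Polynomial K := (l.map fun a => Polynomial.X - Polynomial.C a).prod with hR
  have hPR : P = R * (Polynomial.X - Polynomial.C c) := by
    rw [hprod, ht, Multiset.map_cons, Multiset.prod_cons, mul_comm, ← hlt, Multiset.map_coe, Multiset.prod_coe]
  have hval : Polynomial.aeval x R = (l.map fun μ => x - μ • (1 : Matrix (Fin m) (Fin m) K)).prod := by
    rw [hR, map_list_prod, List.map_map]
    congr 1
    apply List.map_congr_left
    intro a _
    simp [Algebra.algebraMap_eq_smul_one]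
  have hcard : l.length + 1 = Multiset.card P.roots := by
    rw [ht, Multiset.card_cons, ← hlt, Multiset.coe_card]
  have hRm : R.Monic := by
    have h1 : R = ((l : Multiset K).map fun a => Polynomial.X - Polynomial.C a).prod := by
      rw [Multiset.map_coe, Multiset.prod_coe]
    rw [h1]
    exact Polynomial.monic_multiset_prod_of_monic _ _ fun a _ => Polynomial.monic_X_sub_C a
  refine ⟨l, ?_, ?_, ?_, ?_⟩
  · have h1 := Multiset.card_le_card hle
    have h2 := Polynomial.card_roots' x.charpoly
    rw [Matrix.charpoly_natDegree_eq_dim, Fintype.card_fin] at h2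
    omega
  · intro μ hμ
    apply Multiset.mem_of_le hle
    rw [ht]
    apply Multiset.mem_cons_of_mem
    rw [← hlt]; exact hμ
  · rw [← hval]
    intro h0
    have h1 := minpoly.min K x hRm h0
    rw [← hP, hPR, Polynomial.degree_mul, Polynomial.degree_X_sub_C] at h1
    have h2 : R.degree ≠ ⊥ := by rw [Ne, Polynomial.degree_eq_bot]; exact hRm.ne_zero
    rw [Polynomial.degree_eq_natDegree hRm.ne_zero] at h1
    have h3 : ((R.natDegree + 1 : ℕ) : WithBot ℕ) ≤ (R.natDegree : ℕ) := by exact_mod_cast h1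
    have h4 : R.natDegree + 1 ≤ R.natDegree := by exact_mod_cast h3
    omega
  · rw [← hval]
    have h0 : Polynomial.aeval x P = 0 := minpoly.aeval K x
    rw [hPR, map_mul] at h0
    simp only [map_sub, Polynomial.aeval_X, Polynomial.aeval_C, Algebra.algebraMap_eq_smul_one, mul_sub,
      Matrix.mul_smul, mul_one] at h0
    exact sub_eq_zero.1 h0

/-- exponent for letters -/
def opC (n : ℕ) : ℕ := n + ((1 + (n + (n.factorial + n * 1))) + 1)

section
variable {K Λ : Type} [Field K] [LinearOrderedCommGroupWithZero Λ] (q : QV K Λ) {H : Λ}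
variable {m : ℕ} {ι : Type} [Fintype ι] [DecidableEq ι] (w : ι → Matrix (Fin m) (Fin m) K)

/-- standing assumptions on a basis `w` relative to a quasi valuation and size `H` -/
structure Good (H : Λ) (n : ℕ) : Prop where
  hH : q.c ≤ H
  hn : Fintype.card ι = n
  span : Submodule.span K (Set.range w) = ⊤
  tr : ∀ i j, q.v (w i * w j).trace ≤ H
  det0 : (Matrix.of fun p l => (w p * w l).trace).det ≠ 0
  det : (q.v (Matrix.of fun p l => (w p * w l).trace).det)⁻¹ ≤ H

variable {q w} {n : ℕ}

theorem Good.coef (g : Good q w H n) (x : Matrix (Fin m) (Fin m) K) {D : Λ} (hx : nrm q w x ≤ D) :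
    ∃ c : ι → K, x = ∑ p, c p • w p ∧ ∀ p, q.v (c p) ≤ H ^ (1 + (n + (n.factorial + n * 1))) * D :=
  coef_bound q w g.hH 1 1 n g.hn w g.span (by simpa using g.tr) g.det0 (by simpa using g.det) x hx

theorem Good.letter (g : Good q w H n) (b : Matrix (Fin m) (Fin m) K)
    (hb : ∀ p l, q.v (b * w p * w l).trace ≤ H) : Op q w b (H ^ opC n) := by
  intro x
  obtain ⟨c, hc, hc'⟩ := g.coef x le_rfl
  have h1 : b * x = ∑ p, c p • (b * w p) := by
    conv_lhs => rw [hc, Finset.mul_sum]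
    simp [Matrix.mul_smul]
  rw [h1]
  refine (nrm_sum_le q w g.hH g.hn c _ hc' (fun p => (nrm_le q w).2 (hb p))).trans ?_
  apply le_of_eq
  simp only [opC, pow_add, pow_one]
  ac_rfl

theorem Good.smallOp (g : Good q w H n) (hb : ∀ p, Op q w (w p) (H ^ opC n)) (y : Matrix (Fin m) (Fin m) K) {D : Λ}
    (hy : nrm q w y ≤ D) : Op q w y (H ^ (2 * opC n) * D) := by
  intro x
  obtain ⟨c, hc, hc'⟩ := g.coef y hy
  have h1 : y * x = ∑ p, c p • (w p * x) := by
    conv_lhs => rw [hc, Finset.sum_mul]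
    simp [Matrix.smul_mul]
  rw [h1]
  refine (nrm_sum_le q w g.hH g.hn c _ hc' (fun p => hb p x)).trans ?_
  have h1 : H ^ (n + (1 + (n + (n.factorial + n * 1))) + opC n) ≤ H ^ (2 * opC n) := by
    apply pow_le_pow_right' (q.one_le g.hH)
    unfold opC; omega
  refine le_trans (le_of_eq ?_) (mul_le_mul' (mul_le_mul' h1 (le_refl D)) le_rfl)
  simp only [pow_add]
  ac_rfl

theorem Op.list (hH : q.c ≤ H) (x : Matrix (Fin m) (Fin m) K) {a : ℕ} (hx : Op q w x (H ^ a)) (l : List K) (N : ℕ)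
    (hl : l.length ≤ N) (hl' : ∀ μ ∈ l, q.v μ ≤ H ^ a) :
    Op q w (l.map fun μ => x - μ • (1 : Matrix (Fin m) (Fin m) K)).prod (H ^ (N * (a + 1))) := by
  have h1 := q.one_le hH
  suffices h : Op q w (l.map fun μ => x - μ • (1 : Matrix (Fin m) (Fin m) K)).prod (H ^ (l.length * (a + 1))) from
    Op.mono q w h (pow_le_pow_right' h1 (Nat.mul_le_mul_right _ hl))
  clear hl
  induction l with
  | nil => intro z; simp
  | cons μ l ih =>
    rw [List.map_cons, List.prod_cons, List.length_cons, add_mul, one_mul, add_comm, pow_add]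
    refine Op.mul q w ?_ (ih fun ν hν => hl' ν (List.mem_cons_of_mem _ hν))
    rw [pow_succ']
    exact Op.sub q w hH hx (Op.mono q w (Op.scalar q w μ) (hl' μ List.mem_cons_self))

/-- trace bound from eigenvalues -/
theorem trace_le_of_eig [IsAlgClosed K] (hH : q.c ≤ H) (x : Matrix (Fin m) (Fin m) K)
    (hx : ∀ c ∈ x.charpoly.roots, q.v c ≤ H) : q.v x.trace ≤ H ^ (m + 1) := by
  rw [Matrix.trace_eq_sum_roots_charpoly]
  obtain ⟨f, hf, hf'⟩ := multiset_sum_fin x.charpoly.roots m (by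
    rw [← (IsAlgClosed.splits _).natDegree_eq_card_roots, Matrix.charpoly_natDegree_eq_dim, Fintype.card_fin])
  rw [← hf', pow_succ]
  exact q.sum_le hH _ _ (by simp) (fun i _ => hx _ (hf i))

end
end UPE
end

section
open scoped MatrixGroups Pointwise

namespace UPE

set_option linter.unusedSectionVars false
set_option linter.unusedSimpArgs false

/-- the letters -/
structure Dat (K : Type) [Field K] (m J k R : ℕ) where
  w : Fin m × Fin m → Matrix.SpecialLinearGroup (Fin m) K
  I : Finset (Matrix.SpecialLinearGroup (Fin m) K)
  B1 : Finset (Matrix.SpecialLinearGroup (Fin m) K)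
  a : Matrix.SpecialLinearGroup (Fin m) K
  c : ℕ → ℕ → Matrix.SpecialLinearGroup (Fin m) K
  g : ℕ → ℕ → Matrix.SpecialLinearGroup (Fin m) K
  lj : ℕ → Fin m × Fin m
  m_pos : 0 < m
  one_mem : 1 ∈ B1
  inv_mem : ∀ b ∈ B1, b⁻¹ ∈ B1
  w_mem : ∀ l, w l ∈ B1
  I_sub : I ⊆ B1
  I_ne : I.Nonempty
  a_mem : ∀ i ≤ J, a ^ i ∈ B1
  c_mem : ∀ j ∈ Finset.Icc 1 J, ∀ i ≤ k, c j i ∈ B1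
  g_mem : ∀ j ∈ Finset.Icc 1 J, ∀ i ≤ k, g j i ∈ B1
  card : B1.card ≤ R
  span : Submodule.span K (Set.range fun l => (w l : Matrix (Fin m) (Fin m) K)) = ⊤
  li : LinearIndependent K fun l => (w l : Matrix (Fin m) (Fin m) K)
  two : ∀ (Q : Bool → Matrix (Fin m) (Fin m) K), (∀ b, Q b ≠ 0) →
      ∀ e : Matrix.SpecialLinearGroup (Fin m) K → Bool,
      ∀ u : Fin m → K, (∀ g ∈ I, (Q (e g) * g.1).mulVec u = 0) → u = 0
  pj : ∀ j ∈ Finset.Icc 1 J, (((c j k : Matrix (Fin m) (Fin m) K) - 1) * (w (lj j) : Matrix (Fin m) (Fin m) K)).trace ≠ 0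
  c_zero : ∀ j ∈ Finset.Icc 1 J, c j 0 = a ^ j
  c_succ : ∀ j ∈ Finset.Icc 1 J, ∀ i < k, ¬ IsScal (c j i : Matrix (Fin m) (Fin m) K) →
    c j (i + 1) = c j i * (g j i * c j i * (g j i)⁻¹) * (c j i)⁻¹ * (g j i * c j i * (g j i)⁻¹)⁻¹
  c_ne : ∀ j ∈ Finset.Icc 1 J, ∀ i ≤ k, c j i ≠ 1
  tel : ∀ p : ℕ, p.Prime → CharP K p → ∃ x ∈ B1, ∃ t ∈ (x : Matrix (Fin m) (Fin m) K).charpoly.roots, ¬ IsIntegral ℤ t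

open Classical in
/-- predicate describing the dynamic data for one element -/
structure PB {K : Type} [Field K] {m J k R : ℕ} (d : Dat K m J k R)
    (x : Matrix (Fin m) (Fin m) K) (r : Bool → K) (Q : Bool → Matrix (Fin m) (Fin m) K)
    (z : Finset (Matrix.SpecialLinearGroup (Fin m) K) → Fin m × Fin m → Matrix (Fin m) (Fin m) K) : Prop where
  lst : ∀ b, ∃ l : List K, l.length ≤ m ∧ (∀ μ ∈ l, μ ∈ x.charpoly.roots) ∧
      (l.map fun μ => x - μ • (1 : Matrix (Fin m) (Fin m) K)).prod = Q b
  eig : ∀ b, Q b * x = r b • Q b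
  form : ∀ e p, ∃ j, ∃ g ∈ d.I, z e p = (d.w j : Matrix (Fin m) (Fin m) K) * (Q (decide (g ∈ e)) * g.1)
  span : ∀ e, Submodule.span K (Set.range (z e)) = ⊤
  ne : ∀ e, (Matrix.of fun p l => (z e p * (d.w l : Matrix (Fin m) (Fin m) K)).trace).det ≠ 0

open Classical in
theorem exists_PB {K : Type} [Field K] [IsAlgClosed K] {m J k R : ℕ} (d : Dat K m J k R)
    (x : Matrix (Fin m) (Fin m) K) (r : Bool → K) : ∃ Q z, (∀ b, r b ∈ x.charpoly.roots) → PB d x r Q z := by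
  by_cases hr : ∀ b, r b ∈ x.charpoly.roots
  · choose l hl1 hl2 hl3 hl4 using fun b => exists_Q x (r b) (hr b)
    set Q : Bool → Matrix (Fin m) (Fin m) K := fun b => ((l b).map fun μ => x - μ • (1 : Matrix (Fin m) (Fin m) K)).prod with hQ
    have hz : ∀ e : Finset (Matrix.SpecialLinearGroup (Fin m) K), ∃ z : Fin m × Fin m → Matrix (Fin m) (Fin m) K,
        (∀ p, z p ∈ {y | ∃ j, ∃ g : d.I, y = (d.w j : Matrix (Fin m) (Fin m) K) * (Q (decide (g.1 ∈ e)) * g.1.1)}) ∧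
        Submodule.span K (Set.range z) = ⊤ ∧ LinearIndependent K z := by
      intro e
      apply exists_span_family
      · simp [Module.finrank_matrix]
      · apply left_ideal_top (fun g : d.I => Q (decide (g.1 ∈ e)) * g.1.1) ?_ (fun l => (d.w l : Matrix (Fin m) (Fin m) K)) d.span
        intro u hu
        exact d.two Q hl3 (fun g => decide (g ∈ e)) u (fun g hg => hu ⟨g, hg⟩)
    choose z hz1 hz2 hz3 using hz
    refine ⟨Q, z, fun _ => ⟨fun b => ⟨l b, hl1 b, hl2 b, rfl⟩, hl4, ?_, hz2, ?_⟩⟩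
    · intro e p
      obtain ⟨j, g, h⟩ := hz1 e p
      exact ⟨j, g.1, g.2, h⟩
    · intro e
      exact trdet_ne (hz2 e) d.li
  · exact ⟨0, 0, fun h => absurd h hr⟩

section
variable {K : Type} [Field K] [IsAlgClosed K] {m J k R : ℕ} (d : Dat K m J k R)

noncomputable def Qf (x : Matrix (Fin m) (Fin m) K) (r : Bool → K) : Bool → Matrix (Fin m) (Fin m) K :=
  (exists_PB d x r).choose

noncomputable def zf (x : Matrix (Fin m) (Fin m) K) (r : Bool → K) :
    Finset (Matrix.SpecialLinearGroup (Fin m) K) → Fin m × Fin m → Matrix (Fin m) (Fin m) K :=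
  (exists_PB d x r).choose_spec.choose

theorem PBf (x : Matrix (Fin m) (Fin m) K) (r : Bool → K) (hr : ∀ b, r b ∈ x.charpoly.roots) :
    PB d x r (Qf d x r) (zf d x r) := (exists_PB d x r).choose_spec.choose_spec hr

open Classical in
noncomputable def E0 : Finset (Matrix.SpecialLinearGroup (Fin m) K) := d.B1 * d.B1 * d.B1

open Classical in
noncomputable def Tset : Finset (Σ _ : Matrix.SpecialLinearGroup (Fin m) K, (Bool → K) × Finset (Matrix.SpecialLinearGroup (Fin m) K)) :=
  (E0 d).sigma fun x => (Fintype.piFinset fun _ => (x : Matrix (Fin m) (Fin m) K).charpoly.roots.toFinset) ×ˢ d.I.powerset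

/-- determinant values -/
noncomputable def detz (t : Σ _ : Matrix.SpecialLinearGroup (Fin m) K, (Bool → K) × Finset (Matrix.SpecialLinearGroup (Fin m) K)) : K :=
  (Matrix.of fun p l => (zf d t.1 t.2.1 t.2.2 p * (d.w l : Matrix (Fin m) (Fin m) K)).trace).det

noncomputable def gram : K :=
  (Matrix.of fun p l => ((d.w p : Matrix (Fin m) (Fin m) K) * (d.w l : Matrix (Fin m) (Fin m) K)).trace).det

noncomputable def pjv (j : ℕ) : K :=
  (((d.c j k : Matrix (Fin m) (Fin m) K) - 1) * (d.w (d.lj j) : Matrix (Fin m) (Fin m) K)).trace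

theorem mem_E0 {x y z : Matrix.SpecialLinearGroup (Fin m) K} (hx : x ∈ d.B1) (hy : y ∈ d.B1) (hz : z ∈ d.B1) :
    x * y * z ∈ E0 d := by
  classical
  exact Finset.mul_mem_mul (Finset.mul_mem_mul hx hy) hz

theorem mem_E0_1 {x : Matrix.SpecialLinearGroup (Fin m) K} (hx : x ∈ d.B1) : x ∈ E0 d := by
  simpa using mem_E0 d hx d.one_mem d.one_mem

theorem mem_E0_2 {x y : Matrix.SpecialLinearGroup (Fin m) K} (hx : x ∈ d.B1) (hy : y ∈ d.B1) : x * y ∈ E0 d := by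
  simpa using mem_E0 d hx hy d.one_mem

theorem E0_iff {x : Matrix.SpecialLinearGroup (Fin m) K} : x ∈ E0 d ↔ ∃ a ∈ d.B1, ∃ b ∈ d.B1, ∃ c ∈ d.B1, x = a * b * c := by
  classical
  simp only [E0, Finset.mem_mul]
  constructor
  · rintro ⟨_, ⟨a, ha, b, hb, rfl⟩, c, hc, rfl⟩; exact ⟨a, ha, b, hb, c, hc, rfl⟩
  · rintro ⟨a, ha, b, hb, c, hc, rfl⟩; exact ⟨_, ⟨a, ha, b, hb, rfl⟩, c, hc, rfl⟩

theorem mem_Tset {t : Σ _ : Matrix.SpecialLinearGroup (Fin m) K, (Bool → K) × Finset (Matrix.SpecialLinearGroup (Fin m) K)} :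
    t ∈ Tset d ↔ t.1 ∈ E0 d ∧ (∀ b, t.2.1 b ∈ (t.1 : Matrix (Fin m) (Fin m) K).charpoly.roots) ∧ t.2.2 ⊆ d.I := by
  classical
  unfold Tset
  simp only [Finset.mem_sigma, Finset.mem_product, Fintype.mem_piFinset, Multiset.mem_toFinset, Finset.mem_powerset]

theorem card_Tset : (Tset d).card ≤ R ^ 3 * (m ^ 2 * 2 ^ R) := by
  classical
  unfold Tset
  rw [Finset.card_sigma]
  have hE : (E0 d).card ≤ R ^ 3 := by
    unfold E0
    calc _ ≤ (d.B1 * d.B1).card * d.B1.card := Finset.card_mul_le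
      _ ≤ (d.B1.card * d.B1.card) * d.B1.card := Nat.mul_le_mul_right _ Finset.card_mul_le
      _ ≤ R * R * R := Nat.mul_le_mul (Nat.mul_le_mul d.card d.card) d.card
      _ = R ^ 3 := by ring
  refine (Finset.sum_le_card_nsmul _ _ (m ^ 2 * 2 ^ R) ?_).trans (by rw [smul_eq_mul]; exact Nat.mul_le_mul_right _ hE)
  intro x _
  rw [Finset.card_product, Finset.card_powerset, Fintype.card_piFinset]
  apply Nat.mul_le_mul
  · simp only [Finset.prod_const, Finset.card_univ, Fintype.card_bool]
    apply Nat.pow_le_pow_left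
    refine (Multiset.toFinset_card_le _).trans ((Polynomial.card_roots' _).trans ?_)
    rw [Matrix.charpoly_natDegree_eq_dim, Fintype.card_fin]
  · exact Nat.pow_le_pow_right (by norm_num) ((Finset.card_le_card d.I_sub).trans d.card)

theorem gram_ne : gram d ≠ 0 := trdet_ne d.span d.li

theorem detz_ne {t} (ht : t ∈ Tset d) : detz d t ≠ 0 :=
  (PBf d t.1 t.2.1 ((mem_Tset d).1 ht).2.1).ne t.2.2

/-- exponents -/
def aB (m n : ℕ) : ℕ := m * (3 * opC n + 1) + opC n + 1
def dB (m n : ℕ) : ℕ := n.factorial + n * aB m n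
def dG (n : ℕ) : ℕ := n.factorial + n * 1
def CB (m R : ℕ) : ℕ := R ^ 3 * (m ^ 2 * 2 ^ R) * dB m (m * m)
def CY (m J R : ℕ) : ℕ := CB m R + 2 * J * (CB m R + 1)

noncomputable def PBv : K := ∏ t ∈ Tset d, detz d t
noncomputable def PJ : K := ∏ j ∈ Finset.Icc 1 J, pjv d j
noncomputable def PP : K := gram d ^ (CY m J R + 1) * (PBv d * PJ d ^ (CB m R + 1))

theorem PP_ne : PP d ≠ 0 := by
  refine mul_ne_zero (pow_ne_zero _ (gram_ne d)) (mul_ne_zero ?_ (pow_ne_zero _ ?_))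
  · exact Finset.prod_ne_zero_iff.2 fun t ht => detz_ne d ht
  · exact Finset.prod_ne_zero_iff.2 fun j hj => d.pj j hj

end
end UPE
end

section
open scoped MatrixGroups Pointwise

namespace UPE

set_option linter.unusedSectionVars false
set_option linter.unusedSimpArgs false

section
variable {K Λ : Type} [Field K] [IsAlgClosed K] [LinearOrderedCommGroupWithZero Λ] {q : QV K Λ} {m J k R : ℕ}
  {d : Dat K m J k R} {B H : Λ}

/-- the basis as matrices -/
def Dat.W {K : Type} [Field K] {m J k R : ℕ} (d : Dat K m J k R) : Fin m × Fin m → Matrix (Fin m) (Fin m) K :=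
  fun l => (d.w l : Matrix (Fin m) (Fin m) K)

/-- the eigenvalue hypothesis -/
def Eig (q : QV K Λ) (d : Dat K m J k R) (B : Λ) : Prop :=
  q.c ≤ B ∧ ∀ x ∈ E0 d, ∀ c ∈ (x : Matrix (Fin m) (Fin m) K).charpoly.roots, q.v c ≤ B

/-- all hypotheses -/
structure Setup (q : QV K Λ) (d : Dat K m J k R) (B H : Λ) : Prop where
  eig : Eig q d B
  BH : B ^ (m + 1) ≤ H
  good : Good q d.W H (m * m)

theorem Eig.one_le (h : Eig q d B) : 1 ≤ B := q.hc.trans h.1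

theorem Eig.trace (h : Eig q d B) {x} (hx : x ∈ E0 d) :
    q.v (x : Matrix (Fin m) (Fin m) K).trace ≤ B ^ (m + 1) := trace_le_of_eig h.1 _ (h.2 x hx)

theorem Eig.le (h : Eig q d B) : B ≤ B ^ (m + 1) := by
  conv_lhs => rw [← pow_one B]
  exact pow_le_pow_right' h.one_le (by omega)

theorem Eig.setup (h : Eig q d B) (BH : B ^ (m + 1) ≤ H) (hg : (q.v (gram d))⁻¹ ≤ H) : Setup q d B H := by
  refine ⟨h, BH, ⟨h.1.trans (h.le.trans BH), by simp, d.span, ?_, gram_ne d, hg⟩⟩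
  intro i j
  have := (h.trace (mem_E0_2 d (d.w_mem i) (d.w_mem j))).trans BH
  simpa using! this

theorem Setup.one_le (s : Setup q d B H) : 1 ≤ H := q.one_le s.good.hH

theorem Setup.B_le (s : Setup q d B H) : B ≤ H := s.eig.le.trans s.BH

theorem Setup.letter (s : Setup q d B H) {b : Matrix.SpecialLinearGroup (Fin m) K} (hb : b ∈ d.B1) :
    Op q d.W (b : Matrix (Fin m) (Fin m) K) (H ^ opC (m * m)) := by
  apply s.good.letter
  intro p l
  have := (s.eig.trace (mem_E0 d hb (d.w_mem p) (d.w_mem l))).trans s.BH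
  simpa using! this

theorem Setup.op3 (s : Setup q d B H) {b : Matrix.SpecialLinearGroup (Fin m) K} (hb : b ∈ E0 d) :
    Op q d.W (b : Matrix (Fin m) (Fin m) K) (H ^ (3 * opC (m * m))) := by
  obtain ⟨x, hx, y, hy, z, hz, rfl⟩ := (E0_iff d).1 hb
  have := Op.mul q d.W (Op.mul q d.W (s.letter hx) (s.letter hy)) (s.letter hz)
  have e : H ^ opC (m * m) * H ^ opC (m * m) * H ^ opC (m * m) = H ^ (3 * opC (m * m)) := by
    rw [← pow_add, ← pow_add]; congr 1; ring
  rw [e] at this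
  simpa using this

theorem Setup.opQ (s : Setup q d B H) {x : Matrix.SpecialLinearGroup (Fin m) K} (hx : x ∈ E0 d) (r : Bool → K)
    (hr : ∀ b, r b ∈ (x : Matrix (Fin m) (Fin m) K).charpoly.roots) (b : Bool) :
    Op q d.W (Qf d x r b) (H ^ (m * (3 * opC (m * m) + 1))) := by
  obtain ⟨l, h1, h2, h3⟩ := (PBf d x r hr).lst b
  rw [← h3]
  apply Op.list s.good.hH _ (s.op3 hx) l m h1
  intro μ hμ
  refine (s.eig.2 x hx μ (h2 μ hμ)).trans (s.B_le.trans ?_)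
  conv_lhs => rw [← pow_one H]
  apply pow_le_pow_right' s.one_le
  unfold opC; omega

theorem Setup.nrmW (s : Setup q d B H) (l : Fin m × Fin m) : nrm q d.W (d.W l) ≤ H := (nrm_le q d.W).2 (s.good.tr l)

theorem Setup.entry (s : Setup q d B H) {t} (ht : t ∈ Tset d) (p l) :
    q.v (zf d t.1 t.2.1 t.2.2 p * d.W l).trace ≤ H ^ aB m (m * m) := by
  classical
  obtain ⟨h1, h2, h3⟩ := (mem_Tset d).1 ht
  obtain ⟨j, g, hg, h⟩ := (PBf d t.1 t.2.1 h2).form t.2.2 p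
  rw [h]
  have e : ((d.w j : Matrix (Fin m) (Fin m) K) * (Qf d t.1 t.2.1 (decide (g ∈ t.2.2)) * g.1) * d.W l).trace
    = ((Qf d t.1 t.2.1 (decide (g ∈ t.2.2)) * (g.1 * d.W l)) * d.W j).trace := by
    rw [mul_assoc, Matrix.trace_mul_comm, mul_assoc (Qf _ _ _ _)]; rfl
  have h4 := (s.opQ h1 t.2.1 h2 (decide (g ∈ t.2.2)) (g.1 * d.W l)).trans
    (mul_le_mul' le_rfl ((s.letter (d.I_sub hg) (d.W l)).trans (mul_le_mul' le_rfl (s.nrmW l))))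
  refine le_trans (le_of_eq ?_) ((le_nrm q d.W _ j).trans (h4.trans (le_of_eq ?_)))
  · rw [← e]
  · simp only [aB, pow_add, pow_one]; ac_rfl

theorem Setup.detz_le (s : Setup q d B H) {t} (ht : t ∈ Tset d) : q.v (detz d t) ≤ H ^ dB m (m * m) :=
  q.det_le s.good.hH _ _ _ (by simp) (s.entry ht)

theorem Setup.gram_le (s : Setup q d B H) : q.v (gram d) ≤ H ^ dG (m * m) :=
  q.det_le s.good.hH _ _ _ (by simp) (by rw [pow_one]; exact s.good.tr)

theorem Setup.pjv_le (s : Setup q d B H) {j} (hj : j ∈ Finset.Icc 1 J) : q.v (pjv d j) ≤ H ^ 2 := by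
  unfold pjv
  rw [sub_mul, Matrix.trace_sub, sub_eq_add_neg, pow_two, one_mul]
  apply q.add_le s.good.hH
  · have := (s.eig.trace (mem_E0_2 d (d.c_mem j hj k le_rfl) (d.w_mem (d.lj j)))).trans s.BH
    simpa using! this
  · rw [q.neg]
    exact (s.eig.trace (mem_E0_1 d (d.w_mem (d.lj j)))).trans s.BH

theorem prod_bd (_s : Setup q d B H) {α : Type} (T : Finset α) (f : α → K) (e N : ℕ) (h1 : 1 ≤ H) (hN : T.card ≤ N) (h : ∀ t ∈ T, q.v (f t) ≤ H ^ e) :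
    q.v (∏ t ∈ T, f t) ≤ H ^ (N * e) := by
  rw [map_prod]
  calc _ ≤ ∏ t ∈ T, H ^ e := Finset.prod_le_prod' h
    _ = H ^ (T.card * e) := by rw [Finset.prod_const, ← pow_mul, mul_comm]
    _ ≤ _ := pow_le_pow_right' h1 (Nat.mul_le_mul_right _ hN)

theorem Setup.PBv_le (s : Setup q d B H) : q.v (PBv d) ≤ H ^ CB m R :=
  prod_bd s _ _ _ _ s.one_le (card_Tset d) fun _ ht => s.detz_le ht

theorem Setup.PJ_le (s : Setup q d B H) : q.v (PJ d) ≤ H ^ (J * 2) :=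
  prod_bd s _ _ _ _ s.one_le (by simp) fun _ hj => s.pjv_le hj

theorem Setup.Y_le (s : Setup q d B H) : q.v (PBv d * PJ d ^ (CB m R + 1)) ≤ H ^ CY m J R := by
  rw [map_mul, map_pow]
  calc _ ≤ H ^ CB m R * (H ^ (J * 2)) ^ (CB m R + 1) := mul_le_mul' s.PBv_le (pow_le_pow_left' s.PJ_le _)
    _ = _ := by rw [← pow_mul, ← pow_add]; congr 1; unfold CY; ring

theorem Setup.detz_inv (s : Setup q d B H) (hP : 1 ≤ q.v (PP d)) {t} (ht : t ∈ Tset d) :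
    (q.v (detz d t))⁻¹ ≤ H ^ (dG (m * m) * (CY m J R + 1) + CY m J R) := by
  classical
  have h0 : 0 < q.v (detz d t) := zero_lt_iff.2 ((map_ne_zero _).2 (detz_ne d ht))
  have e : PP d = detz d t * (gram d ^ (CY m J R + 1) * ((∏ x ∈ (Tset d).erase t, detz d x) * PJ d ^ (CB m R + 1))) := by
    unfold PP PBv
    rw [← Finset.mul_prod_erase _ _ ht]; ring
  rw [e, map_mul] at hP
  rw [inv_le_iff_one_le_mul₀' h0]
  refine hP.trans (mul_le_mul' le_rfl ?_)
  simp only [map_mul, map_pow]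
  have h2 : q.v (∏ x ∈ (Tset d).erase t, detz d x) ≤ H ^ CB m R :=
    prod_bd s _ _ _ _ s.one_le ((Finset.card_le_card (Finset.erase_subset _ _)).trans (card_Tset d))
      fun _ hx => s.detz_le (Finset.mem_of_mem_erase hx)
  calc _ ≤ (H ^ dG (m * m)) ^ (CY m J R + 1) * (H ^ CB m R * (H ^ (J * 2)) ^ (CB m R + 1)) :=
        mul_le_mul' (pow_le_pow_left' s.gram_le _) (mul_le_mul' h2 (pow_le_pow_left' s.PJ_le _))
    _ = _ := by rw [← pow_mul, ← pow_mul, ← pow_add, ← pow_add]; congr 1; unfold CY; ring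

theorem Setup.PJ_inv (s : Setup q d B H) (hP : 1 ≤ q.v (PP d)) : 1 ≤ H ^ (dG (m * m) * (2 * J + 1) + 1) * q.v (PJ d) := by
  have h : 1 ≤ (H ^ (dG (m * m) * (2 * J + 1) + 1) * q.v (PJ d)) ^ (CB m R + 1) := by
    refine hP.trans ?_
    unfold PP
    simp only [map_mul, map_pow]
    rw [mul_pow, ← mul_assoc]
    refine mul_le_mul' ?_ le_rfl
    calc _ ≤ (H ^ dG (m * m)) ^ (CY m J R + 1) * H ^ (CB m R + 1) :=
          mul_le_mul' (pow_le_pow_left' s.gram_le _) (s.PBv_le.trans (pow_le_pow_right' s.one_le (Nat.le_succ _)))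
      _ = _ := by rw [← pow_mul, ← pow_mul, ← pow_add]; congr 1; unfold CY; ring
  by_contra hlt
  push Not at hlt
  exact absurd h (not_le.2 (pow_lt_one₀ zero_le hlt (by omega)))

theorem Eig.setup_of_PP (h : Eig q d B) (hP : 1 ≤ q.v (PP d)) : Setup q d B (B ^ (m + 1)) := by
  apply h.setup le_rfl
  by_contra hlt
  push Not at hlt
  have s := h.setup hlt.le le_rfl
  have hB1 : 1 ≤ B ^ (m + 1) := one_le_pow_of_one_le' h.one_le _
  have h1 := hP
  unfold PP at h1
  rw [map_mul, map_pow] at h1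
  have h2 := h1.trans (mul_le_mul' le_rfl s.Y_le)
  have h0 : q.v (gram d) ≠ 0 := (map_ne_zero _).2 (gram_ne d)
  rw [pow_succ, mul_right_comm, ← mul_pow, mul_inv_cancel₀ h0, one_pow, one_mul] at h2
  have h3 : (q.v (gram d))⁻¹ ≤ 1 := inv_le_one_of_one_le₀ h2
  exact absurd (h3.trans hB1) (not_le.2 hlt)

/-- if `B = 1` and `1 ≤ v P` then `v P ≤ 1`. -/
theorem Setup.PP_le (s : Setup q d B H) : q.v (PP d) ≤ H ^ (dG (m * m) * (CY m J R + 1) + CY m J R) := by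
  unfold PP
  rw [map_mul, map_pow, pow_add H, pow_mul]
  exact mul_le_mul' (pow_le_pow_left' s.gram_le _) s.Y_le

end
end UPE
end

section
open scoped MatrixGroups Pointwise

namespace UPE

set_option linter.unusedSectionVars false
set_option linter.unusedSimpArgs false

/-- final exponents -/
def bF (m J R : ℕ) : ℕ := dG (m * m) * (CY m J R + 1) + CY m J R
def cF (m J R : ℕ) : ℕ :=
  bF m J R + (m * m + ((m * m).factorial + m * m * aB m (m * m)))
def eF (m J R : ℕ) : ℕ := m * m + (cF m J R + 1 + (m * (3 * opC (m * m) + 1) + opC (m * m)))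
def MF (m J R : ℕ) : ℕ := (m + 1) * eF m J R + 1

section
variable {K Λ : Type} [Field K] [IsAlgClosed K] [LinearOrderedCommGroupWithZero Λ] {q : QV K Λ} {m J k R : ℕ}
  {d : Dat K m J k R} {B : Λ}

theorem exists_small_root (q : QV K Λ) (hm : 0 < m) (x : Matrix.SpecialLinearGroup (Fin m) K) :
    ∃ c ∈ (x : Matrix (Fin m) (Fin m) K).charpoly.roots, q.v c ≤ 1 := by
  by_contra! hcon
  have h1 : (x : Matrix (Fin m) (Fin m) K).charpoly.roots.prod = 1 := by
    rw [← Matrix.det_eq_prod_roots_charpoly]; exact x.2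
  have h2 := (IsAlgClosed.splits (x : Matrix (Fin m) (Fin m) K).charpoly).natDegree_eq_card_roots
  rw [Matrix.charpoly_natDegree_eq_dim, Fintype.card_fin] at h2
  have key : ∀ s : Multiset K, (∀ c ∈ s, 1 < q.v c) → 0 < Multiset.card s → 1 < q.v s.prod := by
    intro s
    induction s using Multiset.induction_on with
    | empty => intro _ h; simp at h
    | cons a s ih =>
      intro h _
      rw [Multiset.prod_cons, map_mul]
      have ha := h a (Multiset.mem_cons_self _ _)
      rcases Nat.eq_zero_or_pos (Multiset.card s) with h0 | h0
      · rw [Multiset.card_eq_zero] at h0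
        subst h0; simpa using ha
      · exact one_lt_mul ha.le (ih (fun c hc => h c (Multiset.mem_cons_of_mem hc)) h0)
  have := key _ hcon (by omega)
  rw [h1, map_one] at this
  exact lt_irrefl _ this

theorem conj_pow_mul (x g : Matrix.SpecialLinearGroup (Fin m) K) (i : ℕ) (y : Matrix (Fin m) (Fin m) K) :
    (g : Matrix (Fin m) (Fin m) K) * (((g⁻¹ * x * g : Matrix.SpecialLinearGroup (Fin m) K) : Matrix (Fin m) (Fin m) K) ^ i * y)
    = (x : Matrix (Fin m) (Fin m) K) ^ i * ((g : Matrix (Fin m) (Fin m) K) * y) := by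
  have h : g * (g⁻¹ * x * g) ^ i = x ^ i * g := by
    have : (g⁻¹ * x * g) ^ i = g⁻¹ * x ^ i * g := by
      have := conj_pow (i := i) (a := g⁻¹) (b := x)
      rwa [inv_inv] at this
    rw [this]; group
  have h2 := congrArg (fun z : Matrix.SpecialLinearGroup (Fin m) K => (z : Matrix (Fin m) (Fin m) K)) h
  simp only [Matrix.SpecialLinearGroup.coe_mul, Matrix.SpecialLinearGroup.coe_pow] at h2
  rw [← mul_assoc, ← mul_assoc, ← h2]
  simp only [Matrix.SpecialLinearGroup.coe_mul]

theorem Q_pow {Q x : Matrix (Fin m) (Fin m) K} {c : K} (h : Q * x = c • Q) (i : ℕ) : Q * x ^ i = c ^ i • Q := by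
  induction i with
  | zero => simp
  | succ i ih => rw [pow_succ, ← mul_assoc, ih, Matrix.smul_mul, h, smul_smul, pow_succ]

theorem Setup.zcoef {H : Λ} (s : Setup q d B H) (hP : 1 ≤ q.v (PP d)) {t} (ht : t ∈ Tset d) (l) :
    ∃ c : Fin m × Fin m → K, d.W l = ∑ p, c p • zf d t.1 t.2.1 t.2.2 p ∧
      ∀ p, q.v (c p) ≤ H ^ cF m J R * H := by
  have h1 := s.detz_inv hP ht
  rw [← bF] at h1
  have h2 := detz_ne d ht
  have pb := PBf d t.1 t.2.1 ((mem_Tset d).1 ht).2.1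
  unfold detz at h1 h2
  rw [cF]
  exact coef_bound q d.W s.good.hH (aB m (m * m)) (bF m J R) (m * m) (by simp) (zf d t.1 t.2.1 t.2.2) (pb.span _)
        (s.entry ht) h2 h1 (d.W l) (s.nrmW l)

theorem Setup.ping (s : Setup q d B (B ^ (m + 1))) (hP : 1 ≤ q.v (PP d)) (hB : 1 < B)
    {x : Matrix.SpecialLinearGroup (Fin m) K} (hx : x ∈ E0 d) {c1 : K}
    (hc1 : c1 ∈ (x : Matrix (Fin m) (Fin m) K).charpoly.roots) (hc1B : q.v c1 = B)
    {S : Set (Matrix.SpecialLinearGroup (Fin m) K)} (hS : Sym S) {L : ℕ} (hL : ∀ b ∈ d.B1, b ∈ S ^ L) :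
    PingData S (5 * L) R (2 * MF m J R + 1) := by
  classical
  set H := B ^ (m + 1) with hH
  set M := MF m J R with hM
  obtain ⟨c2, hc2, hc2'⟩ := exists_small_root q d.m_pos x
  set r : Bool → K := fun b => if b then c1 else c2 with hr
  have hrr : ∀ b, r b ∈ (x : Matrix (Fin m) (Fin m) K).charpoly.roots := by
    intro b; cases b
    · simpa [hr] using hc2
    · simpa [hr] using hc1
  set Q := Qf d x r with hQ
  have pb := PBf d x r hrr
  rw [← hQ] at pb
  set N : Matrix.SpecialLinearGroup (Fin m) K → Bool → Matrix (Fin m) (Fin m) K → Λ :=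
    fun g b y => nrm q d.W (Q b * ((g : Matrix (Fin m) (Fin m) K) * y)) with hN
  have hNs : ∀ g b (c : K) y, N g b (c • y) = q.v c * N g b y := by
    intro g b c y
    simp only [hN, Matrix.mul_smul, nrm_smul]
  have hNi : ∀ (g : Matrix.SpecialLinearGroup (Fin m) K) b (i : ℕ) y,
      N g b (((g⁻¹ * x * g : Matrix.SpecialLinearGroup (Fin m) K) : Matrix (Fin m) (Fin m) K) ^ i * y) = q.v (r b) ^ i * N g b y := by
    intro g b i y
    simp only [hN]
    rw [conj_pow_mul, ← mul_assoc, Q_pow (pb.eig b), Matrix.smul_mul, nrm_smul, map_pow]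
  have hBM : 0 < B ^ M := pow_pos (zero_lt_one.trans hB) _
  refine ⟨d.I, fun g => g⁻¹ * x * g, fun g => {y | N g true y ≠ 0 ∧ N g false y ≠ 0 ∧
    N g true y ≤ B ^ M * N g false y ∧ N g false y ≤ B ^ M * N g true y},
    (Finset.card_le_card d.I_sub).trans d.card, ?_, ?_, ?_, ?_⟩
  · intro g hg
    obtain ⟨a, ha, b, hb, c, hc, rfl⟩ := (E0_iff d).1 hx
    have hgL := hL g (d.I_sub hg)
    have h3 : a * b * c ∈ S ^ (3 * L) :=
      hS.mul_mem (hS.mul_mem (k := 2 * L) (hL a ha) (hL b hb) (by omega)) (hL c hc) (by omega)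
    exact hS.mul_mem (hS.mul_mem (k := 4 * L) (hS.inv_mem_pow hgL) h3 (by omega)) hgL (by omega)
  · rintro g hg y ⟨h1, h2, h3, h4⟩ c hc
    have hc0 : q.v c ≠ 0 := (map_ne_zero _).2 hc
    refine ⟨?_, ?_, ?_, ?_⟩
    · rw [hNs]; exact mul_ne_zero hc0 h1
    · rw [hNs]; exact mul_ne_zero hc0 h2
    · rw [hNs, hNs, mul_left_comm]; exact mul_le_mul' le_rfl h3
    · rw [hNs, hNs, mul_left_comm]; exact mul_le_mul' le_rfl h4
  · intro y hy
    by_contra! hcon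
    have hch : ∀ g ∈ d.I, ∃ b, B ^ M * N g b y ≤ N g (!b) y := by
      intro g hg
      by_contra! hb
      apply hcon g hg
      have ht := hb true
      have hf := hb false
      simp only [Bool.not_true, Bool.not_false] at ht hf
      refine ⟨?_, ?_, hf.le, ht.le⟩
      · intro h0; rw [h0, mul_zero] at ht; exact not_lt_zero ht
      · intro h0; rw [h0, mul_zero] at hf; exact not_lt_zero hf
    set e : Finset (Matrix.SpecialLinearGroup (Fin m) K) := d.I.filter (fun g => B ^ M * N g true y ≤ N g false y) with he
    have hee : ∀ g ∈ d.I, B ^ M * N g (decide (g ∈ e)) y ≤ N g (!(decide (g ∈ e))) y := by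
      intro g hg
      by_cases hge : g ∈ e
      · simp only [hge, decide_true, Bool.not_true]
        exact (Finset.mem_filter.1 hge).2
      · simp only [hge, decide_false, Bool.not_false]
        obtain ⟨b, hb⟩ := hch g hg
        cases b
        · exact hb
        · exact absurd (Finset.mem_filter.2 ⟨hg, hb⟩) hge
    have ht : (⟨x, r, e⟩ : Σ _ : Matrix.SpecialLinearGroup (Fin m) K, (Bool → K) × Finset (Matrix.SpecialLinearGroup (Fin m) K)) ∈ Tset d :=
      (mem_Tset d).2 ⟨hx, hrr, Finset.filter_subset _ _⟩
    have hy0 : nrm q d.W y ≠ 0 := nrm_ne_zero q d.W d.span hy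
    have key : B ^ M * nrm q d.W y ≤ H ^ eF m J R * nrm q d.W y := by
      rw [mul_comm, ← le_div_iff₀ hBM, nrm_le]
      intro l
      rw [le_div_iff₀ hBM]
      obtain ⟨c, hc, hc'⟩ := s.zcoef hP ht l
      simp only at hc hc'
      have h1 : (y * d.W l).trace * 1 = ∑ p, c p * (zf d x r e p * y).trace := by
        rw [mul_one, Matrix.trace_mul_comm]
        conv_lhs => rw [hc, Finset.sum_mul, Matrix.trace_sum]
        simp [Matrix.trace_smul]
      rw [mul_one] at h1
      rw [h1]
      have h2 : ∀ p, q.v (zf d x r e p * y).trace ≤ H ^ (m * (3 * opC (m * m) + 1) + opC (m * m)) * nrm q d.W y / B ^ M := by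
        intro p
        obtain ⟨j, g, hg, hz⟩ := pb.form e p
        rw [le_div_iff₀ hBM, mul_comm]
        have h3 : (zf d x r e p * y).trace = (Q (decide (g ∈ e)) * ((g : Matrix (Fin m) (Fin m) K) * y) * d.W j).trace := by
          rw [Matrix.trace_mul_comm _ (d.W j)]
          have hz' : zf d x r e p = d.W j * (Q (decide (g ∈ e)) * g.1) := by
            rw [hz]; unfold Dat.W; congr!
          rw [hz', mul_assoc, mul_assoc]
        rw [h3]
        refine (mul_le_mul' le_rfl (le_nrm q d.W _ j)).trans ((hee g hg).trans ?_)
        refine (s.opQ hx r hrr _ _).trans ?_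
        rw [pow_add, mul_assoc]
        exact mul_le_mul' le_rfl (s.letter (d.I_sub hg) y)
      have h3 : q.v (∑ p, c p * (zf d x r e p * y).trace) ≤
          H ^ (m * m) * ((H ^ cF m J R * H) * (H ^ (m * (3 * opC (m * m) + 1) + opC (m * m)) * nrm q d.W y / B ^ M)) := by
        refine q.sum_le s.good.hH _ _ (by simp) ?_
        intro p _
        rw [map_mul]
        exact mul_le_mul' (hc' p) (h2 p)
      refine (mul_le_mul' h3 le_rfl).trans (le_of_eq ?_)
      rw [mul_div_assoc', mul_div_assoc', div_mul_cancel₀ _ hBM.ne']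
      simp only [eF, pow_add, pow_one]
      ac_rfl
    have h5 : B ^ M ≤ B ^ ((m + 1) * eF m J R) := by
      rw [pow_mul]
      exact le_of_mul_le_mul_right key (zero_lt_iff.2 hy0)
    have h6 : B ^ ((m + 1) * eF m J R) < B ^ M := pow_lt_pow_right₀ hB (by rw [hM, MF]; omega)
    exact absurd h5 (not_le.2 h6)
  · rintro g hg i hi y ⟨h1, h2, h3, h4⟩ ⟨h5, h6, h7, h8⟩
    rw [hNi, hNi] at h7
    have e1 : r true = c1 := by simp [hr]
    have e2 : r false = c2 := by simp [hr]
    rw [e1, e2, hc1B] at h7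
    have h9 : B ^ i * N g true y ≤ B ^ (2 * M) * N g true y := by
      refine h7.trans ?_
      calc B ^ M * (q.v c2 ^ i * N g false y) ≤ B ^ M * (1 * (B ^ M * N g true y)) :=
            mul_le_mul' le_rfl (mul_le_mul' (pow_le_one' hc2' _) h4)
        _ = _ := by rw [one_mul, ← mul_assoc, ← pow_add, two_mul]
    have h10 := le_of_mul_le_mul_right h9 (zero_lt_iff.2 h1)
    exact absurd h10 (not_le.2 (pow_lt_pow_right₀ hB (by omega)))

end
end UPE
end

section
open scoped MatrixGroups Pointwise NNReal

namespace UPE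

set_option linter.unusedSectionVars false
set_option linter.unusedSimpArgs false

/-- archimedean quasi valuation -/
noncomputable def qArch {K : Type} [Field K] (σ : K →+* ℂ) : QV K ℝ≥0 where
  v := (nnnormHom : ℂ →*₀ ℝ≥0).comp σ.toMonoidWithZeroHom
  c := 2
  hc := by norm_num
  add := by
    intro x y
    show ‖σ (x + y)‖₊ ≤ 2 * max ‖σ x‖₊ ‖σ y‖₊
    rw [map_add, two_mul]
    exact (nnnorm_add_le _ _).trans (add_le_add (le_max_left _ _) (le_max_right _ _))

theorem qArch_v {K : Type} [Field K] (σ : K →+* ℂ) (x : K) : (qArch σ).v x = ‖σ x‖₊ := rfl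

theorem pigeon (ι : Type) [Fintype ι] (H ξ : ℝ) (hξ : 0 < ξ) : ∃ J : ℕ, ∀ f : ℕ → ι → ℂ, (∀ i l, ‖f i l‖ ≤ H) →
    ∃ i j, i < j ∧ j ≤ J ∧ ∀ l, ‖f j l - f i l‖ ≤ ξ := by
  classical
  by_cases hH : 0 ≤ H
  swap
  · refine ⟨1, fun f hf => ⟨0, 1, by norm_num, le_rfl, fun l => ?_⟩⟩
    exact absurd ((norm_nonneg _).trans (hf 0 l)) hH
  obtain ⟨t, ht1, ht2, ht3⟩ := (isCompact_closedBall (0 : ι → ℂ) H).finite_cover_balls (e := ξ / 2) (by positivity)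
  refine ⟨ht2.toFinset.card, fun f hf => ?_⟩
  have hmem : ∀ i, ∃ x ∈ ht2.toFinset, dist (f i) x < ξ / 2 := by
    intro i
    have : f i ∈ Metric.closedBall (0 : ι → ℂ) H := by
      rw [mem_closedBall_zero_iff, pi_norm_le_iff_of_nonneg hH]; exact hf i
    obtain ⟨x, hx, hx'⟩ := Set.mem_iUnion₂.1 (ht3 this)
    exact ⟨x, by simpa using hx, hx'⟩
  choose F hF1 hF2 using hmem
  obtain ⟨i, hi, j, hj, hij, hFij⟩ := Finset.exists_ne_map_eq_of_card_lt_of_maps_to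
    (s := Finset.range (ht2.toFinset.card + 1)) (t := ht2.toFinset) (f := F) (by simp) (fun i _ => hF1 i)
  have key : ∀ i j, F i = F j → ∀ l, ‖f j l - f i l‖ ≤ ξ := by
    intro i j h l
    have h1 : dist (f j) (f i) < ξ := by
      calc dist (f j) (f i) ≤ dist (f j) (F j) + dist (f i) (F j) := dist_triangle_right _ _ _
        _ < ξ / 2 + ξ / 2 := add_lt_add (hF2 j) (by rw [← h]; exact hF2 i)
        _ = ξ := by ring
    have h2 := dist_le_pi_dist (f j) (f i) l
    rw [dist_eq_norm] at h2
    exact h2.trans h1.le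
  rw [Finset.mem_range] at hi hj
  rcases lt_or_gt_of_ne hij with h | h
  · exact ⟨i, j, h, by omega, key i j hFij⟩
  · exact ⟨j, i, h, by omega, key j i hFij.symm⟩

theorem root_unity_far {z : ℂ} {m : ℕ} (hm : 0 < m) (hz : z ^ m = 1) (hz1 : z ≠ 1) : 1 ≤ (m : ℝ) * ‖z - 1‖ := by
  have hn : ‖z‖ = 1 := by
    have : ‖z‖ ^ m = 1 := by rw [← norm_pow, hz, norm_one]
    exact (pow_eq_one_iff_of_nonneg (norm_nonneg _) (by omega)).1 this
  have hsum : ∑ i ∈ Finset.range m, z ^ i = 0 := by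
    have h1 := geom_sum_mul z m
    rw [hz, sub_self] at h1
    exact (mul_eq_zero.1 h1).resolve_right (sub_ne_zero.2 hz1)
  have hi : ∀ i : ℕ, ‖z ^ i - 1‖ ≤ i * ‖z - 1‖ := by
    intro i
    rw [← geom_sum_mul, norm_mul]
    refine mul_le_mul_of_nonneg_right ?_ (norm_nonneg _)
    refine (norm_sum_le _ _).trans ?_
    simp [norm_pow, hn]
  have h2 : (m : ℝ) ≤ ∑ i ∈ Finset.range m, (m : ℝ) * ‖z - 1‖ := by
    have h3 : (m : ℂ) = - ∑ i ∈ Finset.range m, (z ^ i - 1) := by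
      rw [Finset.sum_sub_distrib, hsum]; simp
    calc (m : ℝ) = ‖(m : ℂ)‖ := by simp
      _ = ‖∑ i ∈ Finset.range m, (z ^ i - 1)‖ := by rw [h3, norm_neg]
      _ ≤ ∑ i ∈ Finset.range m, ‖z ^ i - 1‖ := norm_sum_le _ _
      _ ≤ _ := Finset.sum_le_sum fun i hi' => (hi i).trans (mul_le_mul_of_nonneg_right
          (by exact_mod_cast (Finset.mem_range.1 hi').le) (norm_nonneg _))
  rw [Finset.sum_const, Finset.card_range, nsmul_eq_mul] at h2
  have h4 : (0:ℝ) < m := by exact_mod_cast hm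
  by_contra hlt
  push Not at hlt
  nlinarith

section
variable {K : Type} [Field K] [IsAlgClosed K] {m J k R : ℕ} {d : Dat K m J k R}

/-- commutator step -/
theorem Setup.comm_step {Λ : Type} [LinearOrderedCommGroupWithZero Λ] {q : QV K Λ} {B H : Λ} (s : Setup q d B H)
    {x g : Matrix.SpecialLinearGroup (Fin m) K} (hx : x ∈ d.B1) (hg : g ∈ d.B1) {κ : Λ}
    (h : Op q d.W ((x : Matrix (Fin m) (Fin m) K) - 1) κ) :
    Op q d.W (((x * (g * x * g⁻¹) * x⁻¹ * (g * x * g⁻¹)⁻¹ : Matrix.SpecialLinearGroup (Fin m) K) :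
      Matrix (Fin m) (Fin m) K) - 1) (H ^ (6 * opC (m * m) + 1) * κ ^ 2) := by
  set o := opC (m * m)
  set y := g * x * g⁻¹ with hy
  have hgi := s.letter (d.inv_mem _ hg)
  have hxi := s.letter (d.inv_mem _ hx)
  have hgg := s.letter hg
  have e1 : (y : Matrix (Fin m) (Fin m) K) - 1 = (g : Matrix (Fin m) (Fin m) K) * ((x : Matrix (Fin m) (Fin m) K) - 1)
      * ((g⁻¹ : Matrix.SpecialLinearGroup (Fin m) K) : Matrix (Fin m) (Fin m) K) := by
    rw [mul_sub, sub_mul, mul_one, hy]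
    simp only [Matrix.SpecialLinearGroup.coe_mul]
    rw [← Matrix.SpecialLinearGroup.coe_mul g g⁻¹, mul_inv_cancel, Matrix.SpecialLinearGroup.coe_one]
  have hy1 : Op q d.W ((y : Matrix (Fin m) (Fin m) K) - 1) (H ^ o * κ * H ^ o) := by
    rw [e1]; exact Op.mul q d.W (Op.mul q d.W hgg h) hgi
  have hyi : Op q d.W ((y⁻¹ : Matrix.SpecialLinearGroup (Fin m) K) : Matrix (Fin m) (Fin m) K) (H ^ o * H ^ o * H ^ o) := by
    have : y⁻¹ = g * x⁻¹ * g⁻¹ := by rw [hy]; group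
    rw [this]
    simp only [Matrix.SpecialLinearGroup.coe_mul]
    exact Op.mul q d.W (Op.mul q d.W hgg hxi) hgi
  have h1 := Op.mul q d.W h hy1
  have h2 := Op.mul q d.W hy1 h
  rw [mul_comm _ κ] at h2
  have h3 := Op.mul q d.W (Op.mul q d.W (Op.sub q d.W s.good.hH h1 h2) hxi) hyi
  have e2 : ((x * y * x⁻¹ * y⁻¹ : Matrix.SpecialLinearGroup (Fin m) K) : Matrix (Fin m) (Fin m) K) - 1 =
      (((x : Matrix (Fin m) (Fin m) K) - 1) * ((y : Matrix (Fin m) (Fin m) K) - 1) -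
        ((y : Matrix (Fin m) (Fin m) K) - 1) * ((x : Matrix (Fin m) (Fin m) K) - 1)) *
        ((x⁻¹ : Matrix.SpecialLinearGroup (Fin m) K) : Matrix (Fin m) (Fin m) K) *
        ((y⁻¹ : Matrix.SpecialLinearGroup (Fin m) K) : Matrix (Fin m) (Fin m) K) := by
    have e3 : ((x : Matrix (Fin m) (Fin m) K) - 1) * ((y : Matrix (Fin m) (Fin m) K) - 1) -
        ((y : Matrix (Fin m) (Fin m) K) - 1) * ((x : Matrix (Fin m) (Fin m) K) - 1) =
        (x * y : Matrix (Fin m) (Fin m) K) - y * x := by noncomm_ring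
    rw [e3, sub_mul, sub_mul]
    simp only [← Matrix.SpecialLinearGroup.coe_mul]
    have : y * x * x⁻¹ * y⁻¹ = 1 := by group
    rw [this, Matrix.SpecialLinearGroup.coe_one]
  rw [e2]
  refine Op.mono q d.W h3 (le_of_eq ?_)
  have : H ^ (6 * o + 1) = H * H ^ o * H ^ o * H ^ o * H ^ o * H ^ o * H ^ o := by
    rw [pow_succ, show 6 * o = o + o + o + o + o + o by ring]
    simp only [pow_add]; ac_rfl
  rw [this, pow_two]
  ac_rfl

/-- size parameter -/
noncomputable def HA (m : ℕ) : ℝ≥0 := 2 ^ (m + 1)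
noncomputable def DA (m : ℕ) : ℝ≥0 := HA m ^ (6 * opC (m * m) + 1)
noncomputable def xiA (m : ℕ) : ℝ≥0 := (HA m ^ (3 * opC (m * m)))⁻¹ * ((DA m)⁻¹ * (1 / 2))

theorem HA_one (m : ℕ) : 1 ≤ HA m := one_le_pow_of_one_le' (by norm_num) _
theorem HA_DA (m : ℕ) : HA m ≤ DA m := by
  unfold DA
  conv_lhs => rw [← pow_one (HA m)]
  exact pow_le_pow_right' (HA_one m) (by omega)

theorem m_lt_HA (m : ℕ) : (m : ℝ≥0) < HA m := by
  have : m < 2 ^ (m + 1) := (Nat.lt_two_pow_self (n := m)).trans (Nat.pow_lt_pow_right (by norm_num) (by omega))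
  unfold HA
  exact_mod_cast this

theorem chain_bound {σ : K →+* ℂ} (s : Setup (qArch σ) d 2 (HA m)) {j : ℕ} (hj : j ∈ Finset.Icc 1 J)
    (h0 : Op (qArch σ) d.W ((d.c j 0 : Matrix (Fin m) (Fin m) K) - 1) ((DA m)⁻¹ * (1 / 2) ^ 1)) :
    ∀ i ≤ k, Op (qArch σ) d.W ((d.c j i : Matrix (Fin m) (Fin m) K) - 1) ((DA m)⁻¹ * (1 / 2) ^ (i + 1)) := by
  have hD1 : 1 ≤ DA m := (HA_one m).trans (HA_DA m)
  have hD0 : DA m ≠ 0 := (zero_lt_one.trans_le hD1).ne'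
  intro i
  induction i with
  | zero => intro _; exact h0
  | succ i ih =>
    intro hi
    have ih := ih (by omega)
    have hns : ¬ IsScal (d.c j i : Matrix (Fin m) (Fin m) K) := by
      rintro ⟨ζ, hζ⟩
      have hone : (1 : Matrix (Fin m) (Fin m) K) ≠ 0 := by
        have : Nonempty (Fin m) := ⟨⟨0, d.m_pos⟩⟩
        exact one_ne_zero
      have h1 := ih 1
      rw [hζ] at h1
      have e : (ζ • (1 : Matrix (Fin m) (Fin m) K) - 1) * 1 = (ζ - 1) • 1 := by rw [mul_one, sub_smul, one_smul]
      rw [e, nrm_smul] at h1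
      have h2 := le_of_mul_le_mul_right h1 (zero_lt_iff.2 (nrm_ne_zero (qArch σ) d.W d.span hone))
      have hdet := (d.c j i).2
      have h3 : ζ ^ m = 1 := by
        have h4 : (d.c j i : Matrix (Fin m) (Fin m) K).det = 1 := hdet
        rw [hζ, Matrix.det_smul] at h4; simpa using h4
      have h4 : ζ ≠ 1 := by
        rintro rfl
        apply d.c_ne j hj i (by omega)
        apply Subtype.ext
        rw [one_smul] at hζ
        rw [hζ]; rfl
      have h5 := root_unity_far (z := σ ζ) d.m_pos (by rw [← map_pow, h3, map_one])
        (fun h => h4 (σ.injective (by rw [h, map_one])))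
      rw [qArch_v, map_sub, map_one] at h2
      have h6 : (1 : ℝ≥0) ≤ m * ‖σ ζ - 1‖₊ := by exact_mod_cast h5
      have h7 : (m : ℝ≥0) * ‖σ ζ - 1‖₊ ≤ m * ((DA m)⁻¹ * (1 / 2) ^ (i + 1)) := mul_le_mul' le_rfl h2
      have h8 : (m : ℝ≥0) * ((DA m)⁻¹ * (1 / 2) ^ (i + 1)) ≤ m * (DA m)⁻¹ := by
        refine mul_le_mul' le_rfl ?_
        exact mul_le_of_le_one_right' (pow_le_one' (by norm_num) _)
      have h9 : (m : ℝ≥0) * (DA m)⁻¹ < 1 := by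
        rw [← div_eq_mul_inv, div_lt_one (zero_lt_iff.2 hD0)]
        exact (m_lt_HA m).trans_le (HA_DA m)
      exact absurd (h6.trans (h7.trans h8)) (not_le.2 h9)
    rw [d.c_succ j hj i (by omega) hns]
    refine Op.mono _ _ (s.comm_step (d.c_mem j hj i (by omega)) (d.g_mem j hj i (by omega)) ih) ?_
    show DA m * _ ≤ _
    have e : DA m * ((DA m)⁻¹ * (1 / 2) ^ (i + 1)) ^ 2 = (DA m)⁻¹ * (1 / 2) ^ ((i + 1) * 2) := by
      rw [mul_pow, ← pow_mul]; field_simp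
    rw [e]
    refine mul_le_mul' le_rfl ?_
    exact pow_le_pow_right_of_le_one' (by norm_num) (by omega)

/-- exponent `k` -/
def kA (m J : ℕ) : ℕ := (m + 1) * ((dG (m * m) * (2 * J + 1) + 1) + J * 2)

theorem arch_contra (m : ℕ) : ∃ J : ℕ, ∀ (K : Type) [Field K] [IsAlgClosed K] (R : ℕ) (d : Dat K m J (kA m J) R) (σ : K →+* ℂ),
    Eig (qArch σ) d 2 → 1 ≤ (qArch σ).v (PP d) → False := by
  have hD1 : 1 ≤ DA m := (HA_one m).trans (HA_DA m)
  have hD0 : 0 < DA m := (zero_lt_one.trans_le hD1)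
  have hH0 : 0 < HA m := (zero_lt_one.trans_le (HA_one m))
  have hxi : 0 < xiA m := by unfold xiA; positivity
  obtain ⟨J, hJ⟩ := pigeon (Fin m × Fin m) (HA m) (xiA m) (by exact_mod_cast hxi)
  refine ⟨J, ?_⟩
  intro K _ _ R d σ he hP
  have s : Setup (qArch σ) d 2 (HA m) := he.setup_of_PP hP
  obtain ⟨i, i', hii, hi', hd⟩ := hJ (fun i l => if i ≤ J then σ ((((d.a ^ i : Matrix.SpecialLinearGroup (Fin m) K) :
      Matrix (Fin m) (Fin m) K) * d.W l).trace) else 0) (by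
    intro i l
    split_ifs with h
    · have := (he.trace (mem_E0_2 d (d.a_mem i h) (d.w_mem l)))
      rw [qArch_v, Matrix.SpecialLinearGroup.coe_mul] at this
      exact NNReal.coe_le_coe.2 this
    · simp)
  have hiJ : i ≤ J := by omega
  simp only [hiJ, hi', if_true] at hd
  set j := i' - i with hj
  have hjm : j ∈ Finset.Icc 1 J := Finset.mem_Icc.2 ⟨by omega, by omega⟩
  have hn1 : nrm (qArch σ) d.W (((d.a ^ i' : Matrix.SpecialLinearGroup (Fin m) K) : Matrix (Fin m) (Fin m) K) -
      ((d.a ^ i : Matrix.SpecialLinearGroup (Fin m) K) : Matrix (Fin m) (Fin m) K)) ≤ xiA m := by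
    rw [nrm_le]
    intro l
    rw [sub_mul, Matrix.trace_sub, qArch_v, map_sub]
    exact_mod_cast hd l
  have hn2 : nrm (qArch σ) d.W ((d.c j 0 : Matrix (Fin m) (Fin m) K) - 1) ≤ HA m ^ opC (m * m) * xiA m := by
    have e0 : d.a ^ j = (d.a ^ i)⁻¹ * d.a ^ i' := by
      rw [eq_inv_mul_iff_mul_eq, ← pow_add]; congr 1; omega
    have e : (d.c j 0 : Matrix (Fin m) (Fin m) K) - 1 =
      (((d.a ^ i)⁻¹ : Matrix.SpecialLinearGroup (Fin m) K) : Matrix (Fin m) (Fin m) K) *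
      (((d.a ^ i' : Matrix.SpecialLinearGroup (Fin m) K) : Matrix (Fin m) (Fin m) K) -
      ((d.a ^ i : Matrix.SpecialLinearGroup (Fin m) K) : Matrix (Fin m) (Fin m) K)) := by
      rw [mul_sub, ← Matrix.SpecialLinearGroup.coe_mul, ← Matrix.SpecialLinearGroup.coe_mul, inv_mul_cancel,
        Matrix.SpecialLinearGroup.coe_one, d.c_zero j hjm, e0]
    rw [e]
    exact (s.letter (d.inv_mem _ (d.a_mem i hiJ)) _).trans (mul_le_mul' le_rfl hn1)
  have hop := s.good.smallOp (fun p => s.letter (d.w_mem p)) _ hn2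
  have hch := chain_bound s hjm (Op.mono _ _ hop (by
    refine le_of_eq ?_
    rw [pow_one]; unfold xiA
    rw [← mul_assoc, ← mul_assoc, ← pow_add]
    have : 2 * opC (m * m) + opC (m * m) = 3 * opC (m * m) := by ring
    rw [this, mul_inv_cancel₀ (pow_pos hH0 _).ne', one_mul])) (kA m J) le_rfl
  have hpj : (qArch σ).v (pjv d j) ≤ (1 / 2) ^ (kA m J + 1) := by
    have h1 := hch 1
    rw [mul_one] at h1
    have h2 : nrm (qArch σ) d.W (1 : Matrix (Fin m) (Fin m) K) ≤ HA m := by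
      rw [nrm_le]
      intro l
      rw [one_mul]
      exact he.trace (mem_E0_1 d (d.w_mem l))
    have h3 := (le_nrm (qArch σ) d.W ((d.c j (kA m J) : Matrix (Fin m) (Fin m) K) - 1) (d.lj j)).trans
      (h1.trans (mul_le_mul' le_rfl h2))
    refine h3.trans ?_
    rw [mul_right_comm]
    refine mul_le_of_le_one_left' ?_
    rw [inv_mul_le_iff₀ hD0, mul_one]
    exact HA_DA m
  have hPJ : (qArch σ).v (PJ d) ≤ HA m ^ (J * 2) * (1 / 2) ^ (kA m J + 1) := by
    unfold PJ
    rw [← Finset.mul_prod_erase _ _ hjm, map_mul, mul_comm]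
    refine mul_le_mul' ?_ hpj
    refine prod_bd s _ _ _ _ s.one_le ?_ fun j' hj' => s.pjv_le (Finset.mem_of_mem_erase hj')
    exact (Finset.card_le_card (Finset.erase_subset _ _)).trans (by simp)
  have hfin := (s.PJ_inv hP).trans (mul_le_mul' le_rfl hPJ)
  rw [← mul_assoc, ← pow_add] at hfin
  have e : HA m ^ (dG (m * m) * (2 * J + 1) + 1 + J * 2) = 2 ^ kA m J := by
    unfold HA kA; rw [← pow_mul]
  rw [e, pow_succ, ← mul_assoc, ← mul_pow] at hfin
  have hfin2 : (1:ℝ≥0) ≤ 1 / 2 := by simpa using hfin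
  exact absurd hfin2 (by rw [not_le]; exact NNReal.half_lt_self one_ne_zero)
end
end UPE
end

section
open scoped MatrixGroups Pointwise

namespace UPE

theorem coord_mem {K : Type} [Field K] {m : ℕ} {ι : Type} [Fintype ι] [DecidableEq ι]
    {w : ι → Matrix (Fin m) (Fin m) K} (hli : LinearIndependent K w) (hsp : Submodule.span K (Set.range w) = ⊤)
    (E : Subfield K) (hG : ∀ p l, (w p * w l).trace ∈ E) (b : ι → K) (x : Matrix (Fin m) (Fin m) K)
    (hb : x = ∑ l, b l • w l) (hx : ∀ l, (x * w l).trace ∈ E) (l : ι) : b l ∈ E := by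
  set G' : Matrix ι ι E := Matrix.of fun p l => ⟨_, hG p l⟩ with hG'
  set t' : ι → E := fun l => ⟨_, hx l⟩
  have hmap : G'.map (algebraMap E K) = Matrix.of fun p l => (w p * w l).trace := rfl
  have hdet : G'.det ≠ 0 := by
    intro h
    have h1 := trdet_ne (z := w) (w := w) hsp hli
    rw [← hmap] at h1
    apply h1
    have h2 := RingHom.map_det (algebraMap E K) G'
    rw [h, map_zero] at h2
    exact h2.symm
  have hu : IsUnit G'.det := isUnit_iff_ne_zero.2 hdet
  have h3 : b = fun l => algebraMap E K (Matrix.vecMul t' G'⁻¹ l) := by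
    have h4 : Matrix.vecMul b (G'.map (algebraMap E K)) = fun l => algebraMap E K (t' l) := by
      funext p
      show _ = (x * w p).trace
      rw [hb, Finset.sum_mul, Matrix.trace_sum]
      simp only [Matrix.vecMul, dotProduct, hmap, Matrix.of_apply, Matrix.smul_mul, Matrix.trace_smul, smul_eq_mul]
    have h5 : (G'.map (algebraMap E K)) * (G'⁻¹.map (algebraMap E K)) = 1 := by
      rw [← Matrix.map_mul, Matrix.mul_nonsing_inv _ hu]
      simp
    calc b = Matrix.vecMul (Matrix.vecMul b (G'.map (algebraMap E K))) (G'⁻¹.map (algebraMap E K)) := by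
          rw [Matrix.vecMul_vecMul, h5, Matrix.vecMul_one]
      _ = _ := by
          rw [h4]
          funext l
          simp [Matrix.vecMul, dotProduct, map_sum]
  rw [h3]
  exact (Matrix.vecMul t' G'⁻¹ l).2

theorem exists_nonintegral {K : Type} [Field K] [IsAlgClosed K] {m : ℕ}
    {S : Set (Matrix.SpecialLinearGroup (Fin m) K)} (hS : Sym S) (hfin : S.Finite) (hSI : SI 1 S)
    (hinf : (Subgroup.closure S : Set (Matrix.SpecialLinearGroup (Fin m) K)).Infinite)
    (p : ℕ) (hp : p.Prime) [CharP K p] :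
    ∃ x ∈ S ^ (2 * (m * m) + 1), ∃ t ∈ (x : Matrix (Fin m) (Fin m) K).charpoly.roots, ¬ IsIntegral ℤ t := by
  by_contra hcon
  push Not at hcon
  have : Fact p.Prime := ⟨hp⟩
  let _ : Algebra (ZMod p) K := ZMod.algebra K p
  set E : Subfield K := (algebraicClosure (ZMod p) K).toSubfield with hE
  have htr : ∀ x ∈ S ^ (2 * (m * m) + 1), (x : Matrix (Fin m) (Fin m) K).trace ∈ E := by
    intro x hx
    rw [Matrix.trace_eq_sum_roots_charpoly]
    refine multiset_sum_mem _ fun t ht => ?_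
    have : IsIntegral (ZMod p) t := (hcon x hx t ht).tower_top
    exact mem_algebraicClosure_iff'.2 this
  obtain ⟨w, hw1, hw2, hw3⟩ := exists_span_family (K := K) (E := Matrix (Fin m) (Fin m) K) (ι := Fin m × Fin m)
    (by simp [Module.finrank_matrix]) _ (burnside hS hSI (m * m) le_rfl)
  choose g hg1 hg2 using hw1
  simp only at hg2
  have hG : ∀ p l, (w p * w l).trace ∈ E := by
    intro p l
    rw [← hg2, ← hg2, ← Matrix.SpecialLinearGroup.coe_mul]
    exact htr _ (hS.mul_mem (hg1 p) (hg1 l) (by omega))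
  have hex : ∀ x : Matrix (Fin m) (Fin m) K, ∃ b : Fin m × Fin m → K, x = ∑ l, b l • w l := by
    intro x
    have : x ∈ Submodule.span K (Set.range w) := by rw [hw2]; trivial
    obtain ⟨b, hb⟩ := (Submodule.mem_span_range_iff_exists_fun K).1 this
    exact ⟨b, hb.symm⟩
  choose b hb using hex
  set X : Set K := Set.range (b 1) ∪ ⋃ s ∈ S, ⋃ l, Set.range (b (w l * s)) with hX
  have hXf : X.Finite := by
    refine (Set.finite_range _).union ?_
    exact hfin.biUnion fun s _ => Set.finite_iUnion fun l => Set.finite_range _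
  have hXE : ∀ x ∈ X, IsIntegral (ZMod p) x := by
    have key : ∀ x : Matrix (Fin m) (Fin m) K, (∀ l, (x * w l).trace ∈ E) → ∀ l, IsIntegral (ZMod p) (b x l) := by
      intro x hx l
      exact mem_algebraicClosure_iff'.1 (coord_mem hw3 hw2 E hG (b x) x (hb x) hx l)
    rintro x (⟨l, rfl⟩ | hx)
    · refine key 1 ?_ l
      intro l
      rw [one_mul, ← hg2]
      exact htr _ (hS.pow_mono (by omega) (hg1 l))
    · simp only [Set.mem_iUnion] at hx
      obtain ⟨s, hs, l, l', rfl⟩ := hx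
      refine key _ ?_ l'
      intro p
      rw [← hg2, ← hg2, ← Matrix.SpecialLinearGroup.coe_mul, ← Matrix.SpecialLinearGroup.coe_mul]
      refine htr _ (hS.mul_mem (i := m * m + 1) (hS.mul_mem (j := 1) (hg1 l) (by simpa using hs) le_rfl) (hg1 p) (by omega))
  have hfg := fg_adjoin_of_finite hXf hXE
  set 𝔽 := Algebra.adjoin (ZMod p) X with h𝔽
  have hfin𝔽 : Finite 𝔽 := by
    have : Module.Finite (ZMod p) 𝔽 := Module.Finite.iff_fg.2 hfg
    exact Module.finite_of_finite (ZMod p)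
  apply hinf
  have hmem : ∀ x ∈ Subgroup.closure S, ∃ c : Fin m × Fin m → 𝔽, (x : Matrix (Fin m) (Fin m) K) = ∑ l, (c l : K) • w l := by
    intro x hx
    obtain ⟨n, hn⟩ := hS.closure.1 hx
    clear hx
    induction n generalizing x with
    | zero =>
      rw [pow_zero, Set.mem_one] at hn
      subst hn
      refine ⟨fun l => ⟨b 1 l, Algebra.subset_adjoin (Or.inl ⟨l, rfl⟩)⟩, ?_⟩
      rw [Matrix.SpecialLinearGroup.coe_one]
      exact hb 1
    | succ n ih =>
      rw [pow_succ] at hn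
      obtain ⟨y, hy, s, hs, rfl⟩ := Set.mem_mul.1 hn
      obtain ⟨c, hc⟩ := ih y hy
      refine ⟨fun l => ∑ l', c l' * ⟨b (w l' * s) l, Algebra.subset_adjoin (Or.inr (Set.mem_biUnion hs (Set.mem_iUnion.2 ⟨l', ⟨l, rfl⟩⟩)))⟩, ?_⟩
      rw [Matrix.SpecialLinearGroup.coe_mul, hc, Finset.sum_mul]
      simp only [AddSubmonoidClass.coe_finset_sum, MulMemClass.coe_mul, Finset.sum_smul]
      rw [Finset.sum_comm]
      refine Finset.sum_congr rfl fun l' _ => ?_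
      rw [Matrix.smul_mul]
      conv_lhs => rw [hb (w l' * s)]
      rw [Finset.smul_sum]
      refine Finset.sum_congr rfl fun l _ => ?_
      rw [smul_smul]
  refine Set.Finite.of_finite_image (f := fun x : Matrix.SpecialLinearGroup (Fin m) K => (x : Matrix (Fin m) (Fin m) K)) ?_
    (fun x _ y _ h => Subtype.ext h)
  refine (Set.finite_range fun c : Fin m × Fin m → 𝔽 => ∑ l, (c l : K) • w l).subset ?_
  rintro _ ⟨x, hx, rfl⟩
  obtain ⟨c, hc⟩ := hmem x hx
  exact ⟨c, hc.symm⟩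

end UPE
end

section
open scoped MatrixGroups Pointwise

namespace UPE

/-- length of chain elements -/
def Lc (m L0 : ℕ) : ℕ → ℕ
  | 0 => L0
  | i + 1 => 4 * Lc m L0 i + 8 * (m * m)

theorem Lc_mono (m L0 : ℕ) : Monotone (Lc m L0) := monotone_nat_of_le_succ fun i => by simp only [Lc]; omega

open Classical in
/-- commutator chain -/
noncomputable def chn {K : Type} [Field K] {m : ℕ} (γ : Matrix.SpecialLinearGroup (Fin m) K → Matrix.SpecialLinearGroup (Fin m) K)
    (x : Matrix.SpecialLinearGroup (Fin m) K) : ℕ → Matrix.SpecialLinearGroup (Fin m) K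
  | 0 => x
  | i + 1 => if IsScal (chn γ x i : Matrix (Fin m) (Fin m) K) then chn γ x i else
      chn γ x i * (γ (chn γ x i) * chn γ x i * (γ (chn γ x i))⁻¹) * (chn γ x i)⁻¹ *
        (γ (chn γ x i) * chn γ x i * (γ (chn γ x i))⁻¹)⁻¹

theorem comm_mem {G : Type} [Group G] {S : Set G} (hS : Sym S) {c g : G} {l n : ℕ} (hc : c ∈ S ^ l) (hg : g ∈ S ^ n) :
    c * (g * c * g⁻¹) * c⁻¹ * (g * c * g⁻¹)⁻¹ ∈ S ^ (4 * l + 4 * n) := by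
  have h1 : g * c * g⁻¹ ∈ S ^ (2 * n + l) := hS.mul_mem (i := n + l) (hS.mul_mem hg hc le_rfl) (hS.inv_mem_pow hg) (by omega)
  have h2 := hS.mul_mem (k := l + (2 * n + l)) hc h1 le_rfl
  have h3 := hS.mul_mem (k := l + (2 * n + l) + l) h2 (hS.inv_mem_pow hc) le_rfl
  exact hS.mul_mem h3 (hS.inv_mem_pow h1) (by omega)

theorem exists_Dat (m J k : ℕ) (hm : 0 < m) : ∃ N L R : ℕ, 1 ≤ R ∧ ∀ (K : Type) [Field K] [IsAlgClosed K]
    (S : Set (Matrix.SpecialLinearGroup (Fin m) K)), Sym S → S.Finite → SI N S →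
    (Subgroup.closure S : Set (Matrix.SpecialLinearGroup (Fin m) K)).Infinite →
    ∃ d : Dat K m J k R, ∀ b ∈ d.B1, b ∈ S ^ L := by
  classical
  obtain ⟨N0, hN0⟩ := two_family m
  obtain ⟨La, hLa⟩ := exists_nontorsion m J
  set L := m * m + m ^ 4 + La * J + Lc m (La * J) k + 2 * (m * m) + (2 * (m * m) + 1) with hL
  set R0 := 1 + m * m + m ^ 4 + (J + 1) + J * (k + 1) + J * (k + 1) + 1 with hR0
  refine ⟨N0 + m, L, 2 * R0, by omega, ?_⟩
  intro K _ _ S hS hfin hSI hinf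
  have hSI1 : SI 1 S := hSI.mono (by omega)
  obtain ⟨I, hI1, hI2, hI3⟩ := hN0 hS (hSI.mono (by omega))
  obtain ⟨a, ha1, ha2⟩ := hLa hS hfin hSI1 hinf
  obtain ⟨w, hw1, hw2, hw3⟩ := exists_span_family (K := K) (E := Matrix (Fin m) (Fin m) K) (ι := Fin m × Fin m)
    (by simp [Module.finrank_matrix]) _ (burnside hS hSI1 (m * m) le_rfl)
  choose w' hw'1 hw'2 using hw1
  simp only at hw'2
  have hwe : (fun l => (w' l : Matrix (Fin m) (Fin m) K)) = w := funext hw'2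
  have hx0 : ∃ x0 ∈ S ^ (2 * (m * m) + 1), ∀ p : ℕ, p.Prime → CharP K p →
      ∃ t ∈ (x0 : Matrix (Fin m) (Fin m) K).charpoly.roots, ¬ IsIntegral ℤ t := by
    by_cases h : ∃ p : ℕ, p.Prime ∧ CharP K p
    · obtain ⟨p, hp, hc⟩ := h
      obtain ⟨x, hx, ht⟩ := exists_nonintegral hS hfin hSI1 hinf p hp
      exact ⟨x, hx, fun _ _ _ => ht⟩
    · exact ⟨1, hS.one_mem_pow _, fun p hp hc => absurd ⟨p, hp, hc⟩ h⟩
  obtain ⟨x0, hx0, ht0⟩ := hx0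
  have hγ : ∀ c : Matrix.SpecialLinearGroup (Fin m) K, ∃ g ∈ S ^ (2 * (m * m)), ¬ IsScal (c : Matrix (Fin m) (Fin m) K) →
      c * (g * c * g⁻¹) ≠ (g * c * g⁻¹) * c := by
    intro c
    by_cases h : IsScal (c : Matrix (Fin m) (Fin m) K)
    · exact ⟨1, hS.one_mem_pow _, fun h' => absurd h h'⟩
    · obtain ⟨g, hg, h2⟩ := exists_noncomm hS (hSI.mono (by omega)) c h
      exact ⟨g, hg, fun _ => h2⟩
  choose γ hγ1 hγ2 using hγ
  have hcm : ∀ j ≤ J, ∀ i, chn γ (a ^ j) i ∈ S ^ (Lc m (La * J) i) := by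
    intro j hj i
    induction i with
    | zero => exact hS.pow_mono (Nat.mul_le_mul_left _ hj) (pow_mem_pow ha1 j)
    | succ i ih =>
      rw [chn]
      split_ifs with h
      · exact hS.pow_mono (Lc_mono _ _ (Nat.le_succ i)) ih
      · refine hS.pow_mono ?_ (comm_mem hS ih (hγ1 _))
        simp only [Lc]; omega
  have hcne : ∀ j ∈ Finset.Icc 1 J, ∀ i, chn γ (a ^ j) i ≠ 1 := by
    intro j hj i
    rw [Finset.mem_Icc] at hj
    induction i with
    | zero =>
      intro h
      apply ha2 j hj.1 hj.2
      rw [chn] at h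
      refine ⟨1, ?_⟩
      rw [one_smul, ← Matrix.SpecialLinearGroup.coe_pow, h, Matrix.SpecialLinearGroup.coe_one]
    | succ i ih =>
      rw [chn]
      split_ifs with h
      · exact ih
      · intro h1
        apply hγ2 _ h
        rw [mul_inv_eq_one, mul_inv_eq_iff_eq_mul] at h1
        exact h1
  have hlj : ∀ j, ∃ l, j ∈ Finset.Icc 1 J → (((chn γ (a ^ j) k : Matrix (Fin m) (Fin m) K) - 1) * (w' l : Matrix (Fin m) (Fin m) K)).trace ≠ 0 := by
    intro j
    by_cases hj : j ∈ Finset.Icc 1 J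
    · by_contra hcon
      push Not at hcon
      have : (chn γ (a ^ j) k : Matrix (Fin m) (Fin m) K) - 1 = 0 := by
        refine tr_ext (z := w) hw2 fun l => ?_
        rw [Matrix.trace_mul_comm, ← hw'2]
        exact (hcon l).2
      apply hcne j hj k
      apply Subtype.ext
      exact sub_eq_zero.1 this
    · exact ⟨(⟨0, hm⟩, ⟨0, hm⟩), fun h => absurd h hj⟩
  choose lj hlj using hlj
  set B0 : Finset (Matrix.SpecialLinearGroup (Fin m) K) := {1} ∪ Finset.univ.image w' ∪ I ∪ (Finset.range (J + 1)).image (fun i => a ^ i) ∪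
    (Finset.Icc 1 J ×ˢ Finset.range (k + 1)).image (fun x => chn γ (a ^ x.1) x.2) ∪
    (Finset.Icc 1 J ×ˢ Finset.range (k + 1)).image (fun x => γ (chn γ (a ^ x.1) x.2)) ∪ {x0} with hB0
  have hcard : B0.card ≤ R0 := by
    rw [hB0, hR0]
    refine (Finset.card_union_le _ _).trans (add_le_add ?_ (by simp))
    refine (Finset.card_union_le _ _).trans (add_le_add ?_ (Finset.card_image_le.trans (by simp)))
    refine (Finset.card_union_le _ _).trans (add_le_add ?_ (Finset.card_image_le.trans (by simp)))
    refine (Finset.card_union_le _ _).trans (add_le_add ?_ (Finset.card_image_le.trans (by simp)))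
    refine (Finset.card_union_le _ _).trans (add_le_add ?_ hI1)
    refine (Finset.card_union_le _ _).trans (add_le_add (by simp) (Finset.card_image_le.trans (by simp)))
  have hin : ∀ x, x ∈ B0 ↔ ((((((x = 1 ∨ ∃ l, w' l = x) ∨ x ∈ I) ∨ ∃ i ≤ J, a ^ i = x) ∨
      (∃ j ∈ Finset.Icc 1 J, ∃ i ≤ k, chn γ (a ^ j) i = x)) ∨ (∃ j ∈ Finset.Icc 1 J, ∃ i ≤ k, γ (chn γ (a ^ j) i) = x)) ∨ x = x0) := by
    intro x
    rw [hB0]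
    simp only [Finset.mem_union, Finset.mem_singleton, Finset.mem_image, Finset.mem_univ, true_and, Finset.mem_range,
      Nat.lt_succ_iff, Prod.exists, Finset.mem_product]
    refine or_congr (or_congr (or_congr Iff.rfl ?_) ?_) Iff.rfl
    · exact ⟨fun ⟨j, i, h, h'⟩ => ⟨j, h.1, i, h.2, h'⟩, fun ⟨j, h1, i, h2, h'⟩ => ⟨j, i, ⟨h1, h2⟩, h'⟩⟩
    · exact ⟨fun ⟨j, i, h, h'⟩ => ⟨j, h.1, i, h.2, h'⟩, fun ⟨j, h1, i, h2, h'⟩ => ⟨j, i, ⟨h1, h2⟩, h'⟩⟩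
  have hBL : ∀ x ∈ B0, x ∈ S ^ L := by
    intro x hx
    rcases (hin x).1 hx with (((((rfl | ⟨l, rfl⟩) | h) | ⟨i, hi, rfl⟩) | ⟨j, hj, i, hi, rfl⟩) | ⟨j, hj, i, hi, rfl⟩) | rfl
    · exact hS.one_mem_pow _
    · exact hS.pow_mono (by omega) (hw'1 l)
    · exact hS.pow_mono (by omega) (hI2 x h)
    · exact hS.pow_mono (by have := Nat.mul_le_mul_left La hi; omega) (pow_mem_pow ha1 i)
    · exact hS.pow_mono (by have := Lc_mono m (La * J) hi; omega) (hcm j (Finset.mem_Icc.1 hj).2 i)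
    · exact hS.pow_mono (by omega) (hγ1 _)
    · exact hS.pow_mono (by omega) hx0
  have hsub : B0 ⊆ B0 ∪ B0⁻¹ := Finset.subset_union_left
  refine ⟨{
    w := w'
    I := I
    B1 := B0 ∪ B0⁻¹
    a := a
    c := fun j i => chn γ (a ^ j) i
    g := fun j i => γ (chn γ (a ^ j) i)
    lj := lj
    m_pos := hm
    one_mem := hsub ((hin _).2 (by simp))
    inv_mem := by
      intro b hb
      rw [Finset.mem_union, Finset.mem_inv'] at hb ⊢
      rw [inv_inv]; exact hb.symm
    w_mem := fun l => hsub ((hin _).2 (Or.inl (Or.inl (Or.inl (Or.inl (Or.inl (Or.inr ⟨l, rfl⟩)))))))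
    I_sub := fun x hx => hsub ((hin _).2 (Or.inl (Or.inl (Or.inl (Or.inl (Or.inr hx))))))
    I_ne := by
      rw [Finset.nonempty_iff_ne_empty]
      intro h
      have : Nonempty (Fin m) := ⟨⟨0, hm⟩⟩
      have := hI3 (fun _ => 1) (fun _ => one_ne_zero) (fun _ => true) 1 (by rw [h]; simp)
      exact one_ne_zero this
    a_mem := fun i hi => hsub ((hin _).2 (Or.inl (Or.inl (Or.inl (Or.inr ⟨i, hi, rfl⟩)))))
    c_mem := fun j hj i hi => hsub ((hin _).2 (Or.inl (Or.inl (Or.inr ⟨j, hj, i, hi, rfl⟩))))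
    g_mem := fun j hj i hi => hsub ((hin _).2 (Or.inl (Or.inr ⟨j, hj, i, hi, rfl⟩)))
    card := by
      refine (Finset.card_union_le _ _).trans ?_
      rw [Finset.card_inv]; omega
    span := by rw [hwe]; exact hw2
    li := by rw [hwe]; exact hw3
    two := hI3
    pj := fun j hj => hlj j hj
    c_zero := fun j hj => rfl
    c_succ := fun j hj i hi hs => by
      show chn γ (a ^ j) (i + 1) = _
      rw [chn, if_neg hs]
    c_ne := fun j hj i hi => hcne j hj i
    tel := fun p hp hc => ⟨x0, hsub ((hin _).2 (Or.inr rfl)), ht0 p hp hc⟩ }, ?_⟩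
  intro b hb
  simp only [Finset.mem_union, Finset.mem_inv'] at hb
  rcases hb with h | h
  · exact hBL b h
  · have := hS.inv_mem_pow (hBL _ h)
    rwa [inv_inv] at this

end UPE
end

section
open scoped MatrixGroups Pointwise NNReal

namespace UPE

theorem exists_val {K : Type} [Field K] {x : K} (hx : ¬ IsIntegral ℤ x) :
    ∃ V : ValuationSubring K, (∀ y : K, IsIntegral ℤ y → y ∈ V) ∧ x ∉ V := by
  have : IsIntegrallyClosedIn (integralClosure ℤ K).toSubring K :=
    inferInstanceAs (IsIntegrallyClosedIn (integralClosure ℤ K) K)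
  obtain ⟨V, h1, h2⟩ := Subring.exists_le_valuationSubring_of_isIntegrallyClosedIn (K := K) (x := x)
    (R := (integralClosure ℤ K).toSubring) hx
  exact ⟨V, fun y hy => h1 hy, h2⟩

/-- quasi valuation of a valuation ring -/
noncomputable def qV {K : Type} [Field K] (V : ValuationSubring K) : QV K V.ValueGroup where
  v := V.valuation.toMonoidWithZeroHom
  c := 1
  hc := le_rfl
  add := by
    intro x y
    rw [one_mul]
    exact V.valuation.map_add x y

theorem qV_le {K : Type} [Field K] (V : ValuationSubring K) (x : K) : (qV V).v x ≤ 1 ↔ x ∈ V :=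
  V.valuation_le_one_iff x

theorem emb_ext {k K : Type} [Field k] [Field K] [Algebra k K] [Algebra k ℂ] [Countable K] :
    ∃ σ : K →+* ℂ, ∀ x : k, σ (algebraMap k K x) = algebraMap k ℂ x := by
  have hk : Countable k := (algebraMap k K).injective.countable
  obtain ⟨s, hs⟩ := exists_isTranscendenceBasis k K
  obtain ⟨t, ht⟩ := exists_isTranscendenceBasis k ℂ
  have htinf : Infinite t := by
    by_contra hfin
    rw [not_infinite_iff_finite] at hfin
    have h1 := IsAlgClosed.cardinal_le_max_transcendence_basis' (R := k) (Subtype.val : t → ℂ) ht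
    have h2 : Cardinal.mk ℂ ≤ Cardinal.aleph0 := by
      refine h1.trans ?_
      simp only [max_le_iff, le_refl, and_true, Cardinal.mk_le_aleph0_iff]
      exact ⟨hk, Finite.to_countable⟩
    rw [Cardinal.mk_complex] at h2
    exact absurd h2 (not_le.2 Cardinal.aleph0_lt_continuum)
  obtain ⟨f, hf⟩ : ∃ f : s → t, Function.Injective f := by
    obtain ⟨g, hg⟩ := exists_injective_nat s
    exact ⟨fun x => Infinite.natEmbedding t (g x), fun x y h => hg ((Infinite.natEmbedding t).injective h)⟩
  have hv : AlgebraicIndependent k (fun x : s => (f x : ℂ)) := ht.1.comp f hf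
  set R0 := Algebra.adjoin k (Set.range (Subtype.val : s → K)) with hR0
  let ρ : R0 →ₐ[k] ℂ := (MvPolynomial.aeval (fun x : s => (f x : ℂ))).comp hs.1.aevalEquiv.symm.toAlgHom
  have hρ : Function.Injective ρ := by
    have : Function.Injective (MvPolynomial.aeval (R := k) (fun x : s => (f x : ℂ))) := hv
    exact this.comp hs.1.aevalEquiv.symm.injective
  let _ : Algebra R0 ℂ := ρ.toRingHom.toAlgebra
  have halg : Algebra.IsAlgebraic R0 K := hs.isAlgebraic
  have : FaithfulSMul R0 ℂ := (faithfulSMul_iff_algebraMap_injective R0 ℂ).2 hρ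
  let σ : K →ₐ[R0] ℂ := IsAlgClosed.lift
  refine ⟨σ.toRingHom, fun x => ?_⟩
  have h1 := σ.commutes (algebraMap k R0 x)
  have h2 : algebraMap R0 ℂ (algebraMap k R0 x) = algebraMap k ℂ x := ρ.commutes x
  rw [h2] at h1
  exact h1

theorem exists_big_root (f : Polynomial ℤ) (hf : f.Monic) (h0 : f.coeff 0 ≠ 0) (hd : f.natDegree ≠ 0) :
    ∃ z : ℂ, Polynomial.aeval z f = 0 ∧ 1 ≤ ‖z‖ := by
  by_contra hcon
  push Not at hcon
  set g := f.map (Int.castRingHom ℂ) with hg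
  have hgm : g.Monic := hf.map _
  have hsp := IsAlgClosed.splits g
  have h1 := hsp.coeff_zero_eq_prod_roots_of_monic hgm
  have hroot : ∀ z ∈ g.roots, ‖z‖ < 1 := by
    intro z hz
    apply hcon
    rw [Polynomial.mem_roots hgm.ne_zero, Polynomial.IsRoot, hg, Polynomial.eval_map] at hz
    rw [Polynomial.aeval_def]
    exact hz
  have hne : g.roots ≠ 0 := by
    intro h
    apply hd
    have := hsp.natDegree_eq_card_roots
    rw [h, hg, hf.natDegree_map] at this
    simpa using this
  have key : ∀ s : Multiset ℂ, (∀ z ∈ s, ‖z‖ < 1) → ‖s.prod‖ ≤ 1 := by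
    intro s
    induction s using Multiset.induction_on with
    | empty => simp
    | cons a s ih =>
      intro h
      rw [Multiset.prod_cons, norm_mul]
      exact mul_le_one₀ (h a (by simp)).le (norm_nonneg _) (ih fun z hz => h z (by simp [hz]))
  obtain ⟨a, s, hs⟩ := Multiset.exists_mem_of_ne_zero hne |>.imp fun a ha => Multiset.exists_cons_of_mem ha
  have h2 : ‖g.roots.prod‖ < 1 := by
    rw [hs, Multiset.prod_cons, norm_mul]
    have ha := hroot a (by simp [hs])
    have hb := key s fun z hz => hroot z (by simp [hs, hz])
    exact mul_lt_one_of_nonneg_of_lt_one_left (norm_nonneg _) ha hb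
  have h3 : ‖g.coeff 0‖ < 1 := by
    rw [h1, norm_mul]; simpa using h2
  rw [hg, Polynomial.coeff_map] at h3
  have h4 : ‖((f.coeff 0 : ℤ) : ℂ)‖ = |(f.coeff 0 : ℝ)| := by simp [Complex.norm_intCast]
  have h5 : |(f.coeff 0 : ℝ)| < 1 := by rw [← h4]; exact h3
  have h6 : |f.coeff 0| < 1 := by exact_mod_cast h5
  exact h0 (Int.abs_lt_one_iff.1 h6)

theorem exists_emb {K : Type} [Field K] [CharZero K] [Countable K] {P : K} (hP : IsIntegral ℤ P) (hP0 : P ≠ 0) :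
    ∃ σ : K →+* ℂ, 1 ≤ ‖σ P‖ := by
  have hPQ : IsIntegral ℚ P := hP.tower_top
  have he := minpoly.isIntegrallyClosed_eq_field_fractions' ℚ hP
  have hc0 : (minpoly ℤ P).coeff 0 ≠ 0 := by
    intro h
    have h1 := minpoly.coeff_zero_ne_zero hPQ hP0
    rw [he, Polynomial.coeff_map, h, map_zero] at h1
    exact h1 rfl
  obtain ⟨z, hz, hz1⟩ := exists_big_root (minpoly ℤ P) (minpoly.monic hP) hc0 (minpoly.natDegree_pos hP).ne'
  have hz' : z ∈ (minpoly ℚ P).aroots ℂ := by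
    rw [Polynomial.mem_aroots]
    refine ⟨minpoly.ne_zero hPQ, ?_⟩
    rw [he, Polynomial.aeval_map_algebraMap]
    exact hz
  set k0 := IntermediateField.adjoin ℚ {P} with hk0
  let φ := (IntermediateField.algHomAdjoinIntegralEquiv ℚ (K := ℂ) hPQ).symm ⟨z, hz'⟩
  have hφ : φ (IntermediateField.AdjoinSimple.gen ℚ P) = z :=
    IntermediateField.algHomAdjoinIntegralEquiv_symm_apply_gen ℚ hPQ ⟨z, hz'⟩
  let _ : Algebra k0 ℂ := φ.toRingHom.toAlgebra
  obtain ⟨σ, hσ⟩ := emb_ext (k := k0) (K := K)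
  refine ⟨σ, ?_⟩
  have h1 := hσ (IntermediateField.AdjoinSimple.gen ℚ P)
  rw [IntermediateField.AdjoinSimple.algebraMap_gen] at h1
  rw [h1]
  have h2 : algebraMap k0 ℂ (IntermediateField.AdjoinSimple.gen ℚ P) = z := hφ
  rw [h2]; exact hz1

section
variable {K : Type} [Field K] [IsAlgClosed K] {m J k R : ℕ} (d : Dat K m J k R)

theorem big_ping {Λ : Type} [LinearOrderedCommGroupWithZero Λ] (q : QV K Λ) (hP : 1 ≤ q.v (PP d)) (b0 : Λ) (hb0 : q.c ≤ b0)
    (hbig : ¬ Eig q d b0)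
    {S : Set (Matrix.SpecialLinearGroup (Fin m) K)} (hS : Sym S) {L : ℕ} (hL : ∀ b ∈ d.B1, b ∈ S ^ L) :
    PingData S (5 * L) R (2 * MF m J R + 1) := by
  classical
  have hbig : ∃ x ∈ E0 d, ∃ c ∈ (x : Matrix (Fin m) (Fin m) K).charpoly.roots, b0 < q.v c := by
    by_contra hcon
    push Not at hcon
    exact hbig ⟨hb0, hcon⟩
  obtain ⟨x, hx, c, hc, hcb⟩ := hbig
  set T := (E0 d).biUnion fun x => (x : Matrix (Fin m) (Fin m) K).charpoly.roots.toFinset with hT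
  have hmem : ∀ c, c ∈ T ↔ ∃ x ∈ E0 d, c ∈ (x : Matrix (Fin m) (Fin m) K).charpoly.roots := by
    intro c; simp only [hT, Finset.mem_biUnion, Multiset.mem_toFinset]
  obtain ⟨c1, hc1, hmax⟩ := T.exists_max_image q.v ⟨c, (hmem c).2 ⟨x, hx, hc⟩⟩
  obtain ⟨x1, hx1, hcx1⟩ := (hmem c1).1 hc1
  have hB : b0 < q.v c1 := hcb.trans_le (hmax c ((hmem c).2 ⟨x, hx, hc⟩))
  have he : Eig q d (q.v c1) := ⟨hb0.trans hB.le, fun x hx c hc => hmax c ((hmem c).2 ⟨x, hx, hc⟩)⟩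
  exact (he.setup_of_PP hP).ping hP ((q.hc.trans hb0).trans_lt hB) hx1 hcx1 rfl hS hL

end

theorem integral_inv {K : Type} [Field K] (p : ℕ) (hp : p.Prime) [CharP K p] {x : K} (hx : IsIntegral ℤ x) :
    IsIntegral ℤ x⁻¹ := by
  have : Fact p.Prime := ⟨hp⟩
  let _ : Algebra (ZMod p) K := ZMod.algebra K p
  have h1 : IsIntegral (ZMod p) x := hx.tower_top
  have h2 : IsIntegral (ZMod p) x⁻¹ := h1.inv
  have h3 : Algebra.IsIntegral ℤ (ZMod p) := Algebra.IsIntegral.of_surjective (Algebra.ofId ℤ (ZMod p)) (ZMod.intCast_surjective)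
  exact isIntegral_trans _ h2

theorem data_theorem (m : ℕ) (hm : 0 < m) : ∃ N L R M : ℕ, 1 ≤ R ∧ 1 ≤ M ∧ ∀ (K : Type) [Field K] [IsAlgClosed K] [Countable K]
    (S : Set (Matrix.SpecialLinearGroup (Fin m) K)), Sym S → S.Finite → SI N S →
    (Subgroup.closure S : Set (Matrix.SpecialLinearGroup (Fin m) K)).Infinite → PingData S L R M := by
  obtain ⟨J, hJ⟩ := arch_contra m
  obtain ⟨N, L, R, hR, hD⟩ := exists_Dat m J (kA m J) hm
  refine ⟨N, 5 * L, R, 2 * MF m J R + 1, hR, by omega, ?_⟩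
  intro K _ _ _ S hS hfin hSI hinf
  obtain ⟨d, hd⟩ := hD K S hS hfin hSI hinf
  by_cases hinteg : IsIntegral ℤ (PP d)
  · obtain ⟨p, hc⟩ := CharP.exists K
    rcases CharP.char_is_prime_or_zero K p with hp | rfl
    · obtain ⟨x, hx, t, ht, hti⟩ := d.tel p hp hc
      obtain ⟨V, hV1, hV2⟩ := exists_val hti
      refine big_ping d (qV V) ?_ 1 le_rfl ?_ hS hd
      · have h1 := (qV_le V _).2 (hV1 _ (integral_inv p hp hinteg))
        rw [map_inv₀] at h1
        exact (inv_le_one₀ (zero_lt_iff.2 ((map_ne_zero _).2 (PP_ne d)))).1 h1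
      · intro he
        exact hV2 ((qV_le V t).1 (he.2 x (mem_E0_1 d hx) t ht))
    · have : CharZero K := CharP.charP_to_charZero K
      obtain ⟨σ, hσ⟩ := exists_emb hinteg (PP_ne d)
      have hP : 1 ≤ (qArch σ).v (PP d) := hσ
      refine big_ping d (qArch σ) hP 2 le_rfl ?_ hS hd
      intro he
      exact hJ K R d σ he hP
  · obtain ⟨V, hV1, hV2⟩ := exists_val hinteg
    have hlt : 1 < (qV V).v (PP d) := by
      rw [← not_le, qV_le]; exact hV2
    refine big_ping d (qV V) hlt.le 1 le_rfl ?_ hS hd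
    intro he
    have := (he.setup_of_PP hlt.le).PP_le
    rw [one_pow, one_pow] at this
    exact absurd this (not_le.2 hlt)

end UPE
end

section
open scoped MatrixGroups Pointwise

namespace UPE

/-- derived series inside the ambient group -/
def dser {G : Type} [Group G] (H : Subgroup G) : ℕ → Subgroup G
  | 0 => H
  | n + 1 => ⁅dser H n, dser H n⁆

theorem dser_mono {G : Type} [Group G] {H H' : Subgroup G} (h : H ≤ H') (n : ℕ) : dser H n ≤ dser H' n := by
  induction n with
  | zero => exact h
  | succ n ih => exact Subgroup.commutator_mono ih ih

theorem dser_succ_le {G : Type} [Group G] (H : Subgroup G) (n : ℕ) : dser H (n + 1) ≤ dser H n := by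
  induction n with
  | zero => exact Subgroup.commutator_le_self H
  | succ n ih => exact Subgroup.commutator_mono ih ih

theorem dser_anti {G : Type} [Group G] (H : Subgroup G) : Antitone (dser H) := antitone_nat_of_succ_le (dser_succ_le H)

theorem dser_map {G G' : Type} [Group G] [Group G'] (f : G →* G') (H : Subgroup G) (n : ℕ) :
    dser (H.map f) n = (dser H n).map f := by
  induction n with
  | zero => rfl
  | succ n ih => simp only [dser]; rw [ih, Subgroup.map_commutator]

theorem dser_solvable {G : Type} [Group G] (H : Subgroup G) (n : ℕ) (h : dser H n = ⊥) : IsSolvable H := by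
  have key : ∀ n, (derivedSeries H n).map H.subtype = dser H n := by
    intro n
    induction n with
    | zero => simp [dser, derivedSeries_zero, ← MonoidHom.range_eq_map]
    | succ n ih => rw [derivedSeries_succ, Subgroup.map_commutator, ih, dser]
  refine ⟨n, ?_⟩
  have := key n
  rw [h] at this
  exact (Subgroup.map_eq_bot_iff_of_injective _ H.subtype_injective).1 this

/-- virtual solvability modulo the kernel of a map -/
def VSm {G Q : Type} [Group G] [Monoid Q] (f : G →* Q) (C : Subgroup G) : Prop :=
  ∃ H : Subgroup G, H ≤ C ∧ H.relIndex C ≠ 0 ∧ ∃ n, dser H n ≤ f.ker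

theorem VSm.combine {G Q Q1 Q2 : Type} [Group G] [Monoid Q] [Monoid Q1] [Monoid Q2] {f : G →* Q} {f1 : G →* Q1} {f2 : G →* Q2}
    {C : Subgroup G} (h1 : VSm f1 C) (h2 : VSm f2 C)
    (hc : ∀ x y, f1 x = 1 → f2 x = 1 → f1 y = 1 → f2 y = 1 → f (x * y) = f (y * x)) : VSm f C := by
  obtain ⟨H1, hH1, hi1, n1, hn1⟩ := h1
  obtain ⟨H2, hH2, hi2, n2, hn2⟩ := h2
  refine ⟨H1 ⊓ H2, inf_le_left.trans hH1, Subgroup.relIndex_inf_ne_zero hi1 hi2, max n1 n2 + 1, ?_⟩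
  have k1 : dser (H1 ⊓ H2) (max n1 n2) ≤ f1.ker :=
    (dser_mono inf_le_left _).trans ((dser_anti H1 (le_max_left _ _)).trans hn1)
  have k2 : dser (H1 ⊓ H2) (max n1 n2) ≤ f2.ker :=
    (dser_mono inf_le_right _).trans ((dser_anti H2 (le_max_right _ _)).trans hn2)
  rw [dser, Subgroup.commutator_le]
  intro x hx y hy
  rw [MonoidHom.mem_ker, commutatorElement_def]
  have h3 := hc x y (k1 hx) (k2 hx) (k1 hy) (k2 hy)
  have : x * y * x⁻¹ * y⁻¹ = (x * y) * (y * x)⁻¹ := by group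
  rw [this, map_mul, h3, ← map_mul, mul_inv_cancel, map_one]

theorem VSm.of_le {G Q : Type} [Group G] [Monoid Q] {f : G →* Q} {C C' : Subgroup G} (h : VSm f C) (hC : C ≤ C')
    (hi : C.relIndex C' ≠ 0) : VSm f C' := by
  obtain ⟨H, hH, hHi, n⟩ := h
  refine ⟨H, hH.trans hC, ?_, n⟩
  rw [← Subgroup.relIndex_mul_relIndex _ _ _ hH hC]
  exact mul_ne_zero hHi hi

theorem VSm.map {G Q : Type} [Group G] [Monoid Q] {f : G →* Q} {H0 : Subgroup G} {C : Subgroup H0}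
    (h : VSm (f.comp H0.subtype) C) : VSm f (C.map H0.subtype) := by
  obtain ⟨H, hH, hHi, n, hn⟩ := h
  refine ⟨H.map H0.subtype, Subgroup.map_mono hH, ?_, n, ?_⟩
  · rwa [Subgroup.relIndex_map_map_of_injective _ _ H0.subtype_injective]
  · rw [dser_map, Subgroup.map_le_iff_le_comap]
    exact hn

theorem relIndex_ne_of_map {G T : Type} [Group G] [Finite T] {H C : Subgroup G} (φ : C → T)
    (h : ∀ x y : C, φ x = φ y → (x : G)⁻¹ * y ∈ H) : H.relIndex C ≠ 0 := by
  have : Finite (C ⧸ H.subgroupOf C) := by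
    refine Finite.of_injective (fun q : C ⧸ H.subgroupOf C => φ q.out) ?_
    intro q q' hq
    have h1 := h _ _ hq
    rw [← q.out_eq', ← q'.out_eq']
    exact QuotientGroup.eq.2 (Subgroup.mem_subgroupOf.2 (by simpa using h1))
  exact Subgroup.index_ne_zero_of_finite

theorem finite_pow {G : Type} [Group G] {T : Set G} (hT : T.Finite) (n : ℕ) : (T ^ n).Finite := by
  induction n with
  | zero => simp
  | succ n ih => rw [pow_succ]; exact ih.mul hT

/-- Schreier generators, for a symmetric set acting on a finite set -/
theorem schreier {G X : Type} [Group G] [MulAction G X] {T : Set G} (hT : Sym T) (W : Finset X) (N : ℕ) (hN : W.card ≤ N)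
    (hW : ∀ t ∈ T, ∀ w ∈ W, t • w ∈ W) (w0 : X) (hw0 : w0 ∈ W) :
    (Subgroup.closure (T ^ (2 * N + 1) ∩ {g | g • w0 = w0})).relIndex (Subgroup.closure T) ≠ 0 := by
  classical
  set D := Subgroup.closure (T ^ (2 * N + 1) ∩ {g | g • w0 = w0}) with hD
  have hWn : ∀ n, ∀ t ∈ T ^ n, ∀ w ∈ W, t • w ∈ W := by
    intro n
    induction n with
    | zero => intro t ht w hw; rw [pow_zero, Set.mem_one] at ht; subst ht; simpa using hw
    | succ n ih =>
      intro t ht w hw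
      rw [pow_succ] at ht
      obtain ⟨a, ha, b, hb, rfl⟩ := Set.mem_mul.1 ht
      rw [mul_smul]
      exact ih a ha _ (hW b hb w hw)
  set O : ℕ → Finset X := fun n => W.filter fun w => ∃ g ∈ T ^ n, g • w0 = w with hO
  have hOmono : Monotone O := by
    intro i j hij w hw
    rw [hO, Finset.mem_filter] at hw ⊢
    obtain ⟨h1, g, hg, h2⟩ := hw
    exact ⟨h1, g, hT.pow_mono hij hg, h2⟩
  obtain ⟨i, hi, he⟩ := nat_stab (fun n => (O n).card) (fun i j h => Finset.card_le_card (hOmono h)) N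
    (fun i => (Finset.card_le_card (Finset.filter_subset _ _)).trans hN)
  have heq : O i = O (i + 1) := Finset.eq_of_subset_of_card_le (hOmono (Nat.le_succ i)) he.symm.le
  have hstep : ∀ w ∈ O i, ∀ t ∈ T, t • w ∈ O i := by
    intro w hw t ht
    rw [heq]
    rw [hO, Finset.mem_filter] at hw ⊢
    obtain ⟨h1, g, hg, h2⟩ := hw
    refine ⟨hW t ht w h1, t * g, ?_, by rw [mul_smul, h2]⟩
    rw [pow_succ']
    exact Set.mul_mem_mul ht hg
  have hrep : ∀ w : X, ∃ g ∈ T ^ N, w ∈ O i → g • w0 = w := by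
    intro w
    by_cases h : w ∈ O i
    · have h' := h
      rw [hO, Finset.mem_filter] at h'
      obtain ⟨_, g, hg, h2⟩ := h'
      exact ⟨g, hT.pow_mono hi hg, fun _ => h2⟩
    · exact ⟨1, hT.one_mem_pow _, fun h' => absurd h' h⟩
  choose γ hγ1 hγ2 using hrep
  have hw0O : w0 ∈ O i := by
    rw [hO, Finset.mem_filter]
    exact ⟨hw0, 1, hT.one_mem_pow _, one_smul _ _⟩
  -- the main induction
  have hmain : ∀ n, ∀ g ∈ T ^ n, g • w0 ∈ O i ∧ (γ (g • w0))⁻¹ * g ∈ D := by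
    intro n
    induction n with
    | zero =>
      intro g hg
      rw [pow_zero, Set.mem_one] at hg
      subst hg
      rw [one_smul]
      refine ⟨hw0O, Subgroup.subset_closure ⟨?_, ?_⟩⟩
      · rw [mul_one]
        exact hT.pow_mono (by omega) (hT.inv_mem_pow (hγ1 w0))
      · show ((γ w0)⁻¹ * 1) • w0 = w0
        rw [mul_one, inv_smul_eq_iff, hγ2 w0 hw0O]
    | succ n ih =>
      intro g hg
      rw [pow_succ'] at hg
      obtain ⟨t, ht, b, hb, rfl⟩ := Set.mem_mul.1 hg
      obtain ⟨h1, h2⟩ := ih b hb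
      have h3 : (t * b) • w0 ∈ O i := by rw [mul_smul]; exact hstep _ h1 t ht
      refine ⟨h3, ?_⟩
      have h4 : (γ ((t * b) • w0))⁻¹ * t * γ (b • w0) ∈ D := by
        refine Subgroup.subset_closure ⟨?_, ?_⟩
        · have h5 := hT.mul_mem (k := N + 1) (hT.inv_mem_pow (hγ1 ((t * b) • w0))) (hT.subset_pow (le_refl 1) ht) le_rfl
          exact hT.mul_mem h5 (hγ1 _) (by omega)
        · show ((γ ((t * b) • w0))⁻¹ * t * γ (b • w0)) • w0 = w0
          rw [mul_smul, hγ2 _ h1, mul_smul, ← mul_smul t b, inv_smul_eq_iff, hγ2 _ h3]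
      have h6 := Subgroup.mul_mem _ h4 h2
      have e : (γ ((t * b) • w0))⁻¹ * t * γ (b • w0) * ((γ (b • w0))⁻¹ * b) = (γ ((t * b) • w0))⁻¹ * (t * b) := by group
      rwa [e] at h6
  refine relIndex_ne_of_map (T := W) (fun x => ⟨(x : G) • w0, ?_⟩) ?_
  · obtain ⟨n, hn⟩ := hT.closure.1 x.2
    exact hWn n _ hn _ hw0
  · intro x y hxy
    obtain ⟨n, hn⟩ := hT.closure.1 x.2
    obtain ⟨n', hn'⟩ := hT.closure.1 y.2
    have h1 := (hmain n _ hn).2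
    have h2 := (hmain n' _ hn').2
    have hxy' : (x : G) • w0 = (y : G) • w0 := congrArg Subtype.val hxy
    rw [← hxy'] at h2
    have h3 := Subgroup.mul_mem _ (Subgroup.inv_mem _ h1) h2
    have e : ((γ ((x : G) • w0))⁻¹ * (x : G))⁻¹ * ((γ ((x : G) • w0))⁻¹ * (y : G)) = (x : G)⁻¹ * y := by group
    rwa [e] at h3

end UPE
end

section
open scoped MatrixGroups Pointwise

namespace UPE

/-- the inductive statement, matrix version -/
def EMat (m : ℕ) (ε : ℝ) : Prop :=
  ∀ (K : Type) [Field K] [IsAlgClosed K] [Countable K] (G Y : Type) [Group G] [MulAction G Y],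
    (∀ (g : G) (y : Y), g • y = y → g = 1) → ∀ (A : Finset Y), A.Nonempty →
    ∀ (r : G →* Matrix (Fin m) (Fin m) K) (F : Set G), F.Finite →
    (∀ f ∈ F, (esc A (MulAction.toPerm f) : ℝ) ≤ ε * A.card) → VSm r (Subgroup.closure F)

/-- the inductive statement, linear map version -/
def EV (m : ℕ) (ε : ℝ) : Prop :=
  ∀ (K : Type) [Field K] [IsAlgClosed K] [Countable K] (V : Type) [AddCommGroup V] [Module K V] [FiniteDimensional K V],
    Module.finrank K V = m → ∀ (G Y : Type) [Group G] [MulAction G Y],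
    (∀ (g : G) (y : Y), g • y = y → g = 1) → ∀ (A : Finset Y), A.Nonempty →
    ∀ (r : G →* Module.End K V) (F : Set G), F.Finite →
    (∀ f ∈ F, (esc A (MulAction.toPerm f) : ℝ) ≤ ε * A.card) → VSm r (Subgroup.closure F)

theorem VSm.of_ker {G Q Q' : Type} [Group G] [Monoid Q] [Monoid Q'] {f : G →* Q} {f' : G →* Q'} {C : Subgroup G}
    (h : VSm f C) (hk : ∀ g, f g = 1 → f' g = 1) : VSm f' C := by
  obtain ⟨H, h1, h2, n, h3⟩ := h
  exact ⟨H, h1, h2, n, fun g hg => hk g (h3 hg)⟩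

theorem EMat.toEV {m : ℕ} {ε : ℝ} (h : EMat m ε) : EV m ε := by
  intro K _ _ _ V _ _ _ hV G Y _ _ hfree A hA r F hF hesc
  let b := Module.finBasisOfFinrankEq K V hV
  let e := LinearMap.toMatrixAlgEquiv b
  have := h K G Y hfree A hA ((e : Module.End K V →* Matrix (Fin m) (Fin m) K).comp r) F hF hesc
  refine this.of_ker ?_
  intro g hg
  apply e.injective
  rw [map_one]
  exact hg

theorem EMat.mono {m : ℕ} {ε ε' : ℝ} (h : EMat m ε) (hε : ε' ≤ ε) : EMat m ε' := by
  intro K _ _ _ G Y _ _ hfree A hA r F hF hesc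
  exact h K G Y hfree A hA r F hF fun f hf => (hesc f hf).trans (by gcongr)

theorem esc_set_pow {G Y : Type} [Group G] [MulAction G Y] {A : Finset Y} {T : Set G} {ε : ℝ}
    (h : ∀ f ∈ T, (esc A (MulAction.toPerm f) : ℝ) ≤ ε * A.card) (n : ℕ) :
    ∀ f ∈ T ^ n, (esc A (MulAction.toPerm f) : ℝ) ≤ n * ε * A.card := by
  induction n with
  | zero =>
    intro f hf
    rw [pow_zero, Set.mem_one] at hf
    subst hf
    have : (MulAction.toPerm (1 : G) : Equiv.Perm Y) = 1 := by ext y; simp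
    rw [this, esc_one]; simp
  | succ n ih =>
    intro f hf
    rw [pow_succ] at hf
    obtain ⟨a, ha, b, hb, rfl⟩ := Set.mem_mul.1 hf
    have : (MulAction.toPerm (a * b) : Equiv.Perm Y) = MulAction.toPerm a * MulAction.toPerm b := by
      ext y; simp [mul_smul]
    rw [this]
    have h1 : (esc A (MulAction.toPerm a * MulAction.toPerm b) : ℝ) ≤ esc A (MulAction.toPerm a) + esc A (MulAction.toPerm b) := by
      exact_mod_cast esc_mul A _ _
    have h2 := ih a ha
    have h3 := h b hb
    push_cast
    linarith

/-- action of a group on subspaces -/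
def subAct {K V G : Type} [Field K] [AddCommGroup V] [Module K V] [Group G] (ρ : G →* Module.End K V) :
    MulAction G (Submodule K V) where
  smul g w := w.map (ρ g)
  one_smul w := by
    show w.map (ρ 1) = w
    rw [map_one]; exact Submodule.map_id w
  mul_smul g h w := by
    show w.map (ρ (g * h)) = (w.map (ρ h)).map (ρ g)
    rw [map_mul, ← Submodule.map_comp]; rfl

theorem reduce_step {m N : ℕ} {ε ε' : ℝ} (IH : ∀ j < m, EMat j ε') (hε : (2 * N + 1) * ε ≤ ε')
    (K : Type) [Field K] [IsAlgClosed K] [Countable K] (V : Type) [AddCommGroup V] [Module K V] [FiniteDimensional K V]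
    (hV : Module.finrank K V = m) (G Y : Type) [Group G] [MulAction G Y]
    (hfree : ∀ (g : G) (y : Y), g • y = y → g = 1) (A : Finset Y) (hA : A.Nonempty)
    (ρ : G →* Module.End K V) (T : Set G) (hT : Sym T) (hTf : T.Finite)
    (hesc : ∀ f ∈ T, (esc A (MulAction.toPerm f) : ℝ) ≤ ε * A.card)
    (W : Finset (Submodule K V)) (hWN : W.card ≤ N) (hW : ∀ t ∈ T, ∀ w ∈ W, w.map (ρ t) ∈ W)
    (w0 : Submodule K V) (hw0 : w0 ∈ W) (hb : w0 ≠ ⊥) (ht : w0 ≠ ⊤) : VSm ρ (Subgroup.closure T) := by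
  let _ : MulAction G (Submodule K V) := subAct ρ
  have hsch := schreier hT W N hWN hW w0 hw0
  let H0 : Subgroup G := MulAction.stabilizer G w0
  have hH0 : ∀ g : H0, w0.map (ρ g) = w0 := fun g => g.2
  have hH0' : ∀ g : H0, ∀ v ∈ w0, ρ g v ∈ w0 := by
    intro g v hv
    have := Submodule.mem_map_of_mem (f := ρ g) hv
    rwa [hH0] at this
  let ρ1 : H0 →* Module.End K w0 :=
    { toFun := fun g => (ρ g).restrict (hH0' g)
      map_one' := by ext v; simp
      map_mul' := by intro g h; ext v; simp }
  let ρ2 : H0 →* Module.End K (V ⧸ w0) :=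
    { toFun := fun g => w0.mapQ w0 (ρ g) (hH0' g)
      map_one' := by ext v; simp
      map_mul' := by intro g h; ext v; simp }
  let F : Set H0 := {g | (g : G) ∈ T ^ (2 * N + 1)}
  have hF : F.Finite := (finite_pow hTf (2 * N + 1)).preimage (H0.subtype_injective.injOn)
  have hfree' : ∀ (g : H0) (y : Y), g • y = y → g = 1 := fun g y h => Subtype.ext (hfree g y h)
  have hesc' : ∀ f ∈ F, (esc A (MulAction.toPerm f) : ℝ) ≤ ε' * A.card := by
    intro f hf
    have h1 := esc_set_pow hesc (2 * N + 1) f hf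
    refine h1.trans ?_
    push_cast
    gcongr
  have d1 : Module.finrank K w0 < m := by rw [← hV]; exact Submodule.finrank_lt ht
  have d2 : Module.finrank K (V ⧸ w0) < m := by
    have h1 := w0.finrank_quotient_add_finrank
    have h2 : Module.finrank K w0 ≠ 0 := by rwa [Ne, Submodule.finrank_eq_zero]
    omega
  have v1 := (IH _ d1).toEV K w0 rfl H0 Y hfree' A hA ρ1 F hF hesc'
  have v2 := (IH _ d2).toEV K (V ⧸ w0) rfl H0 Y hfree' A hA ρ2 F hF hesc'
  have v3 : VSm (ρ.comp H0.subtype) (Subgroup.closure F) := by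
    refine VSm.combine v1 v2 ?_
    have hq : ∀ x, ρ2 x = 1 → ∀ v, ρ x v - v ∈ w0 := by
      intro x hx v
      have := congrArg (fun f : Module.End K (V ⧸ w0) => f (Submodule.Quotient.mk v)) hx
      exact (Submodule.Quotient.eq w0).1 this
    have hs : ∀ x, ρ1 x = 1 → ∀ v ∈ w0, ρ x v = v := by
      intro x hx v hv
      have := congrArg (fun f : Module.End K w0 => ((f ⟨v, hv⟩ : w0) : V)) hx
      exact this
    have key : ∀ x y, ρ1 x = 1 → ρ2 y = 1 → ∀ v, ρ x (ρ y v) = ρ x v + ρ y v - v := by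
      intro x y h1 h2 v
      have h3 := hs x h1 _ (hq y h2 v)
      rw [map_sub] at h3
      rw [sub_eq_iff_eq_add] at h3
      rw [h3]; abel
    intro x y x1 x2 y1 y2
    rw [map_mul, map_mul]
    ext v
    show ρ x (ρ y v) = ρ y (ρ x v)
    rw [key x y x1 y2, key y x y1 x2]; abel
  have hcl : (Subgroup.closure F).map H0.subtype = Subgroup.closure (T ^ (2 * N + 1) ∩ {g | g • w0 = w0}) := by
    rw [MonoidHom.map_closure]
    congr 1
    ext g
    constructor
    · rintro ⟨x, hx, rfl⟩
      exact ⟨hx, x.2⟩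
    · rintro ⟨h1, h2⟩
      exact ⟨⟨g, h2⟩, h1, rfl⟩
  have v4 := v3.map
  rw [hcl] at v4
  refine v4.of_le ?_ hsch
  rw [Subgroup.closure_le]
  rintro g ⟨hg, _⟩
  exact hT.closure.2 ⟨_, hg⟩

end UPE
end

section
open scoped MatrixGroups Pointwise

namespace UPE

theorem roots_finite {K : Type} [Field K] {m : ℕ} (hm : 0 < m) (a : K) : {c : K | c ^ m = a}.Finite := by
  classical
  refine (Polynomial.nthRoots m a).toFinset.finite_toSet.subset ?_
  intro c hc
  simpa [Polynomial.mem_nthRoots hm] using hc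

theorem sym_closure {G : Type} [Group G] (F : Set G) : Subgroup.closure (F ∪ F⁻¹ ∪ {1}) = Subgroup.closure F := by
  apply le_antisymm
  · rw [Subgroup.closure_le]
    rintro x ((hx | hx) | hx)
    · exact Subgroup.subset_closure hx
    · have := Subgroup.inv_mem _ (Subgroup.subset_closure (Set.mem_inv.1 hx))
      rwa [inv_inv] at this
    · rw [Set.mem_singleton_iff] at hx; subst hx; exact Subgroup.one_mem _
  · exact Subgroup.closure_mono fun x hx => Or.inl (Or.inl hx)

/-- projection of a free action to the group, along orbit representatives -/
theorem free_proj {G Y : Type} [Group G] [MulAction G Y] (hfree : ∀ (g : G) (y : Y), g • y = y → g = 1) :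
    ∃ φ : Y → G, ∀ g y, φ (g • y) = g * φ y := by
  let rep : Y → Y := fun y => (Quotient.mk (MulAction.orbitRel G Y) y).out
  have hrep : ∀ y, ∃ g : G, g • rep y = y := by
    intro y
    have : (MulAction.orbitRel G Y) (rep y) y := Quotient.mk_out (s := MulAction.orbitRel G Y) y
    rw [MulAction.orbitRel_apply] at this
    obtain ⟨g, hg⟩ := this
    refine ⟨g⁻¹, ?_⟩
    rw [inv_smul_eq_iff]; exact hg.symm
  choose φ hφ using hrep
  refine ⟨φ, fun g y => ?_⟩
  have h0 : rep (g • y) = rep y := by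
    show (Quotient.mk (MulAction.orbitRel G Y) (g • y)).out = (Quotient.mk (MulAction.orbitRel G Y) y).out
    congr 1
    exact Quotient.sound (s := MulAction.orbitRel G Y) (MulAction.mem_orbit y g)
  have h1 := hφ (g • y)
  rw [h0] at h1
  have h2 : ((φ (g • y))⁻¹ * (g * φ y)) • rep y = rep y := by
    rw [mul_smul, mul_smul, hφ y, inv_smul_eq_iff, h1]
  have := hfree _ _ h2
  rw [inv_mul_eq_one] at this
  exact this

theorem emat_step (m : ℕ) (hm : 0 < m) {ε' : ℝ} (hε' : 0 < ε') (IH : ∀ j < m, EMat j ε') : ∃ ε : ℝ, 0 < ε ∧ EMat m ε := by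
  obtain ⟨N, L, R, M, hR, hM, hdata⟩ := data_theorem m hm
  have hR0 : (1:ℝ) ≤ R := by exact_mod_cast hR
  have hM0 : (1:ℝ) ≤ M := by exact_mod_cast hM
  set δ : ℝ := 1 / (32 * R ^ 2 * M * (L + 1)) with hδ
  have hδ0 : 0 < δ := by positivity
  refine ⟨min δ (ε' / (2 * N + 1)), by positivity, ?_⟩
  set ε := min δ (ε' / (2 * N + 1)) with hεd
  have hε0 : 0 < ε := by positivity
  have hε1 : ε ≤ δ := min_le_left _ _
  have hε2 : (2 * N + 1) * ε ≤ ε' := by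
    have h1 : ε ≤ ε' / (2 * N + 1) := min_le_right _ _
    rw [le_div_iff₀ (by positivity)] at h1
    linarith
  intro K _ _ _ G Y _ _ hfree A hA r F hF hesc
  set T : Set G := F ∪ F⁻¹ ∪ {1} with hTdef
  have hT : Sym T := by
    refine ⟨Or.inr rfl, ?_⟩
    rintro s ((hs | hs) | hs)
    · exact Or.inl (Or.inr (by simpa using hs))
    · exact Or.inl (Or.inl hs)
    · rw [Set.mem_singleton_iff] at hs; subst hs; exact Or.inr (by simp)
  have hTf : T.Finite := (hF.union hF.inv).union (Set.finite_singleton 1)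
  have hescT : ∀ f ∈ T, (esc A (MulAction.toPerm f) : ℝ) ≤ ε * A.card := by
    rintro s ((hs | hs) | hs)
    · exact hesc s hs
    · have h1 := hesc _ (Set.mem_inv.1 hs)
      have : (MulAction.toPerm s⁻¹ : Equiv.Perm Y) = (MulAction.toPerm s)⁻¹ := by
        rw [eq_inv_iff_mul_eq_one]; ext y; simp
      rw [this, esc_inv] at h1
      exact h1
    · rw [Set.mem_singleton_iff] at hs; subst hs
      have : (MulAction.toPerm (1 : G) : Equiv.Perm Y) = 1 := by ext y; simp
      rw [this, esc_one]; simp; positivity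
  rw [← sym_closure F, ← hTdef]
  have hne : Nonempty (Fin m) := ⟨⟨0, hm⟩⟩
  have hunit : ∀ g, IsUnit (r g) := fun g => (Group.isUnit g).map r
  have hdet : ∀ g, (r g).det ≠ 0 := fun g => ((Matrix.isUnit_iff_isUnit_det _).1 (hunit g)).ne_zero
  have hlift : ∀ g, ∃ x : Matrix.SpecialLinearGroup (Fin m) K, ∃ c : K, c ≠ 0 ∧ (x : Matrix (Fin m) (Fin m) K) = c • r g := by
    intro g
    obtain ⟨c, hc⟩ := IsAlgClosed.exists_pow_nat_eq ((r g).det)⁻¹ hm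
    have hc0 : c ≠ 0 := by
      rintro rfl
      rw [zero_pow hm.ne'] at hc
      exact inv_ne_zero (hdet g) hc.symm
    refine ⟨⟨c • r g, ?_⟩, c, hc0, rfl⟩
    rw [Matrix.det_smul, Fintype.card_fin, hc, inv_mul_cancel₀ (hdet g)]
  set S : Set (Matrix.SpecialLinearGroup (Fin m) K) := {x | ∃ f ∈ T, ∃ c : K, c ≠ 0 ∧ (x : Matrix (Fin m) (Fin m) K) = c • r f} with hSdef
  have hinv : ∀ (x : Matrix.SpecialLinearGroup (Fin m) K) (g : G) (c : K), c ≠ 0 → (x : Matrix (Fin m) (Fin m) K) = c • r g →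
      ((x⁻¹ : Matrix.SpecialLinearGroup (Fin m) K) : Matrix (Fin m) (Fin m) K) = c⁻¹ • r g⁻¹ := by
    intro x g c hc hx
    have h1 : ((x⁻¹ : Matrix.SpecialLinearGroup (Fin m) K) : Matrix (Fin m) (Fin m) K) * (x : Matrix (Fin m) (Fin m) K) = 1 := by
      rw [← Matrix.SpecialLinearGroup.coe_mul, inv_mul_cancel, Matrix.SpecialLinearGroup.coe_one]
    have h2 : (x : Matrix (Fin m) (Fin m) K) * (c⁻¹ • r g⁻¹) = 1 := by
      rw [hx, Matrix.smul_mul, Matrix.mul_smul, smul_smul, mul_inv_cancel₀ hc, one_smul, ← map_mul, mul_inv_cancel, map_one]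
    exact left_inv_eq_right_inv h1 h2
  have hS : Sym S := by
    refine ⟨⟨1, hT.one, 1, one_ne_zero, by simp⟩, ?_⟩
    rintro x ⟨f, hf, c, hc, hx⟩
    exact ⟨f⁻¹, hT.inv f hf, c⁻¹, inv_ne_zero hc, hinv x f c hc hx⟩
  have hSf : S.Finite := by
    have h1 : S ⊆ ⋃ f ∈ T, Subtype.val ⁻¹' ((fun c : K => c • r f) '' {c | c ^ m = ((r f).det)⁻¹}) := by
      rintro x ⟨f, hf, c, hc, hx⟩
      refine Set.mem_biUnion hf ⟨c, ?_, hx.symm⟩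
      have h2 := x.2
      have h3 : (c • r f).det = 1 := by rw [← hx]; exact h2
      rw [Matrix.det_smul, Fintype.card_fin] at h3
      exact eq_inv_of_mul_eq_one_left h3
    refine (hTf.biUnion fun f _ => ?_).subset h1
    exact ((roots_finite hm _).image _).preimage Subtype.val_injective.injOn
  have hcl : ∀ g ∈ Subgroup.closure T, ∃ x ∈ Subgroup.closure S, ∃ c : K, c ≠ 0 ∧ (x : Matrix (Fin m) (Fin m) K) = c • r g := by
    intro g hg
    induction hg using Subgroup.closure_induction with
    | mem f hf =>
      obtain ⟨x, c, hc, hx⟩ := hlift f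
      exact ⟨x, Subgroup.subset_closure ⟨f, hf, c, hc, hx⟩, c, hc, hx⟩
    | one => exact ⟨1, Subgroup.one_mem _, 1, one_ne_zero, by simp⟩
    | mul a b _ _ ha hb =>
      obtain ⟨x, hx, c, hc, hxc⟩ := ha
      obtain ⟨y, hy, d, hd, hyd⟩ := hb
      refine ⟨x * y, Subgroup.mul_mem _ hx hy, c * d, mul_ne_zero hc hd, ?_⟩
      rw [Matrix.SpecialLinearGroup.coe_mul, hxc, hyd, map_mul, Matrix.smul_mul, Matrix.mul_smul, smul_smul]
    | inv a _ ha =>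
      obtain ⟨x, hx, c, hc, hxc⟩ := ha
      exact ⟨x⁻¹, Subgroup.inv_mem _ hx, c⁻¹, inv_ne_zero hc, hinv x a c hc hxc⟩
  by_cases hSI : SI N S
  · by_cases hinf : (Subgroup.closure S : Set (Matrix.SpecialLinearGroup (Fin m) K)).Infinite
    · exfalso
      obtain ⟨φ, hφ⟩ := free_proj hfree
      refine PingData.contra (A := A) (pt := fun y => r (φ y)) (hdata K S hS hSf hSI hinf) hM hR hA ?_ ?_
      · intro y h0
        have := hdet (φ y)
        rw [show r (φ y) = 0 from h0, Matrix.det_zero] at this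
        exact this rfl
      · rintro x ⟨f, hf, c, hc, hx⟩
        refine ⟨MulAction.toPerm f, ?_, ?_⟩
        · intro y
          refine ⟨c⁻¹, inv_ne_zero hc, ?_⟩
          show r (φ (f • y)) = c⁻¹ • ((x : Matrix (Fin m) (Fin m) K) * r (φ y))
          rw [hφ, map_mul, hx, Matrix.smul_mul, smul_smul, inv_mul_cancel₀ hc, one_smul]
        · refine (hescT f hf).trans ?_
          rw [← hδ]
          gcongr
    · rw [Set.not_infinite] at hinf
      choose x hx c hc hxc using hcl
      have : Finite (Subgroup.closure S) := hinf
      let H : Subgroup G := 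
        { carrier := {g | g ∈ Subgroup.closure T ∧ ∃ c : K, r g = c • 1}
          one_mem' := ⟨Subgroup.one_mem _, 1, by simp⟩
          mul_mem' := by
            rintro a b ⟨ha, c, hc⟩ ⟨hb, d, hd⟩
            exact ⟨Subgroup.mul_mem _ ha hb, c * d, by rw [map_mul, hc, hd]; simp [smul_smul, mul_comm]⟩
          inv_mem' := by
            rintro a ⟨ha, c, hc⟩
            refine ⟨Subgroup.inv_mem _ ha, c⁻¹, ?_⟩
            have hc0 : c ≠ 0 := by
              rintro rfl
              have := hdet a
              rw [hc, zero_smul, Matrix.det_zero] at this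
              exact this rfl
            have h1 : r a⁻¹ * r a = 1 := by rw [← map_mul, inv_mul_cancel, map_one]
            have h2 : r a * (c⁻¹ • 1) = 1 := by
              rw [hc, Matrix.smul_mul, Matrix.mul_smul, smul_smul, mul_inv_cancel₀ hc0, one_smul, mul_one]
            exact left_inv_eq_right_inv h1 h2 }
      refine ⟨H, fun g hg => hg.1, ?_, 1, ?_⟩
      · refine relIndex_ne_of_map (T := Subgroup.closure S) (fun g => ⟨x g g.2, hx g g.2⟩) ?_
        intro a b hab
        have h1 : x a a.2 = x b b.2 := congrArg Subtype.val hab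
        refine ⟨Subgroup.mul_mem _ (Subgroup.inv_mem _ a.2) b.2, (c b b.2)⁻¹ * c a a.2, ?_⟩
        have h2 := hxc a a.2
        have h3 := hxc b b.2
        rw [h1, h3] at h2
        have h4 : r b = ((c b b.2)⁻¹ * c a a.2) • r a := by
          rw [← smul_smul, ← h2, smul_smul, inv_mul_cancel₀ (hc _ _), one_smul]
        rw [map_mul, h4, Matrix.mul_smul, ← map_mul, inv_mul_cancel, map_one]
      · show ⁅H, H⁆ ≤ r.ker
        rw [Subgroup.commutator_le]
        rintro a ⟨_, ca, ha⟩ b ⟨_, cb, hb⟩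
        rw [MonoidHom.mem_ker, commutatorElement_def]
        have : a * b * a⁻¹ * b⁻¹ = (a * b) * (b * a)⁻¹ := by group
        have h3 : r (a * b) = r (b * a) := by
          rw [map_mul, map_mul, ha, hb]; simp [smul_smul, mul_comm]
        rw [this, map_mul, h3, ← map_mul, mul_inv_cancel, map_one]
  · unfold SI at hSI
    push Not at hSI
    obtain ⟨W, hWne, hWN, hWp, hWst⟩ := hSI
    obtain ⟨w0, hw0⟩ := hWne
    let e : Matrix (Fin m) (Fin m) K ≃ₐ[K] Module.End K (Fin m → K) := Matrix.toLinAlgEquiv'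
    have key := reduce_step IH hε2 K (Fin m → K) (by simp) G Y hfree A hA
      ((e : Matrix (Fin m) (Fin m) K →* Module.End K (Fin m → K)).comp r) T hT hTf hescT W hWN ?_ w0 hw0 (hWp w0 hw0).1 (hWp w0 hw0).2
    · refine key.of_ker ?_
      intro g hg
      apply e.injective
      rw [map_one]
      exact hg
    · intro t ht w hw
      obtain ⟨x, c, hc, hx⟩ := hlift t
      have h1 := hWst x ⟨t, ht, c, hc, hx⟩ w hw
      rw [hx, map_smul, Submodule.map_smul _ _ _ hc] at h1
      exact h1

theorem emat_zero : EMat 0 1 := by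
  intro K _ _ _ G Y _ _ hfree A hA r F hF hesc
  refine ⟨_, le_rfl, by simp, 0, ?_⟩
  intro g _
  exact Subsingleton.elim _ _

theorem emat_all (m : ℕ) : ∃ ε : ℝ, 0 < ε ∧ ∀ j ≤ m, EMat j ε := by
  induction m with
  | zero => exact ⟨1, one_pos, fun j hj => (Nat.le_zero.1 hj) ▸ emat_zero⟩
  | succ m ih =>
    obtain ⟨ε', h0, h1⟩ := ih
    obtain ⟨ε, h2, h3⟩ := emat_step (m + 1) (Nat.succ_pos m) h0 (fun j hj => h1 j (by omega))
    refine ⟨min ε ε', by positivity, fun j hj => ?_⟩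
    rcases Nat.lt_or_ge m j with h | h
    · obtain rfl : j = m + 1 := by omega
      exact h3.mono (min_le_left _ _)
    · exact (h1 j h).mono (min_le_right _ _)

end UPE
end

section
open scoped MatrixGroups Pointwise

namespace UPE

theorem gl_map_inj {d : ℕ} {k K : Type} [Field k] [Field K] (f : k →+* K) :
    Function.Injective (Matrix.GeneralLinearGroup.map (n := Fin d) f) := by
  intro a b hab
  apply Units.ext
  ext i j
  apply f.injective
  have := congrArg (fun g : GL (Fin d) K => (g : Matrix (Fin d) (Fin d) K) i j) hab
  simpa using this

theorem final (d : ℕ) : ∃ ε : ℝ, 0 < ε ∧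
      ∀ (K : Type) [Field K], ∀ F : Set (GL (Fin d) K),
        F.Finite → (1 : GL (Fin d) K) ∈ F →
        ¬(∃ H : Subgroup ↥(Subgroup.closure F), H.FiniteIndex ∧ IsSolvable ↥H) →
        ∀ A : Set (GL (Fin d) K), A.Finite →
          (1 + ε) * (A.ncard : ℝ) ≤ ((F * A).ncard : ℝ) := by
  classical
  obtain ⟨ε, hε, hall⟩ := emat_all d
  refine ⟨ε, hε, ?_⟩
  intro K _ F hF h1 hns A hA
  by_contra hcon
  push Not at hcon
  apply hns
  have hAne : A.Nonempty := by
    by_contra h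
    rw [Set.not_nonempty_iff_eq_empty] at h
    subst h
    simp at hcon
  -- the field of definition
  let E : Set K := (⋃ f ∈ F, Set.range fun p : Fin d × Fin d => (f : Matrix (Fin d) (Fin d) K) p.1 p.2) ∪
    (⋃ f ∈ F, Set.range fun p : Fin d × Fin d => ((f⁻¹ : GL (Fin d) K) : Matrix (Fin d) (Fin d) K) p.1 p.2)
  have hE : E.Finite := (hF.biUnion fun f _ => Set.finite_range _).union (hF.biUnion fun f _ => Set.finite_range _)
  let k : Subfield K := Subfield.closure E
  have hk : Countable k := by
    rw [← Cardinal.mk_le_aleph0_iff]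
    refine (Subfield.cardinalMk_closure_le_max E).trans (max_le ?_ le_rfl)
    have := hE.countable.to_subtype
    exact Cardinal.mk_le_aleph0
  have hkb : Countable (AlgebraicClosure k) := by
    rw [← Cardinal.mk_le_aleph0_iff]
    refine (Algebra.IsAlgebraic.cardinalMk_le_max k (AlgebraicClosure k)).trans (max_le ?_ le_rfl)
    exact Cardinal.mk_le_aleph0
  let G := GL (Fin d) k
  let ι : G →* GL (Fin d) K := Matrix.GeneralLinearGroup.map k.subtype
  have hι : Function.Injective ι := gl_map_inj _
  let r0 : G →* GL (Fin d) (AlgebraicClosure k) := Matrix.GeneralLinearGroup.map (algebraMap k (AlgebraicClosure k))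
  have hr0 : Function.Injective r0 := gl_map_inj _
  let r : G →* Matrix (Fin d) (Fin d) (AlgebraicClosure k) := (Units.coeHom _).comp r0
  have hr : ∀ g, r g = 1 → g = 1 := by
    intro g hg
    apply hr0
    rw [map_one]
    exact Units.ext hg
  have hlift : ∀ f ∈ F, ∃ g : G, ι g = f := by
    intro f hf
    have e1 : ∀ i j, (f : Matrix (Fin d) (Fin d) K) i j ∈ k := fun i j =>
      Subfield.subset_closure (Or.inl (Set.mem_biUnion hf ⟨(i, j), rfl⟩))
    have e2 : ∀ i j, ((f⁻¹ : GL (Fin d) K) : Matrix (Fin d) (Fin d) K) i j ∈ k := fun i j =>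
      Subfield.subset_closure (Or.inr (Set.mem_biUnion hf ⟨(i, j), rfl⟩))
    have hinj : Function.Injective (k.subtype.mapMatrix : Matrix (Fin d) (Fin d) k →+* Matrix (Fin d) (Fin d) K) := by
      intro a b hab
      ext i j
      exact congrFun (congrFun hab i) j
    have m1 : k.subtype.mapMatrix (Matrix.of fun i j => (⟨_, e1 i j⟩ : k)) = (f : Matrix (Fin d) (Fin d) K) := by
      ext i j; rfl
    have m2 : k.subtype.mapMatrix (Matrix.of fun i j => (⟨_, e2 i j⟩ : k)) = ((f⁻¹ : GL (Fin d) K) : Matrix (Fin d) (Fin d) K) := by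
      ext i j; rfl
    refine ⟨⟨Matrix.of fun i j => ⟨_, e1 i j⟩, Matrix.of fun i j => ⟨_, e2 i j⟩, ?_, ?_⟩, ?_⟩
    · apply hinj
      rw [map_mul, m1, m2, map_one, ← Units.val_mul, mul_inv_cancel, Units.val_one]
    · apply hinj
      rw [map_mul, m1, m2, map_one, ← Units.val_mul, inv_mul_cancel, Units.val_one]
    · apply Units.ext
      exact m1
  let F0 : Set G := ι ⁻¹' F
  have hF0 : F0.Finite := hF.preimage hι.injOn
  have hFF : ι '' F0 = F := Set.image_preimage_eq_of_subset (fun f hf => hlift f hf)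
  let _ : MulAction G (GL (Fin d) K) := MulAction.compHom _ ι
  have hsm : ∀ (g : G) (y : GL (Fin d) K), g • y = ι g * y := fun g y => rfl
  have hfree : ∀ (g : G) (y : GL (Fin d) K), g • y = y → g = 1 := by
    intro g y h
    rw [hsm, mul_eq_right] at h
    apply hι
    rw [h, map_one]
  have hesc : ∀ f ∈ F0, (esc hA.toFinset (MulAction.toPerm f) : ℝ) ≤ ε * hA.toFinset.card := by
    intro f hf
    have hFA : (F * A).Finite := hF.mul hA
    have h2 : A ⊆ F * A := fun a ha => ⟨1, h1, a, ha, one_mul a⟩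
    have h3 : esc hA.toFinset (MulAction.toPerm f) ≤ (hFA.toFinset \ hA.toFinset).card := by
      unfold esc
      refine Finset.card_le_card_of_injOn (fun y => f • y) ?_ (MulAction.injective f).injOn
      intro y hy
      simp only [Finset.coe_filter, Set.Finite.mem_toFinset, Set.mem_setOf_eq, MulAction.toPerm_apply] at hy
      simp only [Finset.coe_sdiff, Set.Finite.coe_toFinset]
      exact ⟨⟨ι f, hf, y, hy.1, rfl⟩, hy.2⟩
    have h4 : (hFA.toFinset \ hA.toFinset).card + hA.toFinset.card = hFA.toFinset.card :=
      Finset.card_sdiff_add_card_eq_card (by simpa using h2)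
    rw [Set.ncard_eq_toFinset_card _ hFA, Set.ncard_eq_toFinset_card _ hA] at hcon
    rw [← h4] at hcon
    push_cast at hcon
    have h5 : (esc hA.toFinset (MulAction.toPerm f) : ℝ) ≤ ((hFA.toFinset \ hA.toFinset).card : ℝ) := by exact_mod_cast h3
    linarith
  obtain ⟨H, hHle, hHi, n, hn⟩ := hall d le_rfl (AlgebraicClosure k) G (GL (Fin d) K) hfree hA.toFinset
    (by simpa using hAne) r F0 hF0 hesc
  have hbot : dser H n = ⊥ := by
    rw [eq_bot_iff]
    intro g hg
    exact Subgroup.mem_bot.2 (hr g (hn hg))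
  have hclF : Subgroup.closure F = (Subgroup.closure F0).map ι := by
    rw [MonoidHom.map_closure, hFF]
  refine ⟨(H.map ι).subgroupOf (Subgroup.closure F), ⟨?_⟩, ?_⟩
  · show (H.map ι).relIndex (Subgroup.closure F) ≠ 0
    rw [hclF, Subgroup.relIndex_map_map_of_injective _ _ hι]
    exact hHi
  · have hsol : Group.IsSolvable (H.map ι) := dser_solvable _ n (by rw [dser_map, hbot, Subgroup.map_bot])
    have hle : H.map ι ≤ Subgroup.closure F := by rw [hclF]; exact Subgroup.map_mono hHle
    exact Group.isSolvable_of_isSolvable_injective (f := (Subgroup.subgroupOfEquivOfLe hle).toMonoidHom) (Subgroup.subgroupOfEquivOfLe hle).injective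

end UPE
end

/-- **Uniform expansion.** For every `d ≥ 1` there is `ε = ε(d) > 0` such that if `F` is a finite
subset of `GL_d(K)` containing the identity and generating a non virtually solvable subgroup,
then for every finite subset `A` of `GL_d(K)` one has `|F·A| ≥ (1+ε)·|A|`. -/
theorem uniform_product_set_expansion :
    ∀ d : ℕ, 1 ≤ d → ∃ ε : ℝ, 0 < ε ∧
      ∀ (K : Type) [Field K], ∀ F : Set (GL (Fin d) K),
        F.Finite → (1 : GL (Fin d) K) ∈ F →
        ¬(∃ H : Subgroup ↥(Subgroup.closure F), H.FiniteIndex ∧ IsSolvable ↥H) →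
        ∀ A : Set (GL (Fin d) K), A.Finite →
          (1 + ε) * (A.ncard : ℝ) ≤ ((F * A).ncard : ℝ) := by
  exact fun d _ => UPE.final d
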